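/- Assume g = m + h satisfies the wave-coordinate condition. Then there is a universal constant C such that pointwise: |P(∂h,∂h,∂ψ,∂ψ)|_{𝒯𝒰} ≤ C|∂̄W||∂W|, and |P(∂h,∂h,∂ψ,∂ψ)|_{𝒰𝒰} ≤ C(|∂W|_G² + |∂̄W||∂W| + |W||∂W|²). Furthermore, if |Z^J W| ≤ C₀ for all |J| ≤ |I| and all Z ∈ 𝒵, then |Z^I P(∂h,∂h,∂ψ,∂ψ)|_{𝒰𝒰} ≤ C(Σ_{|J|+|K|≤|I|}(|∂Z^JW|_G|∂Z^KW|_G + |∂̄Z^JW||∂Z^KW|) + Σ_{|J|+|K|≤|I|}|∂Z^Kh|_{𝒰𝒰}[Σ_{|J'|≤|J|−1}|∂Z^{J'}h|_{ℒ𝒯} + Σ_{|J''|≤|J|−2}|∂Z^{J''}h| + Σ_{|J₁|+|J₂|≤|J|}|Z^{J₂}h||∂Z^{J₁}h|]). It also holds that |Q(∂W,∂W)| ≤ C|∂̄W||∂W|. -/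

import Mathlib

noncomputable section

open MeasureTheory

namespace LR

/-- Spacetime point in `ℝ^{1+3}`; coordinate `0` is time. -/
abbrev Pt := Fin 4 → ℝ

/-- A 2-tensor field on spacetime. -/
abbrev Tsr := Pt → Fin 4 → Fin 4 → ℝ

/-- Minkowski metric `diag(-1,1,1,1)` (the components of `m` and of `m⁻¹` coincide). -/
def mink (μ ν : Fin 4) : ℝ := if μ = ν then (if μ = 0 then -1 else 1) else 0

/-- Partial derivative `∂_μ`. -/
def pd (μ : Fin 4) (f : Pt → ℝ) (p : Pt) : ℝ := fderiv ℝ f p (Pi.single μ 1)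

/-- Directional derivative along a vector `U`. -/
def dirD (U : Pt) (f : Pt → ℝ) (p : Pt) : ℝ := fderiv ℝ f p U

/-- Spatial radius `r = |x|`. -/
def rad (p : Pt) : ℝ := Real.sqrt ((p 1)^2 + (p 2)^2 + (p 3)^2)

/-- `q = r - t`. -/
def qc (p : Pt) : ℝ := rad p - p 0

/-- The null vector `L = (1, x/r)`. -/
def Lv (p : Pt) : Pt := fun μ => if μ = 0 then 1 else p μ / rad p

/-- The null vector `L̄ = (1, -x/r)`. -/
def Lbv (p : Pt) : Pt := fun μ => if μ = 0 then 1 else -(p μ / rad p)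

/-- Spatial dot product of two spacetime vectors. -/
def sdot (X Y : Pt) : ℝ := X 1 * Y 1 + X 2 * Y 2 + X 3 * Y 3

/-- `S₁, S₂` is an admissible orthonormal pair tangent to the sphere through `p`. -/
structure SphFrame (p : Pt) (S₁ S₂ : Pt) : Prop where
  time1 : S₁ 0 = 0
  time2 : S₂ 0 = 0
  unit1 : sdot S₁ S₁ = 1
  unit2 : sdot S₂ S₂ = 1
  orth : sdot S₁ S₂ = 0
  rad1 : sdot S₁ p = 0
  rad2 : sdot S₂ p = 0

/-- The family 𝒰 = {L, L̄, S₁, S₂}. -/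
def Ufam (p S₁ S₂ : Pt) : List Pt := [Lv p, Lbv p, S₁, S₂]
/-- The family 𝒯 = {L, S₁, S₂}. -/
def Tfam (p S₁ S₂ : Pt) : List Pt := [Lv p, S₁, S₂]
/-- The family ℒ = {L}. -/
def Lfam (p : Pt) : List Pt := [Lv p]

/-- Contraction of a pointwise 2-tensor with two vectors. -/
def tcon (π : Fin 4 → Fin 4 → ℝ) (V W : Pt) : ℝ := ∑ μ, ∑ ν, π μ ν * V μ * W ν

/-- Seminorm `|π|_{𝒱𝒲}` of a pointwise 2-tensor. -/
def semi (π : Fin 4 → Fin 4 → ℝ) (Vs Ws : List Pt) : ℝ :=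
  (Vs.map fun V => (Ws.map fun W => |tcon π V W|).sum).sum

/-- Derivative seminorm `|∂π|_{𝒱𝒲}` with derivative directions from `Ds`. -/
def dsemi (π : Tsr) (Ds Vs Ws : List Pt) (p : Pt) : ℝ :=
  (Ds.map fun U => (Vs.map fun V => (Ws.map fun W =>
    |∑ μ, ∑ ν, dirD U (fun y => π y μ ν) p * V μ * W ν|).sum).sum).sum

/-- `|ψ|_𝒦`. -/
def ksemi {m : ℕ} (ψ : Fin m → ℝ) : ℝ := ∑ k, |ψ k|

/-- `|∂ψ|_𝒦` with derivative directions from `Ds`. -/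
def kdsemi {m : ℕ} (ψ : Fin m → Pt → ℝ) (Ds : List Pt) (p : Pt) : ℝ :=
  (Ds.map fun U => ∑ k, |dirD U (ψ k) p|).sum

/-- Sum of `|∂u|` over a family of directions. -/
def dAll (Ds : List Pt) (u : Pt → ℝ) (p : Pt) : ℝ := (Ds.map fun U => |dirD U u p|).sum

/-- Lowering both indices of a contravariant 2-tensor with the Minkowski metric. -/
def lowT (H : Tsr) : Tsr := fun p μ ν => ∑ ρ, ∑ σ, mink μ ρ * mink ν σ * H p ρ σ

/-- `1 + t + |q|`. -/
def Aw (p : Pt) : ℝ := 1 + p 0 + |qc p|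
/-- `1 + |q|`. -/
def Bw (p : Pt) : ℝ := 1 + |qc p|

/-- The null form `Q₀(∂u, ∂v) = m^{μν} ∂_μ u ∂_ν v`. -/
def Q0f (u v : Pt → ℝ) (p : Pt) : ℝ := ∑ μ, ∑ ν, mink μ ν * pd μ u p * pd ν v p

/-- The null form `Q̃_{αβ}(∂u, ∂v) = ∂_α u ∂_β v - ∂_β u ∂_α v`. -/
def Qtf (α β : Fin 4) (u v : Pt → ℝ) (p : Pt) : ℝ :=
  pd α u p * pd β v p - pd β u p * pd α v p

/-- Index type for the Minkowski vector fields 𝒵: translations, the `Ω_{μν} = x_μ∂_ν - x_ν∂_μ`,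
and the scaling field `S = x^μ∂_μ`. -/
abbrev ZIdx := Fin 4 ⊕ (Fin 4 × Fin 4) ⊕ Unit

/-- The coefficient vector field of each member of 𝒵 (indices are lowered with `m`,
which is diagonal). -/
def Zv : ZIdx → Pt → Pt
  | Sum.inl μ => fun _ => Pi.single μ 1
  | Sum.inr (Sum.inl (μ, ν)) => fun p ρ =>
      (mink μ μ * p μ) * (Pi.single ν 1 : Pt) ρ - (mink ν ν * p ν) * (Pi.single μ 1 : Pt) ρ
  | Sum.inr (Sum.inr _) => fun p => p

/-- Application of a field `Z ∈ 𝒵`. -/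
def Zap (z : ZIdx) (f : Pt → ℝ) (p : Pt) : ℝ := fderiv ℝ f p (Zv z p)

/-- Iterated application `Z^α`. -/
def Ziter : List ZIdx → (Pt → ℝ) → Pt → ℝ
  | [], f => f
  | z :: l, f => Zap z (Ziter l f)

/-- Sum over all `𝒵` multi-indices of length at most `k`. -/
def Zsum (k : ℕ) (F : List ZIdx → ℝ) : ℝ :=
  ∑ n ∈ Finset.range (k + 1), ∑ v : Fin n → ZIdx, F (List.ofFn v)

/-- `|Z^I φ| = Σ_{|α| ≤ k} |Z^α φ|`. -/
def Znorm (k : ℕ) (φ : Pt → ℝ) (p : Pt) : ℝ := Zsum k fun l => |Ziter l φ p|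

/-- `Z^α` applied componentwise to a 2-tensor. -/
def Ztsr (l : List ZIdx) (π : Tsr) : Tsr := fun p μ ν => Ziter l (fun y => π y μ ν) p

/-- The 2-tensor `P(∂π, ∂θ, ∂Ψ, ∂Φ)_{μν} = P¹(∂π,∂θ)_{μν} + P²(∂π,∂Ψ)_{μν} + P³(∂Ψ,∂Φ)_{μν}`. -/
def PD {m : ℕ} (N : Fin m → ℝ) (NN : Fin m → Fin m → ℝ) (π θ : Tsr)
    (Ψ Φ : Fin m → Pt → ℝ) : Tsr := fun p μ ν =>
  (∑ ρ, ∑ σ, ∑ lam, ∑ τ, mink ρ σ * mink lam τ *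
    ((1/4) * pd μ (fun y => π y ρ σ) p * pd ν (fun y => θ y lam τ) p
      - (1/2) * pd μ (fun y => π y ρ lam) p * pd ν (fun y => θ y σ τ) p))
  + (∑ k, N k * ∑ ρ, ∑ σ, mink ρ σ *
      (pd μ (fun y => π y ρ σ) p * pd ν (Ψ k) p
        + pd ν (fun y => π y ρ σ) p * pd μ (Ψ k) p))
  + (∑ k, ∑ l, NN k l *
      (pd μ (Ψ k) p * pd ν (Φ l) p + pd ν (Ψ k) p * pd μ (Φ l) p))

/-- Index type for the unknowns `W = {h_{μν}} ∪ {ψ_k}`. -/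
abbrev WIdx (m : ℕ) := (Fin 4 × Fin 4) ⊕ Fin m

/-- The value space for `W` at a point. -/
abbrev WVal (m : ℕ) := (Fin 4 → Fin 4 → ℝ) × (Fin m → ℝ)

/-- The component functions of `W`. -/
def Wcomp {m : ℕ} (h : Tsr) (ψ : Fin m → Pt → ℝ) : WIdx m → Pt → ℝ
  | Sum.inl (μ, ν) => fun p => h p μ ν
  | Sum.inr k => ψ k

/-- The value of `W` at a point. -/
def Wval {m : ℕ} (h : Tsr) (ψ : Fin m → Pt → ℝ) (p : Pt) : WVal m :=
  (fun μ ν => h p μ ν, fun k => ψ k p)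

/-- The data defining a system in the generalised class \eqref{eq:intro-new-EE}:
the constants `N^k`, `N^{kl}` of `P²`, `P³`; coefficients of the linear combinations
of null forms `Q_{μν}`, `Q_k`; and the coefficients of the quadratic forms
`G_{μν}(W)(∂W,∂W)`, `G_k(W)(∂W,∂W)`, which depend smoothly on `W` and vanish at `W = 0`. -/
structure GenSystem (m : ℕ) where
  Nc : Fin m → ℝ
  NNc : Fin m → Fin m → ℝ
  q0 : Fin 4 → Fin 4 → WIdx m → WIdx m → ℝ
  qt : Fin 4 → Fin 4 → WIdx m → WIdx m → Fin 4 → Fin 4 → ℝ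
  q0k : Fin m → WIdx m → WIdx m → ℝ
  qtk : Fin m → WIdx m → WIdx m → Fin 4 → Fin 4 → ℝ
  gc : Fin 4 → Fin 4 → WIdx m → WIdx m → Fin 4 → Fin 4 → WVal m → ℝ
  gck : Fin m → WIdx m → WIdx m → Fin 4 → Fin 4 → WVal m → ℝ
  gc_smooth : ∀ μ ν A B α β, ContDiff ℝ (⊤ : ℕ∞) (gc μ ν A B α β)
  gck_smooth : ∀ k A B α β, ContDiff ℝ (⊤ : ℕ∞) (gck k A B α β)
  gc_zero : ∀ μ ν A B α β, gc μ ν A B α β 0 = 0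
  gck_zero : ∀ k A B α β, gck k A B α β 0 = 0

/-- The quadratic form
`P(∂_μ W, ∂_ν W) = P¹(∂h,∂h)_{μν} + P²(∂h,∂ψ)_{μν} + P³(∂ψ,∂ψ)_{μν}`. -/
def Pterm {m : ℕ} (S : GenSystem m) (h : Tsr) (ψ : Fin m → Pt → ℝ) (μ ν : Fin 4)
    (p : Pt) : ℝ :=
  (∑ ρ, ∑ σ, ∑ lam, ∑ τ, mink ρ σ * mink lam τ *
    ((1/4) * pd μ (fun y => h y ρ σ) p * pd ν (fun y => h y lam τ) p
      - (1/2) * pd μ (fun y => h y ρ lam) p * pd ν (fun y => h y σ τ) p))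
  + (∑ k, S.Nc k * ∑ ρ, ∑ σ, mink ρ σ *
      (pd μ (fun y => h y ρ σ) p * pd ν (ψ k) p + pd ν (fun y => h y ρ σ) p * pd μ (ψ k) p))
  + (∑ k, ∑ l, S.NNc k l *
      (pd μ (ψ k) p * pd ν (ψ l) p + pd ν (ψ k) p * pd μ (ψ l) p))

/-- The null-form part `Q_{μν}(∂W,∂W)`. -/
def Qterm {m : ℕ} (S : GenSystem m) (h : Tsr) (ψ : Fin m → Pt → ℝ) (μ ν : Fin 4)
    (p : Pt) : ℝ :=
  ∑ A, ∑ B, (S.q0 μ ν A B * Q0f (Wcomp h ψ A) (Wcomp h ψ B) p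
    + ∑ α, ∑ β, S.qt μ ν A B α β * Qtf α β (Wcomp h ψ A) (Wcomp h ψ B) p)

/-- The cubic-type part `G_{μν}(W)(∂W,∂W)`. -/
def Gterm {m : ℕ} (S : GenSystem m) (h : Tsr) (ψ : Fin m → Pt → ℝ) (μ ν : Fin 4)
    (p : Pt) : ℝ :=
  ∑ A, ∑ B, ∑ α, ∑ β,
    S.gc μ ν A B α β (Wval h ψ p) * pd α (Wcomp h ψ A) p * pd β (Wcomp h ψ B) p

/-- The full inhomogeneity `F_{μν}(W)(∂W,∂W)`. -/
def Fterm {m : ℕ} (S : GenSystem m) (h : Tsr) (ψ : Fin m → Pt → ℝ) (μ ν : Fin 4)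
    (p : Pt) : ℝ :=
  Pterm S h ψ μ ν p + Qterm S h ψ μ ν p + Gterm S h ψ μ ν p

/-- The null-form part `Q_k(∂W,∂W)`. -/
def Qkterm {m : ℕ} (S : GenSystem m) (h : Tsr) (ψ : Fin m → Pt → ℝ) (k : Fin m)
    (p : Pt) : ℝ :=
  ∑ A, ∑ B, (S.q0k k A B * Q0f (Wcomp h ψ A) (Wcomp h ψ B) p
    + ∑ α, ∑ β, S.qtk k A B α β * Qtf α β (Wcomp h ψ A) (Wcomp h ψ B) p)

/-- The cubic-type part `G_k(W)(∂W,∂W)`. -/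
def Gkterm {m : ℕ} (S : GenSystem m) (h : Tsr) (ψ : Fin m → Pt → ℝ) (k : Fin m)
    (p : Pt) : ℝ :=
  ∑ A, ∑ B, ∑ α, ∑ β,
    S.gck k A B α β (Wval h ψ p) * pd α (Wcomp h ψ A) p * pd β (Wcomp h ψ B) p

/-- The full inhomogeneity `F_k(W)(∂W,∂W)`. -/
def Fkterm {m : ℕ} (S : GenSystem m) (h : Tsr) (ψ : Fin m → Pt → ℝ) (k : Fin m)
    (p : Pt) : ℝ :=
  Qkterm S h ψ k p + Gkterm S h ψ k p

/-- The metric `g_{μν} = m_{μν} + h_{μν}` as a matrix. -/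
def gmat (h : Tsr) (p : Pt) : Matrix (Fin 4) (Fin 4) ℝ :=
  Matrix.of fun μ ν => mink μ ν + h p μ ν

/-- The inverse metric `g^{μν}`. -/
def ginv (h : Tsr) (p : Pt) : Matrix (Fin 4) (Fin 4) ℝ := (gmat h p)⁻¹

/-- The inverse perturbation `H^{μν} = g^{μν} - m^{μν}`. -/
def Hup (h : Tsr) : Tsr := fun p μ ν => ginv h p μ ν - mink μ ν

/-- Second partial derivatives. -/
def pd2 (ρ σ : Fin 4) (u : Pt → ℝ) (p : Pt) : ℝ := pd ρ (fun y => pd σ u y) p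

/-- The reduced wave operator `□̃_g = g^{ρσ}∂_ρ∂_σ`. -/
def rBox (h : Tsr) (u : Pt → ℝ) (p : Pt) : ℝ := ∑ ρ, ∑ σ, ginv h p ρ σ * pd2 ρ σ u p

/-- The wave-coordinate condition `∂_ρ (g^{ρμ} √|det g|) = 0` at a point. -/
def WaveGaugeAt (h : Tsr) (p : Pt) : Prop :=
  ∀ μ, ∑ ρ, pd ρ (fun y => ginv h y ρ μ * Real.sqrt |(gmat h y).det|) p = 0

/-- The time slab `0 ≤ t ≤ T`. -/
def Slab (T : ℝ) : Set Pt := {p | 0 ≤ p 0 ∧ p 0 ≤ T}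

/-- `(h, ψ)` is a smooth solution of the generalised system `S`, in wave coordinates,
on the region `D`. -/
structure IsSolutionOn {m : ℕ} (S : GenSystem m) (h : Tsr) (ψ : Fin m → Pt → ℝ)
    (D : Set Pt) : Prop where
  smooth_h : ∀ μ ν, ContDiff ℝ (⊤ : ℕ∞) (fun p => h p μ ν)
  smooth_psi : ∀ k, ContDiff ℝ (⊤ : ℕ∞) (ψ k)
  symm : ∀ p μ ν, h p μ ν = h p ν μ
  eq_h : ∀ p ∈ D, ∀ μ ν, rBox h (fun y => h y μ ν) p = Fterm S h ψ μ ν p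
  eq_psi : ∀ p ∈ D, ∀ k, rBox h (ψ k) p = Fkterm S h ψ k p
  gauge : ∀ p ∈ D, WaveGaugeAt h p

/-- `|∂W| = |∂h|_{𝒰𝒰} + |∂ψ|_𝒦` relative to the frame `(S₁, S₂)` at `p`. -/
def dWn {m : ℕ} (h : Tsr) (ψ : Fin m → Pt → ℝ) (S₁ S₂ p : Pt) : ℝ :=
  dsemi h (Ufam p S₁ S₂) (Ufam p S₁ S₂) (Ufam p S₁ S₂) p + kdsemi ψ (Ufam p S₁ S₂) p

/-- `|∂̄W| = |∂̄h|_{𝒰𝒰} + |∂̄ψ|_𝒦`. -/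
def dWbar {m : ℕ} (h : Tsr) (ψ : Fin m → Pt → ℝ) (S₁ S₂ p : Pt) : ℝ :=
  dsemi h (Tfam p S₁ S₂) (Ufam p S₁ S₂) (Ufam p S₁ S₂) p + kdsemi ψ (Tfam p S₁ S₂) p

/-- `|∂W|_G = |∂h|_{𝒯𝒰} + |∂ψ|_𝒦`. -/
def dWG {m : ℕ} (h : Tsr) (ψ : Fin m → Pt → ℝ) (S₁ S₂ p : Pt) : ℝ :=
  dsemi h (Ufam p S₁ S₂) (Tfam p S₁ S₂) (Ufam p S₁ S₂) p + kdsemi ψ (Ufam p S₁ S₂) p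

/-- `|W| = |h|_{𝒰𝒰} + |ψ|_𝒦`. -/
def Wn {m : ℕ} (h : Tsr) (ψ : Fin m → Pt → ℝ) (S₁ S₂ p : Pt) : ℝ :=
  semi (h p) (Ufam p S₁ S₂) (Ufam p S₁ S₂) + ksemi (fun k => ψ k p)

/-- `|Z^I W| = Σ_{|α| ≤ j} (|Z^α h|_{𝒰𝒰} + |Z^α ψ|_𝒦)`. -/
def ZWn {m : ℕ} (j : ℕ) (h : Tsr) (ψ : Fin m → Pt → ℝ) (S₁ S₂ p : Pt) : ℝ :=
  Zsum j fun l => Wn (Ztsr l h) (fun k => Ziter l (ψ k)) S₁ S₂ p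

/-- `|∂Z^I W|`. -/
def ZdWn {m : ℕ} (j : ℕ) (h : Tsr) (ψ : Fin m → Pt → ℝ) (S₁ S₂ p : Pt) : ℝ :=
  Zsum j fun l => dWn (Ztsr l h) (fun k => Ziter l (ψ k)) S₁ S₂ p

/-- `|∂̄Z^I W|`. -/
def ZdWbar {m : ℕ} (j : ℕ) (h : Tsr) (ψ : Fin m → Pt → ℝ) (S₁ S₂ p : Pt) : ℝ :=
  Zsum j fun l => dWbar (Ztsr l h) (fun k => Ziter l (ψ k)) S₁ S₂ p

/-- `|∂Z^I W|_G`. -/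
def ZdWG {m : ℕ} (j : ℕ) (h : Tsr) (ψ : Fin m → Pt → ℝ) (S₁ S₂ p : Pt) : ℝ :=
  Zsum j fun l => dWG (Ztsr l h) (fun k => Ziter l (ψ k)) S₁ S₂ p

/-- `|Z^I π|_{𝒱𝒲}` for a 2-tensor. -/
def Zssemi (k : ℕ) (π : Tsr) (Vs Ws : List Pt) (p : Pt) : ℝ :=
  Zsum k fun l => semi (Ztsr l π p) Vs Ws

/-- `|∂Z^I π|_{𝒱𝒲}` for a 2-tensor. -/
def Zdsemi (k : ℕ) (π : Tsr) (Ds Vs Ws : List Pt) (p : Pt) : ℝ :=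
  Zsum k fun l => dsemi (Ztsr l π) Ds Vs Ws p

/-! ### Sums over lists -/

lemma le_sum_map_of_mem {α : Type*} {l : List α} {f : α → ℝ} (hf : ∀ x ∈ l, 0 ≤ f x) {a : α}
    (ha : a ∈ l) : f a ≤ (l.map f).sum :=
  List.single_le_sum (by simpa using hf) _ (List.mem_map_of_mem ha)

lemma sum_map_le_length_mul {α : Type*} {l : List α} {f : α → ℝ} {X : ℝ} (hf : ∀ x ∈ l, f x ≤ X) :
    (l.map f).sum ≤ l.length * X := by
  have := List.sum_le_card_nsmul (l.map f) X (by simpa using hf)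
  simpa using this

lemma sum_map_nonneg {α : Type*} {l : List α} {f : α → ℝ} (hf : ∀ x ∈ l, 0 ≤ f x) :
    0 ≤ (l.map f).sum := List.sum_nonneg (by simpa using hf)

/-! ### The null frame -/

/-- Pairing of a covector with a vector. -/
def cov (w : Fin 4 → ℝ) (V : Pt) : ℝ := ∑ α, w α * V α

lemma tcon_eq_cov_right (π : Fin 4 → Fin 4 → ℝ) (V W : Pt) :
    tcon π V W = cov (fun μ => cov (π μ) W) V := by
  simp only [tcon, cov, Finset.sum_mul]
  exact Finset.sum_congr rfl fun _ _ => Finset.sum_congr rfl fun _ _ => by ring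

lemma tcon_swap (π : Fin 4 → Fin 4 → ℝ) (V W : Pt) :
    tcon π V W = tcon (fun μ ν => π ν μ) W V := by
  simp only [tcon]
  rw [Finset.sum_comm]
  exact Finset.sum_congr rfl fun _ _ => Finset.sum_congr rfl fun _ _ => by ring

lemma tcon_eq_cov_left (π : Fin 4 → Fin 4 → ℝ) (V W : Pt) :
    tcon π V W = cov (fun ν => cov (fun μ => π μ ν) V) W := by
  rw [tcon_swap, tcon_eq_cov_right]

lemma tcon_comm {π : Fin 4 → Fin 4 → ℝ} (hπ : ∀ μ ν, π μ ν = π ν μ) (V W : Pt) :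
    tcon π V W = tcon π W V := by
  rw [tcon_swap]; congr 1; ext μ ν; exact hπ ν μ

lemma abs_mink_self (μ : Fin 4) : |mink μ μ| = 1 := by
  by_cases h : μ = 0 <;> simp [mink, h]

lemma mink_self_mul_self (μ : Fin 4) : mink μ μ * mink μ μ = 1 := by
  by_cases h : μ = 0 <;> simp [mink, h]

lemma mink_of_ne {μ ν : Fin 4} (h : μ ≠ ν) : mink μ ν = 0 := by simp [mink, h]

lemma abs_mink_le (μ ν : Fin 4) : |mink μ ν| ≤ 1 := by
  by_cases h : μ = ν
  · subst h; exact (abs_mink_self μ).le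
  · simp [mink_of_ne h]

lemma sum_mink_mul (μ : Fin 4) (f : Fin 4 → ℝ) : ∑ ν, mink μ ν * f ν = mink μ μ * f μ :=
  Finset.sum_eq_single_of_mem μ (Finset.mem_univ _) fun ν _ h => by
    rw [mink_of_ne h.symm, zero_mul]

section Frame

variable {p S₁ S₂ : Pt}

lemma rad_sq (p : Pt) : rad p ^ 2 = p 1 ^ 2 + p 2 ^ 2 + p 3 ^ 2 :=
  Real.sq_sqrt (by positivity)

lemma abs_coord_le_rad (p : Pt) {μ : Fin 4} (hμ : μ ≠ 0) : |p μ| ≤ rad p := by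
  apply Real.abs_le_sqrt
  fin_cases μ
  · exact absurd rfl hμ
  all_goals
    simp
    nlinarith [sq_nonneg (p 1), sq_nonneg (p 2), sq_nonneg (p 3)]

lemma abs_Lv_le (p : Pt) (μ : Fin 4) : |Lv p μ| ≤ 1 := by
  unfold Lv
  split_ifs with h
  · simp
  · rw [abs_div, abs_of_nonneg (show 0 ≤ rad p from Real.sqrt_nonneg _)]
    exact div_le_one_of_le₀ (abs_coord_le_rad p h) (Real.sqrt_nonneg _)

lemma abs_Lbv_le (p : Pt) (μ : Fin 4) : |Lbv p μ| ≤ 1 := by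
  have := abs_Lv_le p μ
  unfold Lbv
  unfold Lv at this
  split_ifs with h
  · simp
  · simpa [h] using this

lemma abs_le_one_of_unit {S : Pt} (h0 : S 0 = 0) (h1 : sdot S S = 1) (μ : Fin 4) : |S μ| ≤ 1 := by
  unfold sdot at h1
  refine (sq_le_one_iff_abs_le_one _).mp ?_
  fin_cases μ <;> simp only [Fin.zero_eta, Fin.mk_one, Fin.reduceFinMk, h0] <;>
    nlinarith [sq_nonneg (S 1), sq_nonneg (S 2), sq_nonneg (S 3)]

lemma abs_Ufam_le (hf : SphFrame p S₁ S₂) {U : Pt} (hU : U ∈ Ufam p S₁ S₂) (μ : Fin 4) :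
    |U μ| ≤ 1 := by
  simp only [Ufam, List.mem_cons, List.not_mem_nil, or_false] at hU
  rcases hU with rfl | rfl | rfl | rfl
  · exact abs_Lv_le p μ
  · exact abs_Lbv_le p μ
  · exact abs_le_one_of_unit hf.time1 hf.unit1 μ
  · exact abs_le_one_of_unit hf.time2 hf.unit2 μ

lemma Tfam_subset_Ufam {U : Pt} (hU : U ∈ Tfam p S₁ S₂) : U ∈ Ufam p S₁ S₂ := by
  simp only [Ufam, Tfam, List.mem_cons, List.not_mem_nil, or_false] at hU ⊢
  tauto

lemma Lv_mem_Tfam : Lv p ∈ Tfam p S₁ S₂ := by simp [Tfam]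
lemma S₁_mem_Tfam : S₁ ∈ Tfam p S₁ S₂ := by simp [Tfam]
lemma S₂_mem_Tfam : S₂ ∈ Tfam p S₁ S₂ := by simp [Tfam]
lemma Lbv_mem_Ufam : Lbv p ∈ Ufam p S₁ S₂ := by simp [Ufam]
lemma Lv_mem_Lfam : Lv p ∈ Lfam p := by simp [Lfam]

/-- Completeness relation of the null frame. -/
lemma mink_eq_frame (hr : 0 < rad p) (hf : SphFrame p S₁ S₂) (α β : Fin 4) :
    mink α β = -(1/2) * (Lv p α * Lbv p β + Lbv p α * Lv p β) + S₁ α * S₁ β + S₂ α * S₂ β := by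
  have hr' := hr.ne'
  let O : Matrix (Fin 3) (Fin 3) ℝ :=
    !![p 1 / rad p, p 2 / rad p, p 3 / rad p; S₁ 1, S₁ 2, S₁ 3; S₂ 1, S₂ 2, S₂ 3]
  have hn : p 1 / rad p * (p 1 / rad p) + p 2 / rad p * (p 2 / rad p)
      + p 3 / rad p * (p 3 / rad p) = 1 := by
    field_simp
    rw [rad_sq]
  have h1 : p 1 / rad p * S₁ 1 + p 2 / rad p * S₁ 2 + p 3 / rad p * S₁ 3 = 0 := by
    have := hf.rad1
    unfold sdot at this
    field_simp
    linarith
  have h2 : p 1 / rad p * S₂ 1 + p 2 / rad p * S₂ 2 + p 3 / rad p * S₂ 3 = 0 := by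
    have := hf.rad2
    unfold sdot at this
    field_simp
    linarith
  have e1 := hf.unit1
  have e2 := hf.unit2
  have e3 := hf.orth
  unfold sdot at e1 e2 e3
  have hO : O * O.transpose = 1 := by
    ext i j
    fin_cases i <;> fin_cases j <;> simp [O, Matrix.mul_apply, Fin.sum_univ_three] <;> linarith
  have hO' := mul_eq_one_comm.mp hO
  have key : ∀ i j, (O.transpose * O) i j = (1 : Matrix (Fin 3) (Fin 3) ℝ) i j := by simp [hO']
  have k00 := key 0 0
  have k01 := key 0 1
  have k02 := key 0 2
  have k11 := key 1 1
  have k12 := key 1 2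
  have k22 := key 2 2
  simp [O, Matrix.mul_apply, Fin.sum_univ_three] at k00 k01 k02 k11 k12 k22
  fin_cases α <;> fin_cases β <;>
    simp [mink, Lv, Lbv, hf.time1, hf.time2] <;> linarith

lemma sum_mink_mul_mul (hr : 0 < rad p) (hf : SphFrame p S₁ S₂) (u v : Fin 4 → ℝ) :
    ∑ μ, ∑ ν, mink μ ν * (u μ * v ν) =
      -(1/2) * (cov u (Lv p) * cov v (Lbv p) + cov u (Lbv p) * cov v (Lv p))
        + cov u S₁ * cov v S₁ + cov u S₂ * cov v S₂ := by
  simp only [mink_eq_frame hr hf, cov, Fin.sum_univ_four]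
  ring

lemma trace_eq_frame (hr : 0 < rad p) (hf : SphFrame p S₁ S₂) (π : Fin 4 → Fin 4 → ℝ) :
    ∑ μ, ∑ ν, mink μ ν * π μ ν =
      -(1/2) * (tcon π (Lv p) (Lbv p) + tcon π (Lbv p) (Lv p)) + tcon π S₁ S₁ + tcon π S₂ S₂ := by
  simp only [mink_eq_frame hr hf, tcon, Fin.sum_univ_four]
  ring

lemma coord_eq_frame (hr : 0 < rad p) (hf : SphFrame p S₁ S₂) (w : Fin 4 → ℝ) (α : Fin 4) :
    w α = mink α α * (-(1/2) * (Lv p α * cov w (Lbv p) + Lbv p α * cov w (Lv p))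
      + S₁ α * cov w S₁ + S₂ α * cov w S₂) := by
  have h := sum_mink_mul α w
  have h2 : w α = mink α α * ∑ ν, mink α ν * w ν := by
    rw [h, ← mul_assoc, mink_self_mul_self, one_mul]
  rw [h2]
  congr 1
  simp only [mink_eq_frame hr hf, cov, Fin.sum_univ_four]
  ring

/-- The components of the covector dual to `L`, with the index lowered. -/
def ell (p : Pt) (α : Fin 4) : ℝ := mink α α * Lv p α

lemma abs_ell_le (p : Pt) (α : Fin 4) : |ell p α| ≤ 1 := by
  rw [ell, abs_mul, abs_mink_self, one_mul]; exact abs_Lv_le p α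

lemma abs_coord_add_le (hr : 0 < rad p) (hf : SphFrame p S₁ S₂) (w : Fin 4 → ℝ) (α : Fin 4)
    {X : ℝ} (hX : ∀ V ∈ Tfam p S₁ S₂, |cov w V| ≤ X) :
    |w α + 1/2 * ell p α * cov w (Lbv p)| ≤ 3 * X := by
  have e := coord_eq_frame hr hf w α
  have e' : w α + 1/2 * ell p α * cov w (Lbv p) =
      mink α α * (-(1/2) * (Lbv p α * cov w (Lv p)) + S₁ α * cov w S₁ + S₂ α * cov w S₂) := by
    rw [ell]; nth_rw 1 [e]; ring
  have aux : ∀ U ∈ Ufam p S₁ S₂, ∀ V ∈ Tfam p S₁ S₂, |U α * cov w V| ≤ X := fun U hU V hV => by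
    rw [abs_mul]
    exact (mul_le_of_le_one_left (abs_nonneg _) (abs_Ufam_le hf hU α)).trans (hX V hV)
  have a1 := abs_le.mp (aux _ Lbv_mem_Ufam _ Lv_mem_Tfam)
  have a2 := abs_le.mp (aux _ (Tfam_subset_Ufam S₁_mem_Tfam) _ S₁_mem_Tfam)
  have a3 := abs_le.mp (aux _ (Tfam_subset_Ufam S₂_mem_Tfam) _ S₂_mem_Tfam)
  rw [e', abs_mul, abs_mink_self, one_mul, abs_le]
  constructor <;> linarith [a1.1, a1.2, a2.1, a2.2, a3.1, a3.2]

lemma abs_coord_le (hr : 0 < rad p) (hf : SphFrame p S₁ S₂) (w : Fin 4 → ℝ) (α : Fin 4)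
    {X : ℝ} (hX : ∀ V ∈ Ufam p S₁ S₂, |cov w V| ≤ X) : |w α| ≤ 4 * X := by
  have h := abs_coord_add_le hr hf w α fun V hV => hX V (Tfam_subset_Ufam hV)
  have h2 : |1/2 * ell p α * cov w (Lbv p)| ≤ 1/2 * X := by
    rw [abs_mul, abs_mul, mul_assoc, abs_of_pos (by norm_num : (0:ℝ) < 1/2)]
    gcongr
    exact (mul_le_of_le_one_left (abs_nonneg _) (abs_ell_le p α)).trans (hX _ Lbv_mem_Ufam)
  have hX0 : 0 ≤ X := (abs_nonneg _).trans (hX _ (Lbv_mem_Ufam (S₁ := S₁) (S₂ := S₂)))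
  rw [abs_le] at *
  constructor <;> linarith [h.1, h.2, h2.1, h2.2]

lemma abs_cov_le {w V : Fin 4 → ℝ} {X : ℝ} (hV : ∀ μ, |V μ| ≤ 1) (hX : ∀ μ, |w μ| ≤ X) :
    |cov w V| ≤ 4 * X := by
  refine (Finset.abs_sum_le_sum_abs _ _).trans ?_
  refine (Finset.sum_le_card_nsmul _ _ X fun μ _ => ?_).trans (by simp)
  rw [abs_mul]
  exact (mul_le_of_le_one_right (abs_nonneg _) (hV μ)).trans (hX μ)

lemma abs_tcon_le {π : Fin 4 → Fin 4 → ℝ} {V W : Pt} {X : ℝ} (hV : ∀ μ, |V μ| ≤ 1)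
    (hW : ∀ μ, |W μ| ≤ 1) (hX : ∀ μ ν, |π μ ν| ≤ X) : |tcon π V W| ≤ 16 * X := by
  rw [tcon_eq_cov_right]
  exact (abs_cov_le hV fun μ => abs_cov_le hW (hX μ)).trans (by linarith)

lemma abs_tcon_le_semi {π : Fin 4 → Fin 4 → ℝ} {Vs Ws : List Pt} {V W : Pt} (hV : V ∈ Vs)
    (hW : W ∈ Ws) : |tcon π V W| ≤ semi π Vs Ws :=
  (le_sum_map_of_mem (f := fun W => |tcon π V W|) (fun _ _ => abs_nonneg _) hW).trans
    (le_sum_map_of_mem (f := fun V => (Ws.map fun W => |tcon π V W|).sum)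
      (fun _ _ => sum_map_nonneg fun _ _ => abs_nonneg _) hV)

lemma semi_nonneg (π : Fin 4 → Fin 4 → ℝ) (Vs Ws : List Pt) : 0 ≤ semi π Vs Ws :=
  sum_map_nonneg fun _ _ => sum_map_nonneg fun _ _ => abs_nonneg _

lemma semi_le {π : Fin 4 → Fin 4 → ℝ} {Vs Ws : List Pt} {X : ℝ}
    (h : ∀ V ∈ Vs, ∀ W ∈ Ws, |tcon π V W| ≤ X) : semi π Vs Ws ≤ Vs.length * (Ws.length * X) :=
  sum_map_le_length_mul fun V hV => sum_map_le_length_mul fun W hW => h V hV W hW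

lemma abs_comp_le_semi (hr : 0 < rad p) (hf : SphFrame p S₁ S₂) (π : Fin 4 → Fin 4 → ℝ)
    (μ ν : Fin 4) : |π μ ν| ≤ 16 * semi π (Ufam p S₁ S₂) (Ufam p S₁ S₂) := by
  have : |π μ ν| ≤ 4 * (4 * semi π (Ufam p S₁ S₂) (Ufam p S₁ S₂)) := by
    refine abs_coord_le hr hf (π μ) ν fun W hW => ?_
    refine abs_coord_le hr hf (fun μ => cov (π μ) W) μ fun V hV => ?_
    rw [← tcon_eq_cov_right]
    exact abs_tcon_le_semi hV hW
  linarith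

lemma semi_Ufam_le (hf : SphFrame p S₁ S₂) {π : Fin 4 → Fin 4 → ℝ} {X : ℝ}
    (h : ∀ μ ν, |π μ ν| ≤ X) : semi π (Ufam p S₁ S₂) (Ufam p S₁ S₂) ≤ 256 * X := by
  refine (semi_le fun V hV W hW => abs_tcon_le (abs_Ufam_le hf hV) (abs_Ufam_le hf hW) h).trans
    (le_of_eq ?_)
  simp [Ufam]; ring

end Frame

/-! ### Pointwise bilinear algebra -/

/-- Minkowski trace of a 2-tensor. -/
def trm (π : Fin 4 → Fin 4 → ℝ) : ℝ := ∑ μ, ∑ ν, mink μ ν * π μ ν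

/-- Minkowski inner product of two 2-tensors. -/
def inm (π θ : Fin 4 → Fin 4 → ℝ) : ℝ :=
  ∑ ρ, ∑ σ, ∑ lam, ∑ τ, mink ρ σ * mink lam τ * (π ρ lam * θ σ τ)

/-- The algebraic bilinear form underlying `P`. -/
def Pform {m : ℕ} (N : Fin m → ℝ) (NN : Fin m → Fin m → ℝ) (π : Fin 4 → Fin 4 → ℝ)
    (a : Fin m → ℝ) (θ : Fin 4 → Fin 4 → ℝ) (b : Fin m → ℝ) : ℝ :=
  1/4 * (trm π * trm θ) - 1/2 * inm π θ + (∑ k, N k * (trm π * b k + trm θ * a k))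
    + ∑ k, ∑ l, NN k l * (a k * b l + b k * a l)

section

variable {p S₁ S₂ : Pt}

lemma abs_trm_le (hr : 0 < rad p) (hf : SphFrame p S₁ S₂) {π : Fin 4 → Fin 4 → ℝ}
    (hπ : ∀ μ ν, π μ ν = π ν μ) {g : ℝ}
    (hg : ∀ V ∈ Tfam p S₁ S₂, ∀ W ∈ Ufam p S₁ S₂, |tcon π V W| ≤ g) : |trm π| ≤ 3 * g := by
  rw [trm, trace_eq_frame hr hf, tcon_comm hπ (Lbv p)]
  have h1 := abs_le.mp (hg _ Lv_mem_Tfam _ Lbv_mem_Ufam)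
  have h2 := abs_le.mp (hg _ S₁_mem_Tfam _ (Tfam_subset_Ufam S₁_mem_Tfam))
  have h3 := abs_le.mp (hg _ S₂_mem_Tfam _ (Tfam_subset_Ufam S₂_mem_Tfam))
  rw [abs_le]
  constructor <;> linarith [h1.1, h1.2, h2.1, h2.2, h3.1, h3.2]

lemma inm_eq_frame (hr : 0 < rad p) (hf : SphFrame p S₁ S₂) (π θ : Fin 4 → Fin 4 → ℝ) :
    inm π θ =
      -(1/2) * (
        (-(1/2) * (tcon π (Lv p) (Lv p) * tcon θ (Lbv p) (Lbv p)
            + tcon π (Lv p) (Lbv p) * tcon θ (Lbv p) (Lv p))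
          + tcon π (Lv p) S₁ * tcon θ (Lbv p) S₁ + tcon π (Lv p) S₂ * tcon θ (Lbv p) S₂)
        + (-(1/2) * (tcon π (Lbv p) (Lv p) * tcon θ (Lv p) (Lbv p)
            + tcon π (Lbv p) (Lbv p) * tcon θ (Lv p) (Lv p))
          + tcon π (Lbv p) S₁ * tcon θ (Lv p) S₁ + tcon π (Lbv p) S₂ * tcon θ (Lv p) S₂))
      + (-(1/2) * (tcon π S₁ (Lv p) * tcon θ S₁ (Lbv p) + tcon π S₁ (Lbv p) * tcon θ S₁ (Lv p))
          + tcon π S₁ S₁ * tcon θ S₁ S₁ + tcon π S₁ S₂ * tcon θ S₁ S₂)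
      + (-(1/2) * (tcon π S₂ (Lv p) * tcon θ S₂ (Lbv p) + tcon π S₂ (Lbv p) * tcon θ S₂ (Lv p))
          + tcon π S₂ S₁ * tcon θ S₂ S₁ + tcon π S₂ S₂ * tcon θ S₂ S₂) := by
  have h1 : inm π θ = ∑ lam, ∑ τ, mink lam τ * ∑ ρ, ∑ σ, mink ρ σ * (π ρ lam * θ σ τ) := by
    simp only [inm, Finset.mul_sum]
    have step : ∀ ρ : Fin 4, (∑ σ, ∑ lam, ∑ τ, mink ρ σ * mink lam τ * (π ρ lam * θ σ τ)) =
        ∑ lam, ∑ τ, ∑ σ, mink lam τ * (mink ρ σ * (π ρ lam * θ σ τ)) := fun ρ => by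
      rw [Finset.sum_comm]
      refine Finset.sum_congr rfl fun lam _ => ?_
      rw [Finset.sum_comm]
      exact Finset.sum_congr rfl fun τ _ => Finset.sum_congr rfl fun σ _ => by ring
    simp only [step]
    rw [Finset.sum_comm]
    refine Finset.sum_congr rfl fun lam _ => ?_
    rw [Finset.sum_comm]
  have h2 : ∀ V V' : Pt, ∑ lam, ∑ τ, mink lam τ *
      (cov (fun ρ => π ρ lam) V * cov (fun σ => θ σ τ) V') =
      -(1/2) * (tcon π V (Lv p) * tcon θ V' (Lbv p) + tcon π V (Lbv p) * tcon θ V' (Lv p))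
        + tcon π V S₁ * tcon θ V' S₁ + tcon π V S₂ * tcon θ V' S₂ := fun V V' => by
    rw [sum_mink_mul_mul hr hf (fun lam => cov (fun ρ => π ρ lam) V)
      (fun τ => cov (fun σ => θ σ τ) V')]
    simp only [tcon_eq_cov_left]
  rw [h1]
  simp only [fun lam τ => sum_mink_mul_mul hr hf (fun ρ => π ρ lam) (fun σ => θ σ τ)]
  rw [← h2, ← h2, ← h2, ← h2]
  simp only [mul_add, Finset.sum_add_distrib, Finset.mul_sum]
  simp only [← mul_assoc, mul_comm _ (-(1/2) : ℝ)]

lemma abs_inm_le (hr : 0 < rad p) (hf : SphFrame p S₁ S₂) {π θ : Fin 4 → Fin 4 → ℝ}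
    (hπ : ∀ μ ν, π μ ν = π ν μ) (hθ : ∀ μ ν, θ μ ν = θ ν μ) {g g' l l' u u' : ℝ}
    (hg : ∀ V ∈ Tfam p S₁ S₂, ∀ W ∈ Ufam p S₁ S₂, |tcon π V W| ≤ g)
    (hg' : ∀ V ∈ Tfam p S₁ S₂, ∀ W ∈ Ufam p S₁ S₂, |tcon θ V W| ≤ g')
    (hl : |tcon π (Lv p) (Lv p)| ≤ l) (hl' : |tcon θ (Lv p) (Lv p)| ≤ l')
    (hu : |tcon π (Lbv p) (Lbv p)| ≤ u) (hu' : |tcon θ (Lbv p) (Lbv p)| ≤ u') :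
    |inm π θ| ≤ 10 * (g * g' + l * u' + u * l') := by
  have g0 : 0 ≤ g := (abs_nonneg _).trans (hg _ Lv_mem_Tfam _ Lbv_mem_Ufam)
  have l0 : 0 ≤ l := (abs_nonneg _).trans hl
  have u0 : 0 ≤ u := (abs_nonneg _).trans hu
  have key : ∀ {x y X Y : ℝ}, 0 ≤ X → |x| ≤ X → |y| ≤ Y → -(X * Y) ≤ x * y ∧ x * y ≤ X * Y :=
    fun h0 h1 h2 => abs_le.mp (by rw [abs_mul]; exact mul_le_mul h1 h2 (abs_nonneg _) h0)
  have kg : ∀ V ∈ Tfam p S₁ S₂, ∀ W ∈ Ufam p S₁ S₂, ∀ V' ∈ Tfam p S₁ S₂, ∀ W' ∈ Ufam p S₁ S₂,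
      -(g * g') ≤ tcon π V W * tcon θ V' W' ∧ tcon π V W * tcon θ V' W' ≤ g * g' :=
    fun V hV W hW V' hV' W' hW' => key g0 (hg V hV W hW) (hg' V' hV' W' hW')
  have c1 := key l0 hl hu'
  have c2 := key u0 hu hl'
  have mL : Lv p ∈ Tfam p S₁ S₂ := Lv_mem_Tfam
  have m1 : S₁ ∈ Tfam p S₁ S₂ := S₁_mem_Tfam
  have m2 : S₂ ∈ Tfam p S₁ S₂ := S₂_mem_Tfam
  have mB : Lbv p ∈ Ufam p S₁ S₂ := Lbv_mem_Ufam
  have sub : ∀ U ∈ Tfam p S₁ S₂, U ∈ Ufam p S₁ S₂ := fun U hU => Tfam_subset_Ufam hU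
  rw [inm_eq_frame hr hf, tcon_comm hπ (Lbv p) (Lv p), tcon_comm hπ (Lbv p) S₁,
    tcon_comm hπ (Lbv p) S₂, tcon_comm hθ (Lbv p) (Lv p), tcon_comm hθ (Lbv p) S₁,
    tcon_comm hθ (Lbv p) S₂]
  have d1 := kg _ mL _ mB _ mL _ mB
  have d2 := kg _ mL _ (sub _ m1) _ m1 _ mB
  have d3 := kg _ mL _ (sub _ m2) _ m2 _ mB
  have d4 := kg _ m1 _ mB _ mL _ (sub _ m1)
  have d5 := kg _ m2 _ mB _ mL _ (sub _ m2)
  have d6 := kg _ m1 _ (sub _ mL) _ m1 _ mB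
  have d7 := kg _ m1 _ mB _ m1 _ (sub _ mL)
  have d8 := kg _ m1 _ (sub _ m1) _ m1 _ (sub _ m1)
  have d9 := kg _ m1 _ (sub _ m2) _ m1 _ (sub _ m2)
  have d10 := kg _ m2 _ (sub _ mL) _ m2 _ mB
  have d11 := kg _ m2 _ mB _ m2 _ (sub _ mL)
  have d12 := kg _ m2 _ (sub _ m1) _ m2 _ (sub _ m1)
  have d13 := kg _ m2 _ (sub _ m2) _ m2 _ (sub _ m2)
  have gg : 0 ≤ g * g' := by linarith [d1.1, d1.2]
  have c10 : 0 ≤ l * u' := by linarith [c1.1, c1.2]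
  have c20 : 0 ≤ u * l' := by linarith [c2.1, c2.2]
  rw [abs_le]
  constructor <;>
  linarith [d1.1, d1.2, d2.1, d2.2, d3.1, d3.2, d4.1, d4.2, d5.1, d5.2, d6.1, d6.2, d7.1, d7.2,
    d8.1, d8.2, d9.1, d9.2, d10.1, d10.2, d11.1, d11.2, d12.1, d12.2, d13.1, d13.2,
    c1.1, c1.2, c2.1, c2.2]

lemma abs_sum_mul_le {ι : Type*} (s : Finset ι) (c f : ι → ℝ) {X : ℝ} (hX : ∀ i ∈ s, |f i| ≤ X) :
    |∑ i ∈ s, c i * f i| ≤ (∑ i ∈ s, |c i|) * X := by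
  refine (Finset.abs_sum_le_sum_abs _ _).trans ?_
  rw [Finset.sum_mul]
  refine Finset.sum_le_sum fun i hi => ?_
  rw [abs_mul]
  exact mul_le_mul_of_nonneg_left (hX i hi) (abs_nonneg _)

/-- Constant in the bounds for `Pform`. -/
def Pconst {m : ℕ} (N : Fin m → ℝ) (NN : Fin m → Fin m → ℝ) : ℝ :=
  10 + 6 * ∑ k, |N k| + 2 * ∑ k, ∑ l, |NN k l|

lemma Pconst_pos {m : ℕ} (N : Fin m → ℝ) (NN : Fin m → Fin m → ℝ) : 0 < Pconst N NN := by
  unfold Pconst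
  positivity

lemma abs_Pform_le {m : ℕ} (N : Fin m → ℝ) (NN : Fin m → Fin m → ℝ) (hr : 0 < rad p)
    (hf : SphFrame p S₁ S₂) {π θ : Fin 4 → Fin 4 → ℝ} {a b : Fin m → ℝ}
    (hπ : ∀ μ ν, π μ ν = π ν μ) (hθ : ∀ μ ν, θ μ ν = θ ν μ) {g g' l l' u u' : ℝ}
    (hg : ∀ V ∈ Tfam p S₁ S₂, ∀ W ∈ Ufam p S₁ S₂, |tcon π V W| ≤ g)
    (hg' : ∀ V ∈ Tfam p S₁ S₂, ∀ W ∈ Ufam p S₁ S₂, |tcon θ V W| ≤ g')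
    (ha : ∀ k, |a k| ≤ g) (hb : ∀ k, |b k| ≤ g')
    (hl : |tcon π (Lv p) (Lv p)| ≤ l) (hl' : |tcon θ (Lv p) (Lv p)| ≤ l')
    (hu : |tcon π (Lbv p) (Lbv p)| ≤ u) (hu' : |tcon θ (Lbv p) (Lbv p)| ≤ u') :
    |Pform N NN π a θ b| ≤ Pconst N NN * (g * g' + l * u' + u * l') := by
  have g0 : 0 ≤ g := (abs_nonneg _).trans (hg _ Lv_mem_Tfam _ Lbv_mem_Ufam)
  have g0' : 0 ≤ g' := (abs_nonneg _).trans (hg' _ Lv_mem_Tfam _ Lbv_mem_Ufam)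
  have l0 : 0 ≤ l := (abs_nonneg _).trans hl
  have u0 : 0 ≤ u := (abs_nonneg _).trans hu
  have l0' : 0 ≤ l' := (abs_nonneg _).trans hl'
  have u0' : 0 ≤ u' := (abs_nonneg _).trans hu'
  have t := abs_trm_le hr hf hπ hg
  have t' := abs_trm_le hr hf hθ hg'
  have key : ∀ {x y X Y : ℝ}, 0 ≤ X → |x| ≤ X → |y| ≤ Y → |x * y| ≤ X * Y :=
    fun h0 h1 h2 => by rw [abs_mul]; exact mul_le_mul h1 h2 (abs_nonneg _) h0
  have e1 : |trm π * trm θ| ≤ 9 * (g * g') :=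
    (key (by positivity) t t').trans (le_of_eq (by ring))
  have e2 := abs_inm_le hr hf hπ hθ hg hg' hl hl' hu hu'
  have e3 : |∑ k, N k * (trm π * b k + trm θ * a k)| ≤ (∑ k, |N k|) * (6 * (g * g')) :=
    abs_sum_mul_le _ _ _ fun k _ => by
      refine (abs_add_le _ _).trans ?_
      have i1 := key (by positivity) t (hb k)
      have i2 := key (by positivity) t' (ha k)
      linarith
  have e4 : |∑ k, ∑ l, NN k l * (a k * b l + b k * a l)| ≤
      (∑ k, ∑ l, |NN k l|) * (2 * (g * g')) := by
    simp only [← Finset.sum_product']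
    refine abs_sum_mul_le _ (fun x : Fin m × Fin m => NN x.1 x.2) _ fun x _ => ?_
    refine (abs_add_le _ _).trans ?_
    have i1 := key g0 (ha x.1) (hb x.2)
    have i2 := key g0' (hb x.1) (ha x.2)
    linarith
  have hA : 0 ≤ ∑ k, |N k| := by positivity
  have hB : 0 ≤ ∑ k, ∑ l, |NN k l| := by positivity
  have gg : 0 ≤ g * g' := by positivity
  have lu : 0 ≤ l * u' + u * l' := by positivity
  have hP : Pconst N NN * (g * g' + l * u' + u * l') =
      10 * (g * g' + l * u' + u * l') + (∑ k, |N k|) * (6 * (g * g'))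
      + (∑ k, ∑ l, |NN k l|) * (2 * (g * g'))
      + (6 * (∑ k, |N k|) + 2 * ∑ k, ∑ l, |NN k l|) * (l * u' + u * l') := by
    unfold Pconst; ring
  have hR : 0 ≤ (6 * (∑ k, |N k|) + 2 * ∑ k, ∑ l, |NN k l|) * (l * u' + u * l') := by positivity
  rw [hP]
  unfold Pform
  rw [abs_le] at *
  constructor <;> linarith [e1.1, e1.2, e2.1, e2.2, e3.1, e3.2, e4.1, e4.2]

end

/-! ### Derivative seminorms -/

lemma dirD_eq_cov (U : Pt) (f : Pt → ℝ) (p : Pt) : dirD U f p = cov (fun α => pd α f p) U := by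
  have h := (fderiv ℝ f p).toLinearMap.pi_apply_eq_sum_univ U
  simp only [ContinuousLinearMap.coe_coe, smul_eq_mul] at h
  rw [dirD, h, cov]
  refine Finset.sum_congr rfl fun α _ => ?_
  rw [mul_comm, pd]
  congr 2
  ext j
  simp [Pi.single_apply, eq_comm]

/-- The directional derivative of a tensor field, componentwise. -/
def dirT (h : Tsr) (p U : Pt) : Fin 4 → Fin 4 → ℝ := fun μ ν => dirD U (fun y => h y μ ν) p

/-- The gradient of a tensor field, componentwise. -/
def gradT (h : Tsr) (p : Pt) : Fin 4 → Fin 4 → Fin 4 → ℝ :=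
  fun α μ ν => pd α (fun y => h y μ ν) p

/-- Full contraction of a gradient-type tensor. -/
def tri (D : Fin 4 → Fin 4 → Fin 4 → ℝ) (U V W : Pt) : ℝ := cov (fun α => tcon (D α) V W) U

lemma tcon_cov (D : Fin 4 → Fin 4 → Fin 4 → ℝ) (U V W : Pt) :
    tcon (fun μ ν => cov (fun α => D α μ ν) U) V W = tri D U V W := by
  simp only [tri, tcon, cov, Fin.sum_univ_four]
  ring

lemma tcon_dirT (h : Tsr) (p U V W : Pt) : tcon (dirT h p U) V W = tri (gradT h p) U V W := by
  rw [← tcon_cov]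
  congr 1
  ext μ ν
  exact dirD_eq_cov _ _ _

lemma dsemi_eq (π : Tsr) (Ds Vs Ws : List Pt) (p : Pt) :
    dsemi π Ds Vs Ws p = (Ds.map fun U => semi (dirT π p U) Vs Ws).sum := rfl

lemma dsemi_nonneg (π : Tsr) (Ds Vs Ws : List Pt) (p : Pt) : 0 ≤ dsemi π Ds Vs Ws p := by
  rw [dsemi_eq]; exact sum_map_nonneg fun _ _ => semi_nonneg _ _ _

lemma semi_dirT_le {π : Tsr} {Ds Vs Ws : List Pt} {p U : Pt} (hU : U ∈ Ds) :
    semi (dirT π p U) Vs Ws ≤ dsemi π Ds Vs Ws p := by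
  rw [dsemi_eq]
  exact le_sum_map_of_mem (f := fun U => semi (dirT π p U) Vs Ws) (fun _ _ => semi_nonneg _ _ _) hU

lemma abs_tri_le {π : Tsr} {Ds Vs Ws : List Pt} {p U V W : Pt} (hU : U ∈ Ds) (hV : V ∈ Vs)
    (hW : W ∈ Ws) : |tri (gradT π p) U V W| ≤ dsemi π Ds Vs Ws p := by
  rw [← tcon_dirT]
  exact (abs_tcon_le_semi hV hW).trans (semi_dirT_le hU)

lemma kdsemi_nonneg {m : ℕ} (ψ : Fin m → Pt → ℝ) (Ds : List Pt) (p : Pt) : 0 ≤ kdsemi ψ Ds p :=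
  sum_map_nonneg fun _ _ => Finset.sum_nonneg fun _ _ => abs_nonneg _

lemma abs_dirD_le_kdsemi {m : ℕ} {ψ : Fin m → Pt → ℝ} {Ds : List Pt} {p U : Pt} (hU : U ∈ Ds)
    (k : Fin m) : |dirD U (ψ k) p| ≤ kdsemi ψ Ds p :=
  (Finset.single_le_sum (f := fun k => |dirD U (ψ k) p|) (fun _ _ => abs_nonneg _)
    (Finset.mem_univ k)).trans
    (le_sum_map_of_mem (f := fun U => ∑ k, |dirD U (ψ k) p|)
      (fun _ _ => Finset.sum_nonneg fun _ _ => abs_nonneg _) hU)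

section

variable {p S₁ S₂ : Pt}

lemma abs_tcon_gradT_le (hr : 0 < rad p) (hf : SphFrame p S₁ S₂) {π : Tsr} {Vs Ws : List Pt}
    {V W : Pt} (hV : V ∈ Vs) (hW : W ∈ Ws) (α : Fin 4) :
    |tcon (gradT π p α) V W| ≤ 4 * dsemi π (Ufam p S₁ S₂) Vs Ws p :=
  abs_coord_le hr hf (fun α => tcon (gradT π p α) V W) α fun _ hU => abs_tri_le hU hV hW

lemma abs_dirT_le (hr : 0 < rad p) (hf : SphFrame p S₁ S₂) {π : Tsr} {Ds : List Pt} {U : Pt}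
    (hU : U ∈ Ds) (μ ν : Fin 4) :
    |dirT π p U μ ν| ≤ 16 * dsemi π Ds (Ufam p S₁ S₂) (Ufam p S₁ S₂) p :=
  (abs_comp_le_semi hr hf _ μ ν).trans (by gcongr; exact semi_dirT_le hU)

lemma abs_gradT_le (hr : 0 < rad p) (hf : SphFrame p S₁ S₂) (π : Tsr) (α μ ν : Fin 4) :
    |gradT π p α μ ν| ≤ 64 * dsemi π (Ufam p S₁ S₂) (Ufam p S₁ S₂) (Ufam p S₁ S₂) p := by
  have := abs_coord_le hr hf (fun α => gradT π p α μ ν) α (X :=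
    16 * dsemi π (Ufam p S₁ S₂) (Ufam p S₁ S₂) (Ufam p S₁ S₂) p) fun U hU => by
      have := abs_dirT_le hr hf (π := π) hU μ ν
      rwa [dirT, dirD_eq_cov] at this
  linarith

lemma abs_pd_le_kdsemi {m : ℕ} (hr : 0 < rad p) (hf : SphFrame p S₁ S₂) (ψ : Fin m → Pt → ℝ)
    (α : Fin 4) (k : Fin m) : |pd α (ψ k) p| ≤ 4 * kdsemi ψ (Ufam p S₁ S₂) p :=
  abs_coord_le hr hf (fun α => pd α (ψ k) p) α fun U hU => by
    rw [← dirD_eq_cov]; exact abs_dirD_le_kdsemi hU k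

/-! ### The linear part of the wave-coordinate condition -/

/-- The expression `m^{αβ}(κ_α^γ D_{γβμ} - ½ κ_μ^γ D_{γαβ})`. -/
def gform (κ : Fin 4 → Fin 4 → ℝ) (D : Fin 4 → Fin 4 → Fin 4 → ℝ) (μ : Fin 4) : ℝ :=
  ∑ α, ∑ β, mink α β * ((∑ γ, κ α γ * D γ β μ) - 1/2 * ∑ γ, κ μ γ * D γ α β)

/-- Coefficients of the commutators `[Z, ∂_α] = κ_α^γ ∂_γ`. -/
def commCoef : ZIdx → Fin 4 → Fin 4 → ℝ
  | Sum.inl _ => fun _ _ => 0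
  | Sum.inr (Sum.inl (i, j)) => fun α γ =>
      -(mink i i * (Pi.single i 1 : Pt) α * (Pi.single j 1 : Pt) γ)
        + mink j j * (Pi.single j 1 : Pt) α * (Pi.single i 1 : Pt) γ
  | Sum.inr (Sum.inr _) => fun α γ => -(Pi.single α 1 : Pt) γ

/-- The coefficients `δ_α^γ`. -/
def idCoef : Fin 4 → Fin 4 → ℝ := fun α γ => (Pi.single α 1 : Pt) γ

lemma sum_idCoef_mul (α : Fin 4) (f : Fin 4 → ℝ) : ∑ γ, idCoef α γ * f γ = f α := by
  simp [idCoef, Pi.single_apply]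

lemma abs_commCoef_le (z : ZIdx) (α γ : Fin 4) : |commCoef z α γ| ≤ 2 := by
  have h : ∀ i α : Fin 4, |(Pi.single i 1 : Pt) α| ≤ 1 := fun i α => by
    by_cases h : α = i <;> simp [h]
  rcases z with z | ⟨i, j⟩ | z
  · simp [commCoef]
  · have k : ∀ i j : Fin 4, |mink i i * (Pi.single i 1 : Pt) α * (Pi.single j 1 : Pt) γ| ≤ 1 :=
      fun i j => by
        rw [abs_mul, abs_mul, abs_mink_self, one_mul]
        exact mul_le_one₀ (h _ _) (abs_nonneg _) (h _ _)
    refine (abs_add_le _ _).trans ?_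
    rw [abs_neg]
    linarith [k i j, k j i]
  · simp only [commCoef, abs_neg]
    linarith [h α γ]

lemma cov_gform_idCoef (hr : 0 < rad p) (hf : SphFrame p S₁ S₂)
    (D : Fin 4 → Fin 4 → Fin 4 → ℝ) :
    cov (gform idCoef D) (Lv p) =
      -(1/2) * (tri D (Lv p) (Lbv p) (Lv p) + tri D (Lbv p) (Lv p) (Lv p))
        + tri D S₁ S₁ (Lv p) + tri D S₂ S₂ (Lv p)
        - 1/2 * (-(1/2) * (tri D (Lv p) (Lv p) (Lbv p) + tri D (Lv p) (Lbv p) (Lv p))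
          + tri D (Lv p) S₁ S₁ + tri D (Lv p) S₂ S₂) := by
  have h1 := trace_eq_frame hr hf fun α β => cov (D α β) (Lv p)
  have h2 := trace_eq_frame hr hf fun α β => cov (fun γ => D γ α β) (Lv p)
  have e1 : ∀ U V, tcon (fun α β => cov (D α β) (Lv p)) U V = tri D U V (Lv p) := fun U V => by
    simp only [tri, tcon, cov, Fin.sum_univ_four]; ring
  simp only [e1, tcon_cov] at h1 h2
  rw [← h1, ← h2]
  simp only [gform, sum_idCoef_mul, cov, Finset.sum_mul, Finset.mul_sum, ← Finset.sum_sub_distrib]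
  rw [Finset.sum_comm]
  refine Finset.sum_congr rfl fun α _ => ?_
  rw [Finset.sum_comm]
  refine Finset.sum_congr rfl fun β _ => ?_
  exact Finset.sum_congr rfl fun γ _ => by ring

lemma abs_tri_le_gform (hr : 0 < rad p) (hf : SphFrame p S₁ S₂) {D : Fin 4 → Fin 4 → Fin 4 → ℝ}
    {t : ℝ} (ht : ∀ U ∈ Tfam p S₁ S₂, ∀ V ∈ Ufam p S₁ S₂, ∀ W ∈ Ufam p S₁ S₂, |tri D U V W| ≤ t) :
    |tri D (Lbv p) (Lv p) (Lv p)| ≤ 2 * |cov (gform idCoef D) (Lv p)| + 10 * t := by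
  have e := cov_gform_idCoef hr hf D
  have mL : Lv p ∈ Tfam p S₁ S₂ := Lv_mem_Tfam
  have m1 : S₁ ∈ Tfam p S₁ S₂ := S₁_mem_Tfam
  have m2 : S₂ ∈ Tfam p S₁ S₂ := S₂_mem_Tfam
  have mB : Lbv p ∈ Ufam p S₁ S₂ := Lbv_mem_Ufam
  have sub : ∀ U ∈ Tfam p S₁ S₂, U ∈ Ufam p S₁ S₂ := fun U hU => Tfam_subset_Ufam hU
  have b1 := abs_le.mp (ht _ mL _ mB _ (sub _ mL))
  have b2 := abs_le.mp (ht _ m1 _ (sub _ m1) _ (sub _ mL))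
  have b3 := abs_le.mp (ht _ m2 _ (sub _ m2) _ (sub _ mL))
  have b4 := abs_le.mp (ht _ mL _ (sub _ mL) _ mB)
  have b5 := abs_le.mp (ht _ mL _ (sub _ m1) _ (sub _ m1))
  have b6 := abs_le.mp (ht _ mL _ (sub _ m2) _ (sub _ m2))
  have c1 := neg_abs_le (cov (gform idCoef D) (Lv p))
  have c2 := le_abs_self (cov (gform idCoef D) (Lv p))
  rw [abs_le]
  constructor <;> linarith [b1.1, b1.2, b2.1, b2.2, b3.1, b3.2, b4.1, b4.2, b5.1, b5.2,
    b6.1, b6.2]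

lemma abs_cov_gform_idCoef_le (hr : 0 < rad p) (hf : SphFrame p S₁ S₂)
    {D : Fin 4 → Fin 4 → Fin 4 → ℝ} {t s : ℝ}
    (ht : ∀ U ∈ Tfam p S₁ S₂, ∀ V ∈ Ufam p S₁ S₂, ∀ W ∈ Ufam p S₁ S₂, |tri D U V W| ≤ t)
    (hs : |tri D (Lbv p) (Lv p) (Lv p)| ≤ s) :
    |cov (gform idCoef D) (Lv p)| ≤ s + 10 * t := by
  have e := cov_gform_idCoef hr hf D
  have mL : Lv p ∈ Tfam p S₁ S₂ := Lv_mem_Tfam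
  have m1 : S₁ ∈ Tfam p S₁ S₂ := S₁_mem_Tfam
  have m2 : S₂ ∈ Tfam p S₁ S₂ := S₂_mem_Tfam
  have mB : Lbv p ∈ Ufam p S₁ S₂ := Lbv_mem_Ufam
  have sub : ∀ U ∈ Tfam p S₁ S₂, U ∈ Ufam p S₁ S₂ := fun U hU => Tfam_subset_Ufam hU
  have b1 := abs_le.mp (ht _ mL _ mB _ (sub _ mL))
  have b2 := abs_le.mp (ht _ m1 _ (sub _ m1) _ (sub _ mL))
  have b3 := abs_le.mp (ht _ m2 _ (sub _ m2) _ (sub _ mL))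
  have b4 := abs_le.mp (ht _ mL _ (sub _ mL) _ mB)
  have b5 := abs_le.mp (ht _ mL _ (sub _ m1) _ (sub _ m1))
  have b6 := abs_le.mp (ht _ mL _ (sub _ m2) _ (sub _ m2))
  have c1 := abs_le.mp hs
  rw [e, abs_le]
  constructor <;> linarith [b1.1, b1.2, b2.1, b2.2, b3.1, b3.2, b4.1, b4.2, b5.1, b5.2,
    b6.1, b6.2, c1.1, c1.2]

lemma cov_gform_rotation (D : Fin 4 → Fin 4 → Fin 4 → ℝ) (i j : Fin 4) :
    cov (gform (commCoef (Sum.inr (Sum.inl (i, j)))) D) (Lv p) =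
      cov (D i j) (Lv p) - cov (D j i) (Lv p)
        + 1/2 * (ell p i * trm (D j) - ell p j * trm (D i)) := by
  have hc : ∀ (α : Fin 4) (f : Fin 4 → ℝ),
      ∑ γ, commCoef (Sum.inr (Sum.inl (i, j))) α γ * f γ =
        -(mink i i * (Pi.single i 1 : Pt) α * f j) + mink j j * (Pi.single j 1 : Pt) α * f i := by
    intro α f
    simp [commCoef, add_mul, Finset.sum_add_distrib, Pi.single_apply]
  have hg : ∀ μ, gform (commCoef (Sum.inr (Sum.inl (i, j)))) D μ =
      D i j μ - D j i μ + 1/2 * (mink i i * (Pi.single i 1 : Pt) μ * trm (D j)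
        - mink j j * (Pi.single j 1 : Pt) μ * trm (D i)) := by
    intro μ
    have hd : ∀ α : Fin 4, ∀ F : Fin 4 → ℝ, (∑ β, mink α β * F β) = mink α α * F α :=
      fun α F => sum_mink_mul α F
    have hs : ∀ i j : Fin 4, (∑ α, mink α α * (mink i i * (Pi.single i 1 : Pt) α * D j α μ)) =
        D j i μ := fun i j => by
      rw [Finset.sum_eq_single_of_mem i (Finset.mem_univ _)]
      · rw [Pi.single_eq_same]
        linear_combination (D j i μ) * mink_self_mul_self i
      · intro α _ h; simp [h]
    simp only [gform, hc, hd, trm, mul_sub, mul_add, mul_neg, Finset.sum_sub_distrib,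
      Finset.sum_add_distrib, Finset.sum_neg_distrib, hs, Finset.mul_sum]
    have r : ∀ i j : Fin 4,
        (∑ α, mink α α * (1/2 * (mink i i * (Pi.single i 1 : Pt) μ * D j α α))) =
        ∑ α, 1/2 * (mink i i * (Pi.single i 1 : Pt) μ * (mink α α * D j α α)) := fun i j =>
      Finset.sum_congr rfl fun _ _ => by ring
    rw [r, r]
    ring
  simp only [cov, hg, sub_mul, add_mul, mul_sub, Finset.sum_sub_distrib, Finset.sum_add_distrib]
  have s : ∀ i j : Fin 4, (∑ μ, 1/2 * (mink i i * (Pi.single i 1 : Pt) μ * trm (D j)) * Lv p μ) =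
      1/2 * (ell p i * trm (D j)) := fun i j => by
    rw [Finset.sum_eq_single_of_mem i (Finset.mem_univ _)]
    · rw [Pi.single_eq_same, ell]; ring
    · intro α _ h; simp [h]
  rw [s, s]

lemma abs_antisymm_le (hr : 0 < rad p) (hf : SphFrame p S₁ S₂) {T : Fin 4 → Fin 4 → ℝ} {t s : ℝ}
    (ht : ∀ V ∈ Tfam p S₁ S₂, ∀ W ∈ Ufam p S₁ S₂, |tcon T V W| ≤ t)
    (hs : ∀ W ∈ Tfam p S₁ S₂, |tcon T (Lbv p) W| ≤ s) (i j : Fin 4) :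
    |T i j - T j i| ≤ 24 * t + 3 * s := by
  have h1 : ∀ i j, |T i j + 1/2 * ell p i * cov (fun α => T α j) (Lbv p)| ≤ 3 * (4 * t) :=
    fun i j => abs_coord_add_le hr hf (fun α => T α j) i fun V hV =>
      abs_coord_le hr hf (fun j => cov (fun α => T α j) V) j fun W hW => by
        rw [← tcon_eq_cov_left]; exact ht V hV W hW
  have h2 : ∀ j, |cov (fun α => T α j) (Lbv p) + 1/2 * ell p j * tcon T (Lbv p) (Lbv p)|
      ≤ 3 * s := fun j => by
    rw [tcon_eq_cov_left]
    exact abs_coord_add_le hr hf (fun j => cov (fun α => T α j) (Lbv p)) j fun W hW => by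
      rw [← tcon_eq_cov_left]; exact hs W hW
  have h3 : ∀ i j, |ell p i * (cov (fun α => T α j) (Lbv p)
      + 1/2 * ell p j * tcon T (Lbv p) (Lbv p))| ≤ 3 * s := fun i j => by
    rw [abs_mul]
    exact (mul_le_of_le_one_left (abs_nonneg _) (abs_ell_le p i)).trans (h2 j)
  have e : T i j - T j i = (T i j + 1/2 * ell p i * cov (fun α => T α j) (Lbv p))
      - (T j i + 1/2 * ell p j * cov (fun α => T α i) (Lbv p))
      - 1/2 * (ell p i * (cov (fun α => T α j) (Lbv p)
        + 1/2 * ell p j * tcon T (Lbv p) (Lbv p)))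
      + 1/2 * (ell p j * (cov (fun α => T α i) (Lbv p)
        + 1/2 * ell p i * tcon T (Lbv p) (Lbv p))) := by ring
  have a1 := abs_le.mp (h1 i j)
  have a2 := abs_le.mp (h1 j i)
  have a3 := abs_le.mp (h3 i j)
  have a4 := abs_le.mp (h3 j i)
  rw [abs_le, e]
  constructor <;> linarith [a1.1, a1.2, a2.1, a2.2, a3.1, a3.2, a4.1, a4.2]

/-- The first-order commutator contributions to the wave-coordinate condition only see the
components `∂h_{ℒ𝒯}` and tangential derivatives. -/
lemma abs_cov_gform_commCoef_le (hr : 0 < rad p) (hf : SphFrame p S₁ S₂)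
    {D : Fin 4 → Fin 4 → Fin 4 → ℝ} (hD : ∀ α μ ν, D α μ ν = D α ν μ) {t s : ℝ}
    (ht : ∀ U ∈ Tfam p S₁ S₂, ∀ V ∈ Ufam p S₁ S₂, ∀ W ∈ Ufam p S₁ S₂, |tri D U V W| ≤ t)
    (hs : ∀ W ∈ Tfam p S₁ S₂, |tri D (Lbv p) (Lv p) W| ≤ s) (z : ZIdx) :
    |cov (gform (commCoef z) D) (Lv p)| ≤ 60 * (t + s) := by
  have mL : Lv p ∈ Tfam p S₁ S₂ := Lv_mem_Tfam
  have t0 : 0 ≤ t := (abs_nonneg _).trans (ht _ mL _ (Tfam_subset_Ufam mL) _ (Tfam_subset_Ufam mL))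
  have s0 : 0 ≤ s := (abs_nonneg _).trans (hs _ mL)
  rcases z with z | ⟨i, j⟩ | z
  · have : cov (gform (commCoef (Sum.inl z)) D) (Lv p) = 0 := by simp [cov, gform, commCoef]
    rw [this, abs_zero]; positivity
  · rw [cov_gform_rotation]
    have e1 : ∀ U V, tcon (fun α β => cov (D α β) (Lv p)) U V = tri D U V (Lv p) := fun U V => by
      simp only [tri, tcon, cov, Fin.sum_univ_four]; ring
    have b1 : |cov (D i j) (Lv p) - cov (D j i) (Lv p)| ≤ 24 * t + 3 * s := by
      refine abs_antisymm_le hr hf (T := fun i j => cov (D i j) (Lv p)) (fun V hV W hW => ?_)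
        (fun W hW => ?_) i j
      · rw [e1]; exact ht V hV W hW _ (Tfam_subset_Ufam mL)
      · rw [e1]
        have : tri D (Lbv p) W (Lv p) = tri D (Lbv p) (Lv p) W := by
          simp only [tri, tcon_comm (hD _) W]
        rw [this]; exact hs W hW
    have htr : ∀ V ∈ Tfam p S₁ S₂, |cov (fun α => trm (D α)) V| ≤ 3 * t := fun V hV => by
      have : cov (fun α => trm (D α)) V = trm fun μ ν => cov (fun α => D α μ ν) V := by
        simp only [trm, cov, Fin.sum_univ_four]; ring
      rw [this]
      refine abs_trm_le hr hf (fun μ ν => by simp only [hD _ μ ν]) fun W hW W' hW' => ?_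
      rw [tcon_cov]
      exact ht V hV W (Tfam_subset_Ufam hW) W' hW'
    have h1 : ∀ i, |trm (D i) + 1/2 * ell p i * cov (fun α => trm (D α)) (Lbv p)| ≤ 3 * (3 * t) :=
      fun i => abs_coord_add_le hr hf (fun α => trm (D α)) i htr
    have h2 : ∀ i j, |ell p i * (trm (D j) + 1/2 * ell p j * cov (fun α => trm (D α)) (Lbv p))|
        ≤ 3 * (3 * t) := fun i j => by
      rw [abs_mul]
      exact (mul_le_of_le_one_left (abs_nonneg _) (abs_ell_le p i)).trans (h1 j)
    have e : ell p i * trm (D j) - ell p j * trm (D i) =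
        ell p i * (trm (D j) + 1/2 * ell p j * cov (fun α => trm (D α)) (Lbv p))
        - ell p j * (trm (D i) + 1/2 * ell p i * cov (fun α => trm (D α)) (Lbv p)) := by ring
    have a1 := abs_le.mp (h2 i j)
    have a2 := abs_le.mp (h2 j i)
    have a3 := abs_le.mp b1
    rw [e, abs_le]
    constructor <;> linarith [a1.1, a1.2, a2.1, a2.2, a3.1, a3.2]
  · have : cov (gform (commCoef (Sum.inr (Sum.inr z))) D) (Lv p) =
        -cov (gform idCoef D) (Lv p) := by
      have hg : ∀ μ, gform (commCoef (Sum.inr (Sum.inr z))) D μ = -gform idCoef D μ := fun μ => by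
        simp only [gform, commCoef, idCoef, neg_mul, ← Finset.sum_neg_distrib]
        refine Finset.sum_congr rfl fun α _ => Finset.sum_congr rfl fun β _ => ?_
        simp only [Finset.sum_neg_distrib]
        ring
      simp only [cov, hg, neg_mul, Finset.sum_neg_distrib]
    rw [this, abs_neg]
    linarith [abs_cov_gform_idCoef_le hr hf ht (hs _ mL)]

end

/-! ### Calculus of the Minkowski vector fields -/

/-- Smooth scalar functions on spacetime. -/
abbrev Sm (f : Pt → ℝ) : Prop := ContDiff ℝ (⊤ : ℕ∞) f

lemma Sm.differentiable {f : Pt → ℝ} (hf : Sm f) : Differentiable ℝ f :=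
  ContDiff.differentiable hf (by simp)

lemma Sm.fderiv {f : Pt → ℝ} (hf : Sm f) : ContDiff ℝ (⊤ : ℕ∞) (fderiv ℝ f) :=
  ContDiff.fderiv_right hf (by simp)

lemma Sm.pd {f : Pt → ℝ} (hf : Sm f) (α : Fin 4) : Sm (pd α f) :=
  hf.fderiv.clm_apply contDiff_const

lemma contDiff_Zv (z : ZIdx) : ContDiff ℝ (⊤ : ℕ∞) (Zv z) := by
  rcases z with z | ⟨i, j⟩ | z
  · exact contDiff_const
  · rw [contDiff_pi]
    intro ρ
    simp only [Zv]
    fun_prop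
  · exact contDiff_id

lemma Sm.Zap {f : Pt → ℝ} (hf : Sm f) (z : ZIdx) : Sm (Zap z f) :=
  hf.fderiv.clm_apply (contDiff_Zv z)

lemma Sm.Ziter {f : Pt → ℝ} (hf : Sm f) (l : List ZIdx) : Sm (Ziter l f) := by
  induction l with
  | nil => exact hf
  | cons z l ih => exact ih.Zap z

lemma Ziter_append (l l' : List ZIdx) (f : Pt → ℝ) : Ziter (l ++ l') f = Ziter l (Ziter l' f) := by
  induction l with
  | nil => rfl
  | cons z l ih => simp [Ziter, ih]

lemma Ziter_concat (l : List ZIdx) (z : ZIdx) (f : Pt → ℝ) :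
    Ziter (l ++ [z]) f = Ziter l (Zap z f) := Ziter_append l [z] f

lemma Zap_add {f g : Pt → ℝ} (hf : Sm f) (hg : Sm g) (z : ZIdx) :
    Zap z (fun y => f y + g y) = fun y => Zap z f y + Zap z g y := by
  ext p
  simp only [Zap]
  rw [fderiv_fun_add (hf.differentiable p) (hg.differentiable p)]
  rfl

lemma Zap_const_mul {f : Pt → ℝ} (hf : Sm f) (c : ℝ) (z : ZIdx) :
    Zap z (fun y => c * f y) = fun y => c * Zap z f y := by
  ext p
  simp only [Zap]
  rw [fderiv_const_mul (hf.differentiable p)]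
  rfl

lemma Zap_mul {f g : Pt → ℝ} (hf : Sm f) (hg : Sm g) (z : ZIdx) :
    Zap z (fun y => f y * g y) = fun y => Zap z f y * g y + f y * Zap z g y := by
  ext p
  simp only [Zap]
  rw [fderiv_fun_mul (hf.differentiable p) (hg.differentiable p)]
  simp
  ring

lemma Ziter_add {f g : Pt → ℝ} (hf : Sm f) (hg : Sm g) (l : List ZIdx) :
    Ziter l (fun y => f y + g y) = fun y => Ziter l f y + Ziter l g y := by
  induction l with
  | nil => rfl
  | cons z l ih => simp only [Ziter, ih]; exact Zap_add (hf.Ziter l) (hg.Ziter l) z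

lemma Ziter_const_mul {f : Pt → ℝ} (hf : Sm f) (c : ℝ) (l : List ZIdx) :
    Ziter l (fun y => c * f y) = fun y => c * Ziter l f y := by
  induction l with
  | nil => rfl
  | cons z l ih => simp only [Ziter, ih]; exact Zap_const_mul (hf.Ziter l) c z

lemma Ziter_sub {f g : Pt → ℝ} (hf : Sm f) (hg : Sm g) (l : List ZIdx) :
    Ziter l (fun y => f y - g y) = fun y => Ziter l f y - Ziter l g y := by
  have h := Ziter_add hf (contDiff_const.mul hg : Sm fun y => (-1) * g y) l
  simp only [Ziter_const_mul hg] at h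
  simpa [sub_eq_add_neg] using h

lemma Zap_zero (z : ZIdx) : Zap z (fun _ => 0) = fun _ => 0 := by
  ext p; simp [Zap]

lemma Ziter_zero (l : List ZIdx) : Ziter l (fun _ => 0) = fun _ => 0 := by
  induction l with
  | nil => rfl
  | cons z l ih => simp only [Ziter, ih]; exact Zap_zero z

lemma Ziter_sum {ι : Type*} (s : Finset ι) {f : ι → Pt → ℝ} (hf : ∀ i, Sm (f i)) (l : List ZIdx) :
    Ziter l (fun y => ∑ i ∈ s, f i y) = fun y => ∑ i ∈ s, Ziter l (f i) y := by
  classical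
  induction s using Finset.induction_on with
  | empty => simpa using Ziter_zero l
  | insert a s ha ih =>
    simp only [Finset.sum_insert ha]
    rw [Ziter_add (hf a) (ContDiff.sum fun i _ => hf i), ih]

lemma Zap_congr {f g : Pt → ℝ} {p : Pt} (h : f =ᶠ[nhds p] g) (z : ZIdx) :
    Zap z f =ᶠ[nhds p] Zap z g := by
  filter_upwards [h.fderiv (𝕜 := ℝ)] with y hy
  simp only [Zap, hy]

lemma Ziter_congr {f g : Pt → ℝ} {p : Pt} (h : f =ᶠ[nhds p] g) (l : List ZIdx) :
    Ziter l f =ᶠ[nhds p] Ziter l g := by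
  induction l with
  | nil => exact h
  | cons z l ih => exact Zap_congr ih z

lemma hasFDerivAt_Zv_apply (z : ZIdx) (p : Pt) (α : Fin 4) :
    fderiv ℝ (Zv z) p (Pi.single α 1) = fun γ => -commCoef z α γ := by
  rcases z with z | ⟨i, j⟩ | z
  · ext γ
    simp [Zv, commCoef]
  · ext γ
    have hd : ∀ ρ, DifferentiableAt ℝ (fun y : Pt => Zv (Sum.inr (Sum.inl (i, j))) y ρ) p :=
      fun ρ => by simp only [Zv]; fun_prop
    have hp : ∀ k : Fin 4, fderiv ℝ (fun y : Pt => y k) p = ContinuousLinearMap.proj k := fun k =>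
      (ContinuousLinearMap.proj (R := ℝ) (φ := fun _ : Fin 4 => ℝ) k).hasFDerivAt.fderiv
    rw [show fderiv ℝ (Zv (Sum.inr (Sum.inl (i, j)))) p (Pi.single α 1) γ =
        fderiv ℝ (fun y : Pt => Zv (Sum.inr (Sum.inl (i, j))) y γ) p (Pi.single α 1) by
      rw [fderiv_pi hd]; rfl]
    simp only [Zv, commCoef]
    rw [fderiv_fun_sub (by fun_prop) (by fun_prop), fderiv_mul_const (by fun_prop),
      fderiv_mul_const (by fun_prop), fderiv_const_mul (by fun_prop),
      fderiv_const_mul (by fun_prop), hp, hp]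
    simp [Pi.single_comm]
    have : ∀ k : Fin 4, (Pi.single α 1 : Pt) k = (Pi.single k 1 : Pt) α := fun k => by
      simp [Pi.single_apply, eq_comm]
    rw [this, this]
    ring
  · ext γ
    have : Zv (Sum.inr (Sum.inr z)) = id := rfl
    rw [this, fderiv_id]
    simp [commCoef]

lemma Zap_pd {f : Pt → ℝ} (hf : Sm f) (z : ZIdx) (α : Fin 4) :
    Zap z (pd α f) = fun p => pd α (Zap z f) p + ∑ γ, commCoef z α γ * pd γ f p := by
  ext p
  have h1 : DifferentiableAt ℝ (fderiv ℝ f) p := hf.fderiv.differentiable (by simp) p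
  have h2 : DifferentiableAt ℝ (Zv z) p := (contDiff_Zv z).differentiable (by simp) p
  have hs : IsSymmSndFDerivAt ℝ f p := (hf.contDiffAt).isSymmSndFDerivAt (by
    rw [minSmoothness_of_isRCLikeNormedField]
    exact WithTop.coe_le_coe.mpr le_top)
  have e1 : Zap z (pd α f) p = fderiv ℝ (fderiv ℝ f) p (Zv z p) (Pi.single α 1) := by
    show fderiv ℝ (fun y => fderiv ℝ f y (Pi.single α 1)) p (Zv z p) = _
    rw [fderiv_clm_apply h1 (differentiableAt_const _)]
    simp
  have e2 : pd α (Zap z f) p = fderiv ℝ (fderiv ℝ f) p (Pi.single α 1) (Zv z p)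
      + fderiv ℝ f p (fderiv ℝ (Zv z) p (Pi.single α 1)) := by
    show fderiv ℝ (fun y => fderiv ℝ f y (Zv z y)) p (Pi.single α 1) = _
    rw [fderiv_clm_apply h1 h2]
    simp [add_comm]
  have e3 : fderiv ℝ f p (fun γ => -commCoef z α γ) = -∑ γ, commCoef z α γ * pd γ f p := by
    have := dirD_eq_cov (fun γ => -commCoef z α γ) f p
    rw [dirD] at this
    rw [this, cov, ← Finset.sum_neg_distrib]
    exact Finset.sum_congr rfl fun _ _ => by ring
  rw [e1, e2, hasFDerivAt_Zv_apply, e3, hs.eq]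
  ring

lemma abs_Ziter_mul_le {p : Pt} {X : ℝ} (l : List ZIdx) {F G : Pt → ℝ} (hF : Sm F) (hG : Sm G)
    (h : ∀ J K : List ZIdx, J.length + K.length ≤ l.length → |Ziter J F p * Ziter K G p| ≤ X) :
    |Ziter l (fun y => F y * G y) p| ≤ 2 ^ l.length * X := by
  induction l using List.reverseRecOn generalizing F G with
  | nil => simpa [Ziter, abs_mul] using h [] [] (by simp)
  | append_singleton l z ih =>
    rw [Ziter_concat, Zap_mul hF hG, Ziter_add ((hF.Zap z).mul hG) (hF.mul (hG.Zap z))]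
    have i1 := ih (hF.Zap z) hG fun J K hJK => by
      rw [← Ziter_concat]; exact h _ _ (by simp; omega)
    have i2 := ih hF (hG.Zap z) fun J K hJK => by
      rw [← Ziter_concat]; exact h _ _ (by simp; omega)
    refine (abs_add_le _ _).trans ?_
    rw [List.length_append, List.length_singleton, pow_succ]
    linarith

lemma abs_sum_commCoef_mul_le (z : ZIdx) (α : Fin 4) {f : Fin 4 → ℝ} {X : ℝ} (hX : ∀ γ, |f γ| ≤ X) :
    |∑ γ, commCoef z α γ * f γ| ≤ 8 * X := by
  have X0 : 0 ≤ X := (abs_nonneg _).trans (hX 0)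
  refine (abs_sum_mul_le _ _ _ fun γ _ => hX γ).trans ?_
  gcongr
  exact (Finset.sum_le_card_nsmul _ _ 2 fun γ _ => abs_commCoef_le z α γ).trans
    (by norm_num)

lemma Ziter_Zap_pd {f : Pt → ℝ} (hf : Sm f) (l : List ZIdx) (z : ZIdx) (α : Fin 4) (p : Pt) :
    Ziter (l ++ [z]) (pd α f) p =
      Ziter l (pd α (Zap z f)) p + ∑ γ, commCoef z α γ * Ziter l (pd γ f) p := by
  have hs : ∀ γ, Sm fun y => commCoef z α γ * pd γ f y := fun γ => contDiff_const.mul (hf.pd γ)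
  rw [Ziter_concat, Zap_pd hf, Ziter_add ((hf.Zap z).pd α) (ContDiff.sum fun γ _ => hs γ),
    Ziter_sum _ hs]
  simp only [Ziter_const_mul (hf.pd _)]

lemma abs_Ziter_pd_sub_le {p : Pt} {X : ℝ} (l : List ZIdx) {f : Pt → ℝ} (hf : Sm f)
    (h : ∀ J : List ZIdx, J.length < l.length → ∀ γ, |pd γ (Ziter J f) p| ≤ X) (α : Fin 4) :
    |Ziter l (pd α f) p - pd α (Ziter l f) p| ≤ (9 ^ l.length - 1) * X := by
  induction l using List.reverseRecOn generalizing f α with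
  | nil => simp [Ziter]
  | append_singleton l z ih =>
    rw [Ziter_Zap_pd hf, Ziter_concat]
    have i1 := ih (hf.Zap z) (fun J hJ γ => by
      rw [← Ziter_concat]; exact h _ (by simp; omega) γ) α
    have i2 : ∀ γ, |Ziter l (pd γ f) p| ≤ 9 ^ l.length * X := fun γ => by
      have a := ih hf (fun J hJ γ => h J (by simp; omega) γ) γ
      have b := h l (by simp) γ
      rw [abs_le] at *
      constructor <;> linarith [a.1, a.2, b.1, b.2]
    have i3 := abs_sum_commCoef_mul_le z α i2
    have e : (9 : ℝ) ^ (l ++ [z]).length = 9 * 9 ^ l.length := by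
      rw [List.length_append, List.length_singleton, pow_succ]; ring
    rw [e]
    rw [abs_le] at *
    constructor <;> linarith [i1.1, i1.2, i3.1, i3.2]

lemma abs_Ziter_pd_le {p : Pt} {X : ℝ} (l : List ZIdx) {f : Pt → ℝ} (hf : Sm f)
    (h : ∀ J : List ZIdx, J.length ≤ l.length → ∀ γ, |pd γ (Ziter J f) p| ≤ X) (α : Fin 4) :
    |Ziter l (pd α f) p| ≤ 9 ^ l.length * X := by
  have a := abs_Ziter_pd_sub_le l hf (fun J hJ => h J hJ.le) α
  have b := h l le_rfl α
  rw [abs_le] at *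
  constructor <;> linarith [a.1, a.2, b.1, b.2]

/-! ### Commuting vector fields through the wave-coordinate condition -/

/-- `Z^l` applied to the gradient of a tensor field. -/
def ZgradT (l : List ZIdx) (h : Tsr) (p : Pt) : Fin 4 → Fin 4 → Fin 4 → ℝ :=
  fun γ μ ν => Ziter l (pd γ fun y => h y μ ν) p

lemma Ztsr_concat (l : List ZIdx) (z : ZIdx) (h : Tsr) :
    Ztsr (l ++ [z]) h = Ztsr l (Ztsr [z] h) := by
  ext p μ ν
  exact congrFun (Ziter_concat l z fun y => h y μ ν) p

lemma gform_sub (κ : Fin 4 → Fin 4 → ℝ) (D D' : Fin 4 → Fin 4 → Fin 4 → ℝ) (μ : Fin 4) :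
    gform κ D μ - gform κ D' μ = gform κ (fun γ α β => D γ α β - D' γ α β) μ := by
  simp only [gform, mul_sub, Finset.sum_sub_distrib]
  ring

lemma abs_gform_le {κ : Fin 4 → Fin 4 → ℝ} (hκ : ∀ α γ, |κ α γ| ≤ 2)
    {D : Fin 4 → Fin 4 → Fin 4 → ℝ} {X : ℝ} (hD : ∀ α μ ν, |D α μ ν| ≤ X) (μ : Fin 4) :
    |gform κ D μ| ≤ 192 * X := by
  have X0 : 0 ≤ X := (abs_nonneg _).trans (hD 0 0 0)
  have k : ∀ α (f : Fin 4 → ℝ), (∀ γ, |f γ| ≤ X) → |∑ γ, κ α γ * f γ| ≤ 8 * X := fun α f hf => by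
    refine (abs_sum_mul_le _ _ _ fun γ _ => hf γ).trans ?_
    gcongr
    exact (Finset.sum_le_card_nsmul _ _ 2 fun γ _ => hκ α γ).trans (by norm_num)
  have i : ∀ α β, |(∑ γ, κ α γ * D γ β μ) - 1/2 * ∑ γ, κ μ γ * D γ α β| ≤ 12 * X := fun α β => by
    have a := k α (fun γ => D γ β μ) fun γ => hD γ β μ
    have b := k μ (fun γ => D γ α β) fun γ => hD γ α β
    rw [abs_le] at *
    constructor <;> linarith [a.1, a.2, b.1, b.2]
  rw [gform]
  simp only [← Finset.sum_product']
  refine (abs_sum_mul_le _ (fun x : Fin 4 × Fin 4 => mink x.1 x.2) _ fun x _ => i x.1 x.2).trans ?_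
  have : ∑ x ∈ (Finset.univ : Finset (Fin 4)) ×ˢ (Finset.univ : Finset (Fin 4)),
      |mink x.1 x.2| ≤ 16 :=
    (Finset.sum_le_card_nsmul _ _ 1 fun x _ => abs_mink_le _ _).trans (by simp)
  nlinarith

lemma abs_cov_gform_commCoef_sub_le {p : Pt} {X : ℝ} (hX0 : 0 ≤ X) (l : List ZIdx) {h : Tsr}
    (hh : ∀ μ ν, Sm fun y => h y μ ν)
    (hX : ∀ J : List ZIdx, J.length < l.length → ∀ γ μ ν, |gradT (Ztsr J h) p γ μ ν| ≤ X)
    (z : ZIdx) :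
    |cov (gform (commCoef z) (ZgradT l h p)) (Lv p)
      - cov (gform (commCoef z) (gradT (Ztsr l h) p)) (Lv p)| ≤ 768 * (9 ^ l.length * X) := by
  have e : cov (gform (commCoef z) (ZgradT l h p)) (Lv p)
      - cov (gform (commCoef z) (gradT (Ztsr l h) p)) (Lv p) =
      cov (gform (commCoef z) fun γ α β => ZgradT l h p γ α β - gradT (Ztsr l h) p γ α β)
        (Lv p) := by
    simp only [cov, ← gform_sub, sub_mul, Finset.sum_sub_distrib]
  rw [e]
  refine (abs_cov_le (abs_Lv_le p) fun μ => abs_gform_le (abs_commCoef_le z)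
    (X := 9 ^ l.length * X) (fun α μ ν => ?_) μ).trans (by linarith)
  refine (abs_Ziter_pd_sub_le l (hh μ ν) (fun J hJ γ => hX J hJ γ μ ν) α).trans ?_
  linarith

lemma ZgradT_concat (l : List ZIdx) (z : ZIdx) {h : Tsr} (hh : ∀ μ ν, Sm fun y => h y μ ν)
    (p : Pt) (γ μ ν : Fin 4) :
    ZgradT (l ++ [z]) h p γ μ ν =
      ZgradT l (Ztsr [z] h) p γ μ ν + ∑ δ, commCoef z γ δ * ZgradT l h p δ μ ν :=
  Ziter_Zap_pd (hh μ ν) l z γ p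

lemma gform_idCoef_add (D D' : Fin 4 → Fin 4 → Fin 4 → ℝ) (κ : Fin 4 → Fin 4 → ℝ) (μ : Fin 4) :
    gform idCoef (fun γ α β => D γ α β + ∑ δ, κ γ δ * D' δ α β) μ =
      gform idCoef D μ + gform κ D' μ := by
  simp only [gform, sum_idCoef_mul, ← Finset.sum_add_distrib]
  exact Finset.sum_congr rfl fun α _ => Finset.sum_congr rfl fun β _ => by ring

lemma abs_cov_gform_idCoef_sub_le {p : Pt} {X Y : ℝ} (hX0 : 0 ≤ X) (hY0 : 0 ≤ Y) (l : List ZIdx)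
    {h : Tsr} (hh : ∀ μ ν, Sm fun y => h y μ ν)
    (hX : ∀ J : List ZIdx, J.length + 2 ≤ l.length → ∀ γ μ ν, |gradT (Ztsr J h) p γ μ ν| ≤ X)
    (hY : ∀ J : List ZIdx, J.length + 1 ≤ l.length → ∀ z,
      |cov (gform (commCoef z) (gradT (Ztsr J h) p)) (Lv p)| ≤ Y) :
    |cov (gform idCoef (ZgradT l h p)) (Lv p)
      - cov (gform idCoef (gradT (Ztsr l h) p)) (Lv p)| ≤ 769 * 10 ^ l.length * (X + Y) := by
  induction l using List.reverseRecOn generalizing h with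
  | nil =>
    have : ZgradT [] h p = gradT (Ztsr [] h) p := rfl
    rw [this, sub_self, abs_zero]
    positivity
  | append_singleton l z ih =>
    have i1 := ih (h := Ztsr [z] h) (fun μ ν => (hh μ ν).Zap z) (fun J hJ => by
        rw [← Ztsr_concat]; exact hX _ (by simp; omega)) (fun J hJ => by
        rw [← Ztsr_concat]; exact hY _ (by simp; omega))
    have i2 := abs_cov_gform_commCoef_sub_le hX0 l hh
      (fun J hJ => hX J (by simp; omega)) z
    have i3 := hY l (by simp) z
    have e : cov (gform idCoef (ZgradT (l ++ [z]) h p)) (Lv p) =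
        cov (gform idCoef (ZgradT l (Ztsr [z] h) p)) (Lv p)
          + cov (gform (commCoef z) (ZgradT l h p)) (Lv p) := by
      have : ZgradT (l ++ [z]) h p = fun γ μ ν =>
          ZgradT l (Ztsr [z] h) p γ μ ν + ∑ δ, commCoef z γ δ * ZgradT l h p δ μ ν := by
        ext γ μ ν; exact ZgradT_concat l z hh p γ μ ν
      simp only [this, cov, gform_idCoef_add, add_mul, Finset.sum_add_distrib]
    rw [e, Ztsr_concat]
    have hpow : (9 : ℝ) ^ l.length ≤ 10 ^ l.length := by gcongr; norm_num
    have hone : (1 : ℝ) ≤ 10 ^ l.length := one_le_pow₀ (by norm_num)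
    have j1 : (9 : ℝ) ^ l.length * X ≤ 10 ^ l.length * X := by gcongr
    have j2 : Y ≤ 10 ^ l.length * Y := le_mul_of_one_le_left hY0 hone
    have j3 : 0 ≤ (10 : ℝ) ^ l.length * X := by positivity
    have e2 : (10 : ℝ) ^ (l ++ [z]).length = 10 * 10 ^ l.length := by
      rw [List.length_append, List.length_singleton, pow_succ]; ring
    rw [e2]
    rw [abs_le] at *
    constructor <;> nlinarith [i1.1, i1.2, i2.1, i2.2, i3.1, i3.2]

/-! ### Commuting vector fields through `P` -/

lemma trm_smul (c : ℝ) (π : Fin 4 → Fin 4 → ℝ) : trm (c • π) = c * trm π := by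
  simp only [trm, Pi.smul_apply, smul_eq_mul, Finset.mul_sum, mul_left_comm]

lemma inm_smul_left (c : ℝ) (π θ : Fin 4 → Fin 4 → ℝ) : inm (c • π) θ = c * inm π θ := by
  simp only [inm, Pi.smul_apply, smul_eq_mul, Finset.mul_sum, mul_left_comm, mul_assoc]

lemma inm_smul_right (c : ℝ) (π θ : Fin 4 → Fin 4 → ℝ) : inm π (c • θ) = c * inm π θ := by
  simp only [inm, Pi.smul_apply, smul_eq_mul, Finset.mul_sum, mul_left_comm, mul_assoc]

/-- The form `Pform` as a continuous bilinear map. -/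
def Pbil {m : ℕ} (N : Fin m → ℝ) (NN : Fin m → Fin m → ℝ) : WVal m →L[ℝ] WVal m →L[ℝ] ℝ :=
  LinearMap.toContinuousBilinearMap <| LinearMap.mk₂ ℝ (fun a b => Pform N NN a.1 a.2 b.1 b.2)
    (fun a a' b => by
      simp only [Pform, trm, inm, Prod.fst_add, Prod.snd_add, Pi.add_apply, mul_add, add_mul,
        Finset.sum_add_distrib]
      ring)
    (fun c a b => by
      simp only [Pform, Prod.smul_fst, Prod.smul_snd, trm_smul, inm_smul_left, Pi.smul_apply,
        smul_eq_mul, mul_add, Finset.mul_sum, Finset.sum_add_distrib]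
      refine congrArg₂ (· + ·) (congrArg₂ (· + ·) (by ring) (congrArg₂ (· + ·) ?_ ?_))
        (congrArg₂ (· + ·) ?_ ?_)
      all_goals refine Finset.sum_congr rfl fun k _ => ?_
      all_goals first | ring1 | exact Finset.sum_congr rfl fun _ _ => by ring1)
    (fun a b b' => by
      simp only [Pform, trm, inm, Prod.fst_add, Prod.snd_add, Pi.add_apply, mul_add, add_mul,
        Finset.sum_add_distrib]
      ring)
    (fun c a b => by
      simp only [Pform, Prod.smul_fst, Prod.smul_snd, trm_smul, inm_smul_right, Pi.smul_apply,
        smul_eq_mul, mul_add, Finset.mul_sum, Finset.sum_add_distrib]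
      refine congrArg₂ (· + ·) (congrArg₂ (· + ·) (by ring) (congrArg₂ (· + ·) ?_ ?_))
        (congrArg₂ (· + ·) ?_ ?_)
      all_goals refine Finset.sum_congr rfl fun k _ => ?_
      all_goals first | ring1 | exact Finset.sum_congr rfl fun _ _ => by ring1)

lemma Pbil_apply {m : ℕ} (N : Fin m → ℝ) (NN : Fin m → Fin m → ℝ) (a b : WVal m) :
    Pbil N NN a b = Pform N NN a.1 a.2 b.1 b.2 := rfl

/-- The derivative `∂_α W` as a function on spacetime. -/
def Wgrad {m : ℕ} (α : Fin 4) (h : Tsr) (ψ : Fin m → Pt → ℝ) (y : Pt) : WVal m :=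
  (gradT h y α, fun k => pd α (ψ k) y)

/-- Smoothness of all components of `W`. -/
structure SmW {m : ℕ} (h : Tsr) (ψ : Fin m → Pt → ℝ) : Prop where
  tsr : ∀ μ ν, Sm fun y => h y μ ν
  fld : ∀ k, Sm (ψ k)

lemma SmW.Zap {m : ℕ} {h : Tsr} {ψ : Fin m → Pt → ℝ} (H : SmW h ψ) (z : ZIdx) :
    SmW (Ztsr [z] h) (fun k => Zap z (ψ k)) :=
  ⟨fun μ ν => (H.tsr μ ν).Zap z, fun k => (H.fld k).Zap z⟩

lemma SmW.contDiff_Wgrad {m : ℕ} {h : Tsr} {ψ : Fin m → Pt → ℝ} (H : SmW h ψ) (α : Fin 4) :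
    ContDiff ℝ (⊤ : ℕ∞) (Wgrad α h ψ) :=
  ContDiff.prodMk (contDiff_pi.2 fun μ => contDiff_pi.2 fun ν => (H.tsr μ ν).pd α)
    (contDiff_pi.2 fun k => (H.fld k).pd α)

lemma SmW.fderiv_Wgrad {m : ℕ} {h : Tsr} {ψ : Fin m → Pt → ℝ} (H : SmW h ψ) (α : Fin 4)
    (z : ZIdx) (p : Pt) :
    fderiv ℝ (Wgrad α h ψ) p (Zv z p) =
      Wgrad α (Ztsr [z] h) (fun k => LR.Zap z (ψ k)) p
        + ∑ γ, commCoef z α γ • Wgrad γ h ψ p := by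
  have d1 : ∀ μ ν, HasFDerivAt (pd α fun y => h y μ ν) (fderiv ℝ (pd α fun y => h y μ ν) p) p :=
    fun μ ν => (((H.tsr μ ν).pd α).differentiable p).hasFDerivAt
  have d2 : ∀ k, HasFDerivAt (pd α (ψ k)) (fderiv ℝ (pd α (ψ k)) p) p :=
    fun k => (((H.fld k).pd α).differentiable p).hasFDerivAt
  have d : HasFDerivAt (Wgrad α h ψ) _ p :=
    HasFDerivAt.prodMk (hasFDerivAt_pi.2 fun μ => hasFDerivAt_pi.2 fun ν => d1 μ ν)
      (hasFDerivAt_pi.2 d2)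
  rw [d.fderiv]
  ext μ
  · rename_i ν
    have := congrFun (Zap_pd (H.tsr μ ν) z α) p
    rw [LR.Zap] at this
    simpa [Wgrad, gradT, Prod.fst_sum, Finset.sum_apply, Ztsr, Ziter] using this
  · have := congrFun (Zap_pd (H.fld μ) z α) p
    rw [LR.Zap] at this
    simpa [Wgrad, gradT, Prod.snd_sum, Finset.sum_apply] using this

section

variable {m : ℕ} {h h' : Tsr} {ψ ψ' : Fin m → Pt → ℝ}
  (B : WVal m →L[ℝ] WVal m →L[ℝ] ℝ)

lemma SmW.bilin (H : SmW h ψ) (H' : SmW h' ψ') (α β : Fin 4) :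
    Sm fun y => B (Wgrad α h ψ y) (Wgrad β h' ψ' y) :=
  (B.contDiff.comp (H.contDiff_Wgrad α)).clm_apply (H'.contDiff_Wgrad β)

lemma SmW.Zap_bilin (H : SmW h ψ) (H' : SmW h' ψ') (α β : Fin 4) (z : ZIdx) :
    LR.Zap z (fun y => B (Wgrad α h ψ y) (Wgrad β h' ψ' y)) = fun y =>
      (B (Wgrad α (Ztsr [z] h) (fun k => LR.Zap z (ψ k)) y) (Wgrad β h' ψ' y)
        + B (Wgrad α h ψ y) (Wgrad β (Ztsr [z] h') (fun k => LR.Zap z (ψ' k)) y))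
      + ((∑ γ, commCoef z α γ * B (Wgrad γ h ψ y) (Wgrad β h' ψ' y))
        + ∑ γ, commCoef z β γ * B (Wgrad α h ψ y) (Wgrad γ h' ψ' y)) := by
  ext p
  have d1 := (((H.contDiff_Wgrad α).differentiable (by simp)) p).hasFDerivAt
  have d2 := (((H'.contDiff_Wgrad β).differentiable (by simp)) p).hasFDerivAt
  have d := B.hasFDerivAt_of_bilinear d1 d2
  have e : LR.Zap z (fun y => B (Wgrad α h ψ y) (Wgrad β h' ψ' y)) p =
      B (Wgrad α h ψ p) (fderiv ℝ (Wgrad β h' ψ') p (Zv z p))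
        + B (fderiv ℝ (Wgrad α h ψ) p (Zv z p)) (Wgrad β h' ψ' p) := by
    rw [LR.Zap, d.fderiv]
    rfl
  rw [e, H.fderiv_Wgrad, H'.fderiv_Wgrad]
  simp only [map_add, map_sum, map_smul, add_apply, sum_apply, smul_apply, smul_eq_mul]
  ring

lemma SmW.abs_Ziter_bilin_le {p : Pt} {X : ℝ} (l : List ZIdx) (H : SmW h ψ) (H' : SmW h' ψ')
    (hX : ∀ J K : List ZIdx, J.length + K.length ≤ l.length → ∀ α β,
      |B (Wgrad α (Ztsr J h) (fun k => Ziter J (ψ k)) p)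
        (Wgrad β (Ztsr K h') (fun k => Ziter K (ψ' k)) p)| ≤ X) (μ ν : Fin 4) :
    |Ziter l (fun y => B (Wgrad μ h ψ y) (Wgrad ν h' ψ' y)) p| ≤ 18 ^ l.length * X := by
  induction l using List.reverseRecOn generalizing h h' ψ ψ' μ ν with
  | nil =>
    rw [List.length_nil, pow_zero, one_mul]
    exact hX [] [] (by simp) μ ν
  | append_singleton l z ih =>
    have s : ∀ α β, Sm fun y => B (Wgrad α h ψ y) (Wgrad β h' ψ' y) := H.bilin B H'
    have i1 := ih (H.Zap z) H' (fun J K hJK α β => by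
      simp only [← Ztsr_concat, ← Ziter_concat]; exact hX _ _ (by simp; omega) α β) μ ν
    have i2 := ih H (H'.Zap z) (fun J K hJK α β => by
      simp only [← Ztsr_concat, ← Ziter_concat]; exact hX _ _ (by simp; omega) α β) μ ν
    have i3 := fun μ ν => ih H H' (fun J K hJK => hX J K (by simp; omega)) μ ν
    have i4 := abs_sum_commCoef_mul_le z μ fun γ => i3 γ ν
    have i5 := abs_sum_commCoef_mul_le z ν fun γ => i3 μ γ
    rw [Ziter_concat, H.Zap_bilin B H' μ ν z,
      Ziter_add (((H.Zap z).bilin B H' μ ν).add (H.bilin B (H'.Zap z) μ ν))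
        ((ContDiff.sum fun γ _ => contDiff_const.mul (s γ ν)).add
          (ContDiff.sum fun γ _ => contDiff_const.mul (s μ γ))),
      Ziter_add ((H.Zap z).bilin B H' μ ν) (H.bilin B (H'.Zap z) μ ν),
      Ziter_add (ContDiff.sum fun γ _ => contDiff_const.mul (s γ ν))
        (ContDiff.sum fun γ _ => contDiff_const.mul (s μ γ)),
      Ziter_sum _ fun γ => contDiff_const.mul (s γ ν),
      Ziter_sum _ fun γ => contDiff_const.mul (s μ γ)]
    simp only [Ziter_const_mul (s _ _)]
    rw [List.length_append, List.length_singleton, pow_succ]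
    rw [abs_le] at *
    constructor <;> linarith [i1.1, i1.2, i2.1, i2.2, i4.1, i4.2, i5.1, i5.2]

end

lemma PD_eq_Pform {m : ℕ} (N : Fin m → ℝ) (NN : Fin m → Fin m → ℝ) (h : Tsr)
    (ψ : Fin m → Pt → ℝ) (p : Pt) (μ ν : Fin 4) :
    PD N NN h h ψ ψ p μ ν = Pform N NN (gradT h p μ) (fun k => pd μ (ψ k) p) (gradT h p ν)
      (fun k => pd ν (ψ k) p) := by
  have e1 : (∑ ρ, ∑ σ, ∑ lam, ∑ τ, mink ρ σ * mink lam τ *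
      ((1/4) * pd μ (fun y => h y ρ σ) p * pd ν (fun y => h y lam τ) p
        - (1/2) * pd μ (fun y => h y ρ lam) p * pd ν (fun y => h y σ τ) p)) =
      1/4 * (trm (gradT h p μ) * trm (gradT h p ν)) - 1/2 * inm (gradT h p μ) (gradT h p ν) := by
    have t : trm (gradT h p μ) * trm (gradT h p ν) = ∑ ρ, ∑ σ, ∑ lam, ∑ τ,
        mink ρ σ * mink lam τ * (gradT h p μ ρ σ * gradT h p ν lam τ) := by
      simp only [trm, Finset.sum_mul]
      refine Finset.sum_congr rfl fun ρ _ => Finset.sum_congr rfl fun σ _ => ?_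
      simp only [Finset.mul_sum]
      exact Finset.sum_congr rfl fun lam _ => Finset.sum_congr rfl fun τ _ => by ring
    rw [t, inm]
    simp only [Finset.mul_sum, ← Finset.sum_sub_distrib, gradT]
    refine Finset.sum_congr rfl fun ρ _ => Finset.sum_congr rfl fun σ _ =>
      Finset.sum_congr rfl fun lam _ => Finset.sum_congr rfl fun τ _ => ?_
    ring
  rw [PD, e1, Pform]
  congr 2
  refine Finset.sum_congr rfl fun k _ => ?_
  simp only [trm, gradT, Finset.sum_mul, ← Finset.sum_add_distrib]
  congr 1
  exact Finset.sum_congr rfl fun ρ _ => Finset.sum_congr rfl fun σ _ => by ring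

/-! ### Sums over multi-indices -/

lemma Zsum_le_Zsum {k : ℕ} {F G : List ZIdx → ℝ} (h : ∀ l : List ZIdx, l.length ≤ k → F l ≤ G l) :
    Zsum k F ≤ Zsum k G :=
  Finset.sum_le_sum fun n hn => Finset.sum_le_sum fun v _ =>
    h _ (by rw [List.length_ofFn]; exact Nat.lt_succ_iff.mp (Finset.mem_range.mp hn))

lemma Zsum_nonneg (k : ℕ) {F : List ZIdx → ℝ} (h : ∀ l, 0 ≤ F l) : 0 ≤ Zsum k F :=
  Finset.sum_nonneg fun _ _ => Finset.sum_nonneg fun _ _ => h _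

lemma le_Zsum {k : ℕ} {F : List ZIdx → ℝ} (h : ∀ l, 0 ≤ F l) {l : List ZIdx} (hl : l.length ≤ k) :
    F l ≤ Zsum k F := by
  have h1 : F l ≤ ∑ v : Fin l.length → ZIdx, F (List.ofFn v) := by
    have := Finset.single_le_sum (f := fun v : Fin l.length → ZIdx => F (List.ofFn v))
      (fun _ _ => h _) (Finset.mem_univ l.get)
    simpa using this
  exact h1.trans (Finset.single_le_sum
    (f := fun n => ∑ v : Fin n → ZIdx, F (List.ofFn v))
    (fun _ _ => Finset.sum_nonneg fun _ _ => h _) (Finset.mem_range.mpr (Nat.lt_succ_iff.mpr hl)))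

lemma Zsum_mono {k k' : ℕ} (hk : k ≤ k') {F : List ZIdx → ℝ} (h : ∀ l, 0 ≤ F l) :
    Zsum k F ≤ Zsum k' F :=
  Finset.sum_le_sum_of_subset_of_nonneg (Finset.range_mono (by omega))
    fun _ _ _ => Finset.sum_nonneg fun _ _ => h _

lemma Zsum_const_mul (k : ℕ) (c : ℝ) (F : List ZIdx → ℝ) :
    Zsum k (fun l => c * F l) = c * Zsum k F := by
  simp only [Zsum, Finset.mul_sum]

lemma Zsum_le_const_mul {k : ℕ} {F : List ZIdx → ℝ} {X : ℝ}
    (h : ∀ l : List ZIdx, l.length ≤ k → F l ≤ X) : Zsum k F ≤ Zsum k (fun _ => 1) * X := by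
  rw [mul_comm, ← Zsum_const_mul]
  exact Zsum_le_Zsum fun l hl => (h l hl).trans_eq (mul_one X).symm

/-! ### Functions of `h` close to their Minkowski value -/

/-- The sum of the components of `Z^J h` over multi-indices of length at most `j`. -/
def hnorm (j : ℕ) (h : Tsr) (p : Pt) : ℝ := Zsum j fun l => ∑ μ, ∑ ν, |Ztsr l h p μ ν|

lemma hnorm_nonneg (j : ℕ) (h : Tsr) (p : Pt) : 0 ≤ hnorm j h p :=
  Zsum_nonneg _ fun _ => Finset.sum_nonneg fun _ _ => Finset.sum_nonneg fun _ _ => abs_nonneg _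

lemma hnorm_mono {j k : ℕ} (hjk : j ≤ k) (h : Tsr) (p : Pt) : hnorm j h p ≤ hnorm k h p :=
  Zsum_mono hjk fun _ => Finset.sum_nonneg fun _ _ => Finset.sum_nonneg fun _ _ => abs_nonneg _

lemma abs_Ztsr_le_hnorm (l : List ZIdx) (h : Tsr) (p : Pt) (μ ν : Fin 4) :
    |Ztsr l h p μ ν| ≤ hnorm l.length h p := by
  have h1 : |Ztsr l h p μ ν| ≤ ∑ μ, ∑ ν, |Ztsr l h p μ ν| :=
    (Finset.single_le_sum (f := fun ν => |Ztsr l h p μ ν|) (fun _ _ => abs_nonneg _)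
      (Finset.mem_univ ν)).trans
    (Finset.single_le_sum (f := fun μ => ∑ ν, |Ztsr l h p μ ν|)
      (fun _ _ => Finset.sum_nonneg fun _ _ => abs_nonneg _) (Finset.mem_univ μ))
  exact h1.trans (le_Zsum (F := fun l => ∑ μ, ∑ ν, |Ztsr l h p μ ν|)
    (fun _ => Finset.sum_nonneg fun _ _ => Finset.sum_nonneg fun _ _ => abs_nonneg _) le_rfl)

/-- `Φ` is a smooth function of `h` which deviates from the constant `c` by a quantity whose
commuted derivatives up to order `k` are controlled linearly by those of `h`, as long as
`hnorm k h ≤ C₀`. -/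
def Near (k : ℕ) (C₀ : ℝ) (Φ : Tsr → Pt → ℝ) (c : ℝ) : Prop :=
  (∀ h : Tsr, (∀ μ ν, Sm fun y => h y μ ν) → Sm (Φ h)) ∧
    ∃ C : ℝ, 0 ≤ C ∧ ∀ h : Tsr, (∀ μ ν, Sm fun y => h y μ ν) → ∀ p, hnorm k h p ≤ C₀ →
      ∀ l : List ZIdx, l.length ≤ k → |Ziter l (fun y => Φ h y - c) p| ≤ C * hnorm l.length h p

section

variable {k : ℕ} {C₀ : ℝ}

lemma Near.const (c : ℝ) : Near k C₀ (fun _ _ => c) c := by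
  refine ⟨fun _ _ => contDiff_const, 0, le_rfl, fun h _ p _ l _ => ?_⟩
  simp only [sub_self, Ziter_zero]
  simp

lemma Near.metric (μ ν : Fin 4) : Near k C₀ (fun h y => gmat h y μ ν) (mink μ ν) := by
  refine ⟨fun h hh => contDiff_const.add (hh μ ν), 1, zero_le_one, fun h hh p _ l _ => ?_⟩
  simp only [gmat, Matrix.of_apply, add_sub_cancel_left, one_mul]
  exact abs_Ztsr_le_hnorm l h p μ ν

lemma Near.add {Φ Ψ : Tsr → Pt → ℝ} {c d : ℝ} (hΦ : Near k C₀ Φ c) (hΨ : Near k C₀ Ψ d) :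
    Near k C₀ (fun h y => Φ h y + Ψ h y) (c + d) := by
  obtain ⟨s1, C1, h1, b1⟩ := hΦ
  obtain ⟨s2, C2, h2, b2⟩ := hΨ
  refine ⟨fun h hh => (s1 h hh).add (s2 h hh), C1 + C2, by positivity, fun h hh p hp l hl => ?_⟩
  have e : (fun y => Φ h y + Ψ h y - (c + d)) = fun y => (Φ h y - c) + (Ψ h y - d) := by
    ext y; ring
  rw [e, Ziter_add ((s1 h hh).sub contDiff_const) ((s2 h hh).sub contDiff_const), add_mul]
  exact (abs_add_le _ _).trans (add_le_add (b1 h hh p hp l hl) (b2 h hh p hp l hl))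

lemma Near.mul {Φ Ψ : Tsr → Pt → ℝ} {c d : ℝ} (hΦ : Near k C₀ Φ c) (hΨ : Near k C₀ Ψ d) :
    Near k C₀ (fun h y => Φ h y * Ψ h y) (c * d) := by
  obtain ⟨s1, C1, h1, b1⟩ := hΦ
  obtain ⟨s2, C2, h2, b2⟩ := hΨ
  refine ⟨fun h hh => (s1 h hh).mul (s2 h hh), 2 ^ k * (C1 * C2 * |C₀|) + |c| * C2 + |d| * C1,
    by positivity, fun h hh p hp l hl => ?_⟩
  have t1 : Sm fun y => Φ h y - c := (s1 h hh).sub contDiff_const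
  have t2 : Sm fun y => Ψ h y - d := (s2 h hh).sub contDiff_const
  have e : (fun y => Φ h y * Ψ h y - c * d) =
      fun y => ((Φ h y - c) * (Ψ h y - d) + c * (Ψ h y - d)) + d * (Φ h y - c) := by
    ext y; ring
  have m1 : |Ziter l (fun y => (Φ h y - c) * (Ψ h y - d)) p|
      ≤ 2 ^ l.length * (C1 * C2 * |C₀| * hnorm l.length h p) := by
    refine abs_Ziter_mul_le l t1 t2 fun J K hJK => ?_
    rw [abs_mul]
    have c1 := b1 h hh p hp J (by omega)
    have c2 := b2 h hh p hp K (by omega)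
    have d1 : hnorm J.length h p ≤ |C₀| :=
      (hnorm_mono (by omega) h p).trans (hp.trans (le_abs_self _))
    have d2 : hnorm K.length h p ≤ hnorm l.length h p := hnorm_mono (by omega) h p
    have n1 := hnorm_nonneg J.length h p
    have n2 := hnorm_nonneg K.length h p
    calc _ ≤ (C1 * hnorm J.length h p) * (C2 * hnorm K.length h p) := by gcongr
      _ ≤ (C1 * |C₀|) * (C2 * hnorm l.length h p) := by gcongr
      _ = _ := by ring
  have m2 : |c * Ziter l (fun y => Ψ h y - d) p| ≤ |c| * (C2 * hnorm l.length h p) := by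
    rw [abs_mul]
    gcongr
    exact b2 h hh p hp l hl
  have m3 : |d * Ziter l (fun y => Φ h y - c) p| ≤ |d| * (C1 * hnorm l.length h p) := by
    rw [abs_mul]
    gcongr
    exact b1 h hh p hp l hl
  have m4 : (2 : ℝ) ^ l.length * (C1 * C2 * |C₀| * hnorm l.length h p)
      ≤ 2 ^ k * (C1 * C2 * |C₀| * hnorm l.length h p) := by
    have := hnorm_nonneg l.length h p
    gcongr
    norm_num
  rw [e, Ziter_add ((t1.mul t2).add (contDiff_const.mul t2)) (contDiff_const.mul t1),
    Ziter_add (t1.mul t2) (contDiff_const.mul t2), Ziter_const_mul t2, Ziter_const_mul t1]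
  refine (abs_add_three _ _ _).trans ?_
  linarith

lemma Near.sum {ι : Type*} (s : Finset ι) {Φ : ι → Tsr → Pt → ℝ} {c : ι → ℝ}
    (h : ∀ i, Near k C₀ (Φ i) (c i)) : Near k C₀ (fun h y => ∑ i ∈ s, Φ i h y) (∑ i ∈ s, c i) := by
  classical
  induction s using Finset.induction_on with
  | empty => simpa using Near.const 0
  | insert a s ha ih => simpa only [Finset.sum_insert ha] using (h a).add ih

lemma Near.prod {ι : Type*} (s : Finset ι) {Φ : ι → Tsr → Pt → ℝ} {c : ι → ℝ}
    (h : ∀ i, Near k C₀ (Φ i) (c i)) : Near k C₀ (fun h y => ∏ i ∈ s, Φ i h y) (∏ i ∈ s, c i) := by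
  classical
  induction s using Finset.induction_on with
  | empty => simpa using Near.const 1
  | insert a s ha ih => simpa only [Finset.prod_insert ha] using (h a).mul ih

lemma Near.det {M : Tsr → Pt → Matrix (Fin 4) (Fin 4) ℝ} {M₀ : Matrix (Fin 4) (Fin 4) ℝ}
    (h : ∀ i j, Near k C₀ (fun h y => M h y i j) (M₀ i j)) :
    Near k C₀ (fun h y => (M h y).det) M₀.det := by
  simp only [Matrix.det_apply']
  exact Near.sum _ fun σ => (Near.const _).mul (Near.prod _ fun i => h (σ i) i)

lemma adjugate_mink (i j : Fin 4) : (Matrix.of mink).adjugate i j = -mink i j := by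
  have : Matrix.of mink = Matrix.diagonal fun i => mink i i := by
    ext i j
    by_cases hij : i = j
    · subst hij; simp
    · simp [hij, mink_of_ne hij]
  rw [this, Matrix.adjugate_diagonal]
  by_cases hij : i = j
  · subst hij
    rw [Matrix.diagonal_apply_eq]
    fin_cases i <;> simp [mink]
  · rw [Matrix.diagonal_apply_ne _ hij, mink_of_ne hij, neg_zero]

lemma Near.adjugate (i j : Fin 4) :
    Near k C₀ (fun h y => (gmat h y).adjugate i j) (-mink i j) := by
  rw [← adjugate_mink]
  simp only [Matrix.adjugate_apply]
  refine Near.det fun a b => ?_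
  by_cases ha : a = j
  · subst ha
    simpa using Near.const _
  · simpa [Matrix.updateRow_ne ha] using Near.metric a b

end

/-! ### Consequences of the wave-coordinate condition -/

lemma hasFDerivAt_det {M : Pt → Matrix (Fin 4) (Fin 4) ℝ} {p : Pt}
    (hM : ∀ i j, DifferentiableAt ℝ (fun y => M y i j) p) :
    HasFDerivAt (fun y => (M y).det)
      (∑ i, ∑ j, (M p).adjugate j i • fderiv ℝ (fun y => M y i j) p) p := by
  let f : ContinuousMultilinearMap ℝ (fun _ : Fin 4 => Fin 4 → ℝ) ℝ :=
    { (Matrix.detRowAlternating (R := ℝ) (n := Fin 4)).toMultilinearMap with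
      cont := Continuous.matrix_det (A := fun M : Matrix (Fin 4) (Fin 4) ℝ => M) continuous_id }
  have h := HasFDerivAt.multilinear_comp f (g := fun i y => M y i) (x := p)
    (fun i => hasFDerivAt_pi.2 fun j => (hM i j).hasFDerivAt)
  refine h.congr_fderiv ?_
  ext v
  simp only [sum_apply, ContinuousLinearMap.comp_apply, smul_apply, smul_eq_mul]
  refine Finset.sum_congr rfl fun i _ => ?_
  have e : f.toContinuousLinearMap (fun j => M p j) i
      ((ContinuousLinearMap.pi fun j => fderiv ℝ (fun y => M y i j) p) v) =
      ((M p).updateRow i fun j => fderiv ℝ (fun y => M y i j) p v).det := rfl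
  rw [e, ← Matrix.cramer_transpose_apply, Matrix.cramer_eq_adjugate_mulVec,
    ← Matrix.adjugate_transpose]
  rfl

section

variable {h : Tsr}

lemma contDiff_det_gmat (hh : ∀ μ ν, Sm fun y => h y μ ν) : Sm fun y => (gmat h y).det :=
  (Near.det (k := 0) (C₀ := 0) (M := gmat) (M₀ := Matrix.of mink) fun i j =>
    Near.metric i j).1 h hh

lemma contDiff_adjugate_gmat (hh : ∀ μ ν, Sm fun y => h y μ ν) (i j : Fin 4) :
    Sm fun y => (gmat h y).adjugate i j :=
  (Near.adjugate (k := 0) (C₀ := 0) i j).1 h hh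

lemma differentiableAt_gmat (hh : ∀ μ ν, Sm fun y => h y μ ν) (p : Pt) (i j : Fin 4) :
    DifferentiableAt ℝ (fun y => gmat h y i j) p :=
  ((Near.metric (k := 0) (C₀ := 0) i j).1 h hh).differentiable p

lemma pd_gmat (p : Pt) (α μ ν : Fin 4) :
    pd α (fun y => gmat h y μ ν) p = gradT h p α μ ν := by
  simp [pd, gradT, gmat]

lemma pd_det_gmat (hh : ∀ μ ν, Sm fun y => h y μ ν) (hs : ∀ p μ ν, h p μ ν = h p ν μ) (p : Pt)
    (α : Fin 4) : pd α (fun y => (gmat h y).det) p =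
      ∑ μ, ∑ ν, (gmat h p).adjugate μ ν * gradT h p α μ ν := by
  have hd : ∀ i j, DifferentiableAt ℝ (fun y => gmat h y i j) p := differentiableAt_gmat hh p
  rw [pd, (hasFDerivAt_det hd).fderiv]
  simp only [sum_apply, smul_apply, smul_eq_mul]
  rw [Finset.sum_comm]
  refine Finset.sum_congr rfl fun μ _ => Finset.sum_congr rfl fun ν _ => ?_
  congr 1
  have : (fun y => gmat h y ν μ) = fun y => gmat h y μ ν := by
    ext y
    simp only [gmat, Matrix.of_apply, hs y ν μ]
    congr 1
    by_cases e : μ = ν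
    · rw [e]
    · rw [mink_of_ne e, mink_of_ne (Ne.symm e)]
  rw [this]
  exact pd_gmat p α μ ν

lemma WaveGaugeAt.sum_adjugate_eq_zero (hh : ∀ μ ν, Sm fun y => h y μ ν)
    (hs : ∀ p μ ν, h p μ ν = h p ν μ) {p : Pt} (hp : (gmat h p).det ≠ 0) (hg : WaveGaugeAt h p)
    (lam : Fin 4) :
    ∑ α, ∑ β, (gmat h p).adjugate α β * (gradT h p α β lam - 1/2 * gradT h p lam α β) = 0 := by
  set s : Pt → ℝ := fun y => Real.sqrt |(gmat h y).det| with hsdef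
  set D : Pt → ℝ := fun y => (gmat h y).det with hD
  have hDd : DifferentiableAt ℝ D p := (contDiff_det_gmat hh).differentiable p
  have s0 : 0 < s p := Real.sqrt_pos.2 (abs_pos.2 hp)
  have hss : ∀ y, s y * s y = |D y| := fun y => Real.mul_self_sqrt (abs_nonneg _)
  have hsd : DifferentiableAt ℝ s p :=
    ((hDd.hasFDerivAt.abs hp).sqrt (abs_ne_zero.2 hp)).differentiableAt
  have hs4 : pd lam s p * (2 * D p) = s p * pd lam D p := by
    have e : (fun y => (s y * s y) * (s y * s y)) = fun y => D y * D y := by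
      ext y; rw [hss, abs_mul_abs_self]
    have e2 := congrArg (fun f : Pt → ℝ => pd lam f p) e
    simp only [pd] at e2 ⊢
    rw [fderiv_fun_mul (hsd.fun_mul hsd) (hsd.fun_mul hsd), fderiv_fun_mul hsd hsd,
      fderiv_fun_mul hDd hDd] at e2
    simp only [add_apply, smul_apply, smul_eq_mul] at e2
    have e3 : s p * s p * (s p * s p) = D p * D p := congrFun e p
    have : s p * s p * s p * (fderiv ℝ s p (Pi.single lam 1) * (2 * D p)
        - s p * fderiv ℝ D p (Pi.single lam 1)) = 0 := by
      linear_combination (1/2) * D p * e2 - fderiv ℝ D p (Pi.single lam 1) * e3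
    have h3 : s p * s p * s p ≠ 0 := by positivity
    exact sub_eq_zero.1 ((mul_eq_zero.1 this).resolve_left h3)
  have hgi : ∀ y ρ μ, ginv h y ρ μ = (D y)⁻¹ * (gmat h y).adjugate ρ μ := fun y ρ μ => by
    simp [ginv, Matrix.inv_def, hD]
  have hfd : ∀ ρ μ, DifferentiableAt ℝ (fun y => ginv h y ρ μ * s y) p := fun ρ μ => by
    simp only [hgi]
    exact ((hDd.inv hp).mul ((contDiff_adjugate_gmat hh ρ μ).differentiable p)).mul hsd
  have hGd : ∀ i j, DifferentiableAt ℝ (fun y => gmat h y i j) p := differentiableAt_gmat hh p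
  have hne : ∀ᶠ y in nhds p, D y ≠ 0 := hDd.continuousAt.eventually_ne hp
  have key : ∀ ρ, ∑ μ, (pd ρ (fun y => ginv h y ρ μ * s y) p * gmat h p μ lam
      + ginv h p ρ μ * s p * gradT h p ρ μ lam) = if ρ = lam then pd ρ s p else 0 := fun ρ => by
    have ev : (fun y => ∑ μ, ginv h y ρ μ * s y * gmat h y μ lam) =ᶠ[nhds p]
        fun y => if ρ = lam then s y else 0 := by
      filter_upwards [hne] with y hy
      have e := congrFun (congrFun (Matrix.nonsing_inv_mul (gmat h y) (isUnit_iff_ne_zero.2 hy)) ρ)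
        lam
      rw [Matrix.mul_apply, Matrix.one_apply] at e
      have : ∑ μ, ginv h y ρ μ * s y * gmat h y μ lam =
          s y * ∑ μ, (gmat h y)⁻¹ ρ μ * gmat h y μ lam := by
        rw [Finset.mul_sum]
        exact Finset.sum_congr rfl fun μ _ => by rw [ginv]; ring
      rw [this, e]
      split_ifs <;> simp
    have e := ev.fderiv_eq (𝕜 := ℝ)
    rw [fderiv_fun_sum fun μ _ => (hfd ρ μ).fun_mul (hGd μ lam)] at e
    have e' := congrArg (fun T : Pt →L[ℝ] ℝ => T (Pi.single ρ 1)) e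
    simp only [sum_apply] at e'
    have r : fderiv ℝ (fun y => if ρ = lam then s y else 0) p (Pi.single ρ 1) =
        if ρ = lam then pd ρ s p else 0 := by
      split_ifs
      · rfl
      · simp
    rw [r] at e'
    rw [← e']
    refine Finset.sum_congr rfl fun μ _ => ?_
    rw [fderiv_fun_mul (hfd ρ μ) (hGd μ lam)]
    simp only [add_apply, smul_apply, smul_eq_mul, ← pd_gmat, pd]
    ring
  have tot : ∑ ρ, ∑ μ, ginv h p ρ μ * s p * gradT h p ρ μ lam = pd lam s p := by
    have e := Finset.sum_congr (rfl : (Finset.univ : Finset (Fin 4)) = _) fun ρ _ => key ρ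
    simp only [Finset.sum_add_distrib, Finset.sum_ite_eq', Finset.mem_univ, if_true] at e
    have z : ∑ ρ, ∑ μ, pd ρ (fun y => ginv h y ρ μ * s y) p * gmat h p μ lam = 0 := by
      rw [Finset.sum_comm]
      simp only [← Finset.sum_mul]
      exact Finset.sum_eq_zero fun μ _ => by rw [hg μ, zero_mul]
    rw [z, zero_add] at e
    exact e
  have dd := pd_det_gmat hh hs p lam
  have t1 : s p * ∑ α, ∑ β, (gmat h p).adjugate α β * gradT h p α β lam = D p * pd lam s p := by
    rw [← tot]
    simp only [Finset.mul_sum, hgi]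
    refine Finset.sum_congr rfl fun α _ => Finset.sum_congr rfl fun β _ => ?_
    have : D p ≠ 0 := hp
    field_simp
  simp only [mul_sub, Finset.sum_sub_distrib, mul_left_comm _ (1/2 : ℝ), ← Finset.mul_sum]
  rw [← dd]
  have : s p * (2 * (∑ α, ∑ β, (gmat h p).adjugate α β * gradT h p α β lam
      - 1/2 * pd lam D p)) = 0 := by
    linear_combination 2 * t1 + hs4
  have := (mul_eq_zero.1 this).resolve_left s0.ne'
  linarith

lemma WaveGaugeAt.gform_eventuallyEq (hh : ∀ μ ν, Sm fun y => h y μ ν)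
    (hs : ∀ p μ ν, h p μ ν = h p ν μ) {p : Pt} (hp : (gmat h p).det ≠ 0)
    (hg : ∀ p, WaveGaugeAt h p) (lam : Fin 4) :
    (fun y => gform idCoef (gradT h y) lam) =ᶠ[nhds p] fun y =>
      ∑ α, ∑ β, ((gmat h y).adjugate α β - -mink α β)
        * (gradT h y α β lam - 1/2 * gradT h y lam α β) := by
  filter_upwards [((contDiff_det_gmat hh).differentiable p).continuousAt.eventually_ne hp] with y hy
  have := WaveGaugeAt.sum_adjugate_eq_zero hh hs hy (hg y) lam
  simp only [sub_mul _ _ (gradT h y _ _ _ - _), Finset.sum_sub_distrib] at this ⊢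
  rw [this]
  simp [gform, sum_idCoef_mul]

end

/-! ### The good component of the derivatives of the metric -/

section

variable {p S₁ S₂ : Pt}

lemma Zdsemi_nonneg (k : ℕ) (π : Tsr) (Ds Vs Ws : List Pt) (p : Pt) : 0 ≤ Zdsemi k π Ds Vs Ws p :=
  Zsum_nonneg _ fun _ => dsemi_nonneg _ _ _ _ _

lemma Zssemi_nonneg (k : ℕ) (π : Tsr) (Vs Ws : List Pt) (p : Pt) : 0 ≤ Zssemi k π Vs Ws p :=
  Zsum_nonneg _ fun _ => semi_nonneg _ _ _

lemma dsemi_le_Zdsemi {k : ℕ} {l : List ZIdx} (hl : l.length ≤ k) (π : Tsr) (Ds Vs Ws : List Pt)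
    (p : Pt) : dsemi (Ztsr l π) Ds Vs Ws p ≤ Zdsemi k π Ds Vs Ws p :=
  le_Zsum (F := fun l => dsemi (Ztsr l π) Ds Vs Ws p) (fun _ => dsemi_nonneg _ _ _ _ _) hl

lemma semi_le_Zssemi {k : ℕ} {l : List ZIdx} (hl : l.length ≤ k) (π : Tsr) (Vs Ws : List Pt)
    (p : Pt) : semi (Ztsr l π p) Vs Ws ≤ Zssemi k π Vs Ws p :=
  le_Zsum (F := fun l => semi (Ztsr l π p) Vs Ws) (fun _ => semi_nonneg _ _ _) hl

lemma hnorm_le (hr : 0 < rad p) (hf : SphFrame p S₁ S₂) (j : ℕ) (h : Tsr) :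
    hnorm j h p ≤ 256 * Zssemi j h (Ufam p S₁ S₂) (Ufam p S₁ S₂) p := by
  rw [Zssemi, ← Zsum_const_mul]
  refine Zsum_le_Zsum fun l _ => ?_
  calc ∑ μ, ∑ ν, |Ztsr l h p μ ν|
      ≤ ∑ _μ : Fin 4, ∑ _ν : Fin 4, 16 * semi (Ztsr l h p) (Ufam p S₁ S₂) (Ufam p S₁ S₂) :=
        Finset.sum_le_sum fun μ _ => Finset.sum_le_sum fun ν _ => abs_comp_le_semi hr hf _ μ ν
    _ = _ := by simp; ring

lemma le_sum_sum_range {f : ℕ → ℕ → ℝ} (hf : ∀ i j, 0 ≤ f i j) {n i j : ℕ} (hij : i + j ≤ n) :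
    f i j ≤ ∑ i ∈ Finset.range (n+1), ∑ j ∈ Finset.range (n+1-i), f i j :=
  (Finset.single_le_sum (f := f i) (fun j _ => hf i j)
      (Finset.mem_range.2 (by omega : j < n + 1 - i))).trans
    (Finset.single_le_sum (f := fun i => ∑ j ∈ Finset.range (n+1-i), f i j)
      (fun i _ => Finset.sum_nonneg fun j _ => hf i j)
      (Finset.mem_range.2 (by omega : i < n + 1)))

/-- The quadratic error `Σ |Z^{J₂} h| |∂Z^{J₁} h|`. -/
def quadErr (n : ℕ) (h : Tsr) (S₁ S₂ p : Pt) : ℝ :=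
  ∑ j₁ ∈ Finset.range (n+1), ∑ j₂ ∈ Finset.range (n+1-j₁),
    Zssemi j₂ h (Ufam p S₁ S₂) (Ufam p S₁ S₂) p *
      Zdsemi j₁ h (Ufam p S₁ S₂) (Ufam p S₁ S₂) (Ufam p S₁ S₂) p

/-- The lower-order terms in the estimate of `∂Z^I h_{LL}`. -/
def lowErr (n : ℕ) (h : Tsr) (S₁ S₂ p : Pt) : ℝ :=
  (if n = 0 then 0 else Zdsemi (n-1) h (Ufam p S₁ S₂) (Lfam p) (Tfam p S₁ S₂) p)
    + (if n ≤ 1 then 0 else Zdsemi (n-2) h (Ufam p S₁ S₂) (Ufam p S₁ S₂) (Ufam p S₁ S₂) p)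
    + quadErr n h S₁ S₂ p

lemma quadErr_nonneg (n : ℕ) (h : Tsr) (S₁ S₂ p : Pt) : 0 ≤ quadErr n h S₁ S₂ p :=
  Finset.sum_nonneg fun _ _ => Finset.sum_nonneg fun _ _ =>
    mul_nonneg (Zssemi_nonneg _ _ _ _ _) (Zdsemi_nonneg _ _ _ _ _ _)

lemma lowErr_nonneg (n : ℕ) (h : Tsr) (S₁ S₂ p : Pt) : 0 ≤ lowErr n h S₁ S₂ p := by
  have h1 := quadErr_nonneg n h S₁ S₂ p
  have h2 := Zdsemi_nonneg (n-1) h (Ufam p S₁ S₂) (Lfam p) (Tfam p S₁ S₂) p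
  have h3 := Zdsemi_nonneg (n-2) h (Ufam p S₁ S₂) (Ufam p S₁ S₂) (Ufam p S₁ S₂) p
  refine add_nonneg (add_nonneg ?_ ?_) h1
  · exact ite_nonneg le_rfl h2
  · exact ite_nonneg le_rfl h3

lemma mul_le_quadErr {n j₁ j₂ : ℕ} (hj : j₁ + j₂ ≤ n) (h : Tsr) (S₁ S₂ p : Pt) :
    Zssemi j₂ h (Ufam p S₁ S₂) (Ufam p S₁ S₂) p *
      Zdsemi j₁ h (Ufam p S₁ S₂) (Ufam p S₁ S₂) (Ufam p S₁ S₂) p ≤ quadErr n h S₁ S₂ p := by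
  exact le_sum_sum_range (f := fun j₁ j₂ => Zssemi j₂ h (Ufam p S₁ S₂) (Ufam p S₁ S₂) p *
      Zdsemi j₁ h (Ufam p S₁ S₂) (Ufam p S₁ S₂) (Ufam p S₁ S₂) p)
    (fun _ _ => mul_nonneg (Zssemi_nonneg _ _ _ _ _) (Zdsemi_nonneg _ _ _ _ _ _)) hj

lemma det_gmat_ne_zero {h : Tsr} (hh : ∀ μ ν, |h p μ ν| ≤ 1/8) : (gmat h p).det ≠ 0 := by
  refine det_ne_zero_of_sum_row_lt_diag fun k => ?_
  have h1 : ∑ j ∈ Finset.univ.erase k, ‖gmat h p k j‖ ≤ 3/8 := by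
    refine (Finset.sum_le_card_nsmul _ _ (1/8) fun j hj => ?_).trans ?_
    · rw [gmat, Matrix.of_apply, mink_of_ne (Finset.ne_of_mem_erase hj).symm, zero_add]
      exact hh k j
    · rw [Finset.card_erase_of_mem (Finset.mem_univ k)]
      norm_num
  have h2 : 7/8 ≤ ‖gmat h p k k‖ := by
    have := abs_sub_abs_le_abs_sub (mink k k) (-h p k k)
    rw [abs_mink_self, abs_neg, sub_neg_eq_add] at this
    have := hh k k
    rw [gmat, Matrix.of_apply, Real.norm_eq_abs]
    linarith
  linarith

lemma Ziter_gform {h : Tsr} (hh : ∀ μ ν, Sm fun y => h y μ ν) (l : List ZIdx) (p : Pt)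
    (μ : Fin 4) :
    Ziter l (fun y => gform idCoef (gradT h y) μ) p = gform idCoef (ZgradT l h p) μ := by
  have s : ∀ γ α β, Sm fun y => gradT h y γ α β := fun γ α β => (hh α β).pd γ
  have s' : ∀ α β, Sm fun y => gradT h y α β μ - 1/2 * gradT h y μ α β := fun α β =>
    (s α β μ).sub (contDiff_const.mul (s μ α β))
  have s2 : ∀ α β, Sm fun y => mink α β * (gradT h y α β μ - 1/2 * gradT h y μ α β) :=
    fun α β => contDiff_const.mul (s' α β)
  simp only [gform, sum_idCoef_mul]
  rw [Ziter_sum _ fun α => ContDiff.sum fun β _ => s2 α β]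
  refine Finset.sum_congr rfl fun α _ => ?_
  rw [Ziter_sum _ fun β => s2 α β]
  refine Finset.sum_congr rfl fun β _ => ?_
  rw [Ziter_const_mul (s' α β), Ziter_sub (s α β μ) (contDiff_const.mul (s μ α β)),
    Ziter_const_mul (s μ α β)]
  rfl

lemma exists_abs_gform_le (k : ℕ) (C₀ : ℝ) : ∃ C : ℝ, 0 ≤ C ∧ ∀ h : Tsr,
    (∀ μ ν, Sm fun y => h y μ ν) → (∀ p μ ν, h p μ ν = h p ν μ) → (∀ p, WaveGaugeAt h p) →
    ∀ p S₁ S₂ : Pt, 0 < rad p → SphFrame p S₁ S₂ → hnorm k h p ≤ C₀ → (gmat h p).det ≠ 0 →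
    ∀ l : List ZIdx, l.length ≤ k → ∀ μ,
      |gform idCoef (ZgradT l h p) μ| ≤ C * quadErr l.length h S₁ S₂ p := by
  choose c c0 hc using fun i j => (Near.adjugate (k := k) (C₀ := C₀) i j).2
  refine ⟨∑ α, ∑ β, 2 ^ k * (c α β * 256 * (2 * 9 ^ k * 64)),
    Finset.sum_nonneg fun α _ => Finset.sum_nonneg fun β _ => by have := c0 α β; positivity,
    fun h hh hs hg p S₁ S₂ hr hf hp hdet l hl μ => ?_⟩
  have s : ∀ γ α β, Sm fun y => gradT h y γ α β := fun γ α β => (hh α β).pd γ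
  have s' : ∀ α β, Sm fun y => gradT h y α β μ - 1/2 * gradT h y μ α β := fun α β =>
    (s α β μ).sub (contDiff_const.mul (s μ α β))
  have sA : ∀ α β, Sm fun y => (gmat h y).adjugate α β - -mink α β := fun α β =>
    (contDiff_adjugate_gmat hh α β).sub contDiff_const
  rw [← Ziter_gform hh, (Ziter_congr (WaveGaugeAt.gform_eventuallyEq hh hs hdet hg μ) l).eq_of_nhds,
    Ziter_sum _ fun α => ContDiff.sum fun β _ => (sA α β).mul (s' α β), Finset.sum_mul]
  refine (Finset.abs_sum_le_sum_abs _ _).trans (Finset.sum_le_sum fun α _ => ?_)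
  rw [Ziter_sum _ fun β => (sA α β).mul (s' α β), Finset.sum_mul]
  refine (Finset.abs_sum_le_sum_abs _ _).trans (Finset.sum_le_sum fun β _ => ?_)
  have q0 := quadErr_nonneg l.length h S₁ S₂ p
  have c0' := c0 α β
  have main : |Ziter l (fun y => ((gmat h y).adjugate α β - -mink α β) *
      (gradT h y α β μ - 1/2 * gradT h y μ α β)) p| ≤
      2 ^ l.length * (c α β * 256 * (2 * 9 ^ k * 64) * quadErr l.length h S₁ S₂ p) := by
    refine abs_Ziter_mul_le l (sA α β) (s' α β) fun J K hJK => ?_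
    set a := Zssemi J.length h (Ufam p S₁ S₂) (Ufam p S₁ S₂) p with ha
    set b := Zdsemi K.length h (Ufam p S₁ S₂) (Ufam p S₁ S₂) (Ufam p S₁ S₂) p with hb
    have a0 : 0 ≤ a := Zssemi_nonneg _ _ _ _ _
    have b0 : 0 ≤ b := Zdsemi_nonneg _ _ _ _ _ _
    have h1 : |Ziter J (fun y => (gmat h y).adjugate α β - -mink α β) p| ≤ c α β * (256 * a) :=
      (hc α β h hh p hp J (by omega)).trans (mul_le_mul_of_nonneg_left (hnorm_le hr hf _ _) c0')
    have hK : (9 : ℝ) ^ K.length ≤ 9 ^ k := pow_le_pow_right₀ (by norm_num) (by omega)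
    have h3 : ∀ γ μ ν, |Ziter K (fun y => gradT h y γ μ ν) p| ≤ 9 ^ k * (64 * b) := fun γ μ ν => by
      refine (abs_Ziter_pd_le K (hh μ ν) (X := 64 * b) (fun J hJ γ => ?_) γ).trans
        (mul_le_mul_of_nonneg_right hK (by positivity))
      exact (abs_gradT_le hr hf (Ztsr J h) γ μ ν).trans
        (mul_le_mul_of_nonneg_left (dsemi_le_Zdsemi hJ h _ _ _ p) (by norm_num))
    have h2 : |Ziter K (fun y => gradT h y α β μ - 1/2 * gradT h y μ α β) p| ≤
        2 * (9 ^ k * (64 * b)) := by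
      rw [Ziter_sub (s α β μ) (contDiff_const.mul (s μ α β)), Ziter_const_mul (s μ α β)]
      have u1 := abs_le.1 (h3 α β μ)
      have u2 := abs_le.1 (h3 μ α β)
      rw [abs_le]
      constructor <;> linarith [u1.1, u1.2, u2.1, u2.2]
    rw [abs_mul]
    calc _ ≤ (c α β * (256 * a)) * (2 * (9 ^ k * (64 * b))) := by gcongr
      _ = c α β * 256 * (2 * 9 ^ k * 64) * (a * b) := by ring
      _ ≤ _ := by
        have := mul_le_quadErr (by omega : K.length + J.length ≤ l.length) h S₁ S₂ p
        gcongr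
  refine main.trans ?_
  rw [mul_assoc (2 ^ k)]
  gcongr
  norm_num

lemma abs_tri_le_quadErr (hr : 0 < rad p) (hf : SphFrame p S₁ S₂) {h : Tsr} {μ ν : Fin 4}
    (hh : 1/8 ≤ |h p μ ν|) (l : List ZIdx) :
    |tri (gradT (Ztsr l h) p) (Lbv p) (Lv p) (Lv p)| ≤ 128 * quadErr l.length h S₁ S₂ p := by
  have h1 : |h p μ ν| ≤ 16 * Zssemi 0 h (Ufam p S₁ S₂) (Ufam p S₁ S₂) p :=
    (abs_comp_le_semi hr hf (h p) μ ν).trans (mul_le_mul_of_nonneg_left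
      (semi_le_Zssemi (k := 0) (l := []) le_rfl h _ _ p) (by norm_num))
  have h2 : |tri (gradT (Ztsr l h) p) (Lbv p) (Lv p) (Lv p)| ≤
      Zdsemi l.length h (Ufam p S₁ S₂) (Ufam p S₁ S₂) (Ufam p S₁ S₂) p :=
    (abs_tri_le Lbv_mem_Ufam (Tfam_subset_Ufam Lv_mem_Tfam)
      (Tfam_subset_Ufam Lv_mem_Tfam)).trans (dsemi_le_Zdsemi le_rfl h _ _ _ p)
  have h3 := mul_le_quadErr (by omega : l.length + 0 ≤ l.length) h S₁ S₂ p
  have h4 := Zdsemi_nonneg l.length h (Ufam p S₁ S₂) (Ufam p S₁ S₂) (Ufam p S₁ S₂) p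
  have h5 := mul_le_mul_of_nonneg_right (hh.trans h1) h4
  linarith

lemma abs_cov_gform_sub_le (hr : 0 < rad p) (hf : SphFrame p S₁ S₂) {h : Tsr}
    (hh : ∀ μ ν, Sm fun y => h y μ ν) (hs : ∀ p μ ν, h p μ ν = h p ν μ) (l : List ZIdx)
    {t s x : ℝ} (ht : 0 ≤ t) (hs0 : 0 ≤ s) (hx0 : 0 ≤ x)
    (htl : ∀ J : List ZIdx, J.length + 1 ≤ l.length →
      dsemi (Ztsr J h) (Tfam p S₁ S₂) (Ufam p S₁ S₂) (Ufam p S₁ S₂) p ≤ t)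
    (hsl : ∀ J : List ZIdx, J.length + 1 ≤ l.length →
      dsemi (Ztsr J h) (Ufam p S₁ S₂) (Lfam p) (Tfam p S₁ S₂) p ≤ s)
    (hxl : ∀ J : List ZIdx, J.length + 2 ≤ l.length →
      dsemi (Ztsr J h) (Ufam p S₁ S₂) (Ufam p S₁ S₂) (Ufam p S₁ S₂) p ≤ x) :
    |cov (gform idCoef (ZgradT l h p)) (Lv p) - cov (gform idCoef (gradT (Ztsr l h) p)) (Lv p)| ≤
      769 * 10 ^ l.length * (64 * x + 60 * (t + s)) := by
  refine abs_cov_gform_idCoef_sub_le (p := p) (X := 64 * x) (Y := 60 * (t + s))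
    (mul_nonneg (by norm_num) hx0) (mul_nonneg (by norm_num) (add_nonneg ht hs0)) l hh
    (fun J hJ γ μ ν => ?_) (fun J hJ z => ?_)
  · exact (abs_gradT_le hr hf (Ztsr J h) γ μ ν).trans (mul_le_mul_of_nonneg_left
      (hxl J hJ) (by norm_num))
  · refine abs_cov_gform_commCoef_le hr hf (fun α μ ν => ?_) (fun U hU V hV W hW => ?_)
      (fun W hW => ?_) z
    · have : (fun y => h y μ ν) = fun y => h y ν μ := by ext y; exact hs y μ ν
      simp only [gradT, Ztsr, this]
    · exact (abs_tri_le hU hV hW).trans (htl J hJ)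
    · exact (abs_tri_le Lbv_mem_Ufam Lv_mem_Lfam hW).trans (hsl J hJ)

end

section

variable {p S₁ S₂ : Pt}

lemma le_of_abs_sub_le_of_le_two_mul {c P t s x q P' e1 e2 T : ℝ} (hc : 0 ≤ c)
    (hP' : P' ≤ P) (hP : 1 ≤ P) (ht : 0 ≤ t) (hs : 0 ≤ s) (hx : 0 ≤ x) (hq : 0 ≤ q)
    (h1 : |e1| ≤ 4 * (c * q))
    (h2 : |e1 - e2| ≤ 769 * P' * (64 * x + 60 * (t + s))) (hT : T ≤ 2 * |e2| + 10 * t) :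
    T ≤ (8 * c + 98432 * P + 138) * (t + (s + x + q)) := by
  have h3 : 769 * P' * (64 * x + 60 * (t + s)) ≤ 769 * P * (64 * (t + s + x)) :=
    mul_le_mul (by linarith) (by linarith) (by linarith) (by linarith)
  have h4 : |e2| ≤ |e1| + |e1 - e2| := by
    have := abs_sub_abs_le_abs_sub e2 e1
    rw [abs_sub_comm e2 e1] at this
    linarith
  have h5 : 0 ≤ c * (t + s + x) := mul_nonneg hc (by linarith)
  have h6 : 0 ≤ P * q := mul_nonneg (by linarith) hq
  linarith

lemma exists_abs_tri_le (k : ℕ) (C₀ : ℝ) : ∃ C : ℝ, 0 ≤ C ∧ ∀ h : Tsr,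
    (∀ μ ν, Sm fun y => h y μ ν) → (∀ p μ ν, h p μ ν = h p ν μ) → (∀ p, WaveGaugeAt h p) →
    ∀ p S₁ S₂ : Pt, 0 < rad p → SphFrame p S₁ S₂ → hnorm k h p ≤ C₀ →
    ∀ l : List ZIdx, l.length ≤ k →
      |tri (gradT (Ztsr l h) p) (Lbv p) (Lv p) (Lv p)| ≤
        C * (Zdsemi l.length h (Tfam p S₁ S₂) (Ufam p S₁ S₂) (Ufam p S₁ S₂) p
          + lowErr l.length h S₁ S₂ p) := by
  obtain ⟨c, c0, hc⟩ := exists_abs_gform_le k C₀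
  refine ⟨8 * c + 98432 * 10 ^ k + 138, by positivity,
    fun h hh hs hg p S₁ S₂ hr hf hp l hl => ?_⟩
  have t0 := Zdsemi_nonneg l.length h (Tfam p S₁ S₂) (Ufam p S₁ S₂) (Ufam p S₁ S₂) p
  have s0 := ite_nonneg (p := l.length = 0) le_rfl
    (Zdsemi_nonneg (l.length-1) h (Ufam p S₁ S₂) (Lfam p) (Tfam p S₁ S₂) p)
  have x0 := ite_nonneg (p := l.length ≤ 1) le_rfl
    (Zdsemi_nonneg (l.length-2) h (Ufam p S₁ S₂) (Ufam p S₁ S₂) (Ufam p S₁ S₂) p)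
  have q0 := quadErr_nonneg l.length h S₁ S₂ p
  by_cases hdet : (gmat h p).det = 0
  · have hbig : ∃ μ ν, 1/8 < |h p μ ν| := by
      by_contra! hcon
      exact det_gmat_ne_zero hcon hdet
    obtain ⟨μ, ν, hμν⟩ := hbig
    have h5 := abs_tri_le_quadErr hr hf hμν.le l
    have h6 : quadErr l.length h S₁ S₂ p ≤
        Zdsemi l.length h (Tfam p S₁ S₂) (Ufam p S₁ S₂) (Ufam p S₁ S₂) p
          + lowErr l.length h S₁ S₂ p := by
      rw [lowErr]
      linarith
    refine h5.trans (mul_le_mul ?_ h6 q0 (by positivity))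
    have : (0 : ℝ) ≤ 10 ^ k := by positivity
    linarith
  · have e1 : |cov (gform idCoef (ZgradT l h p)) (Lv p)| ≤
        4 * (c * quadErr l.length h S₁ S₂ p) :=
      abs_cov_le (abs_Lv_le p) fun μ => hc h hh hs hg p S₁ S₂ hr hf hp hdet l hl μ
    have e2 := abs_cov_gform_sub_le hr hf hh hs l t0 s0 x0
      (fun J hJ => dsemi_le_Zdsemi (by omega) h _ _ _ p)
      (fun J hJ => by
        rw [if_neg (by omega)]
        exact dsemi_le_Zdsemi (by omega) h _ _ _ p)
      (fun J hJ => by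
        rw [if_neg (by omega)]
        exact dsemi_le_Zdsemi (by omega) h _ _ _ p)
    have e3 := abs_tri_le_gform hr hf (D := gradT (Ztsr l h) p)
      (t := Zdsemi l.length h (Tfam p S₁ S₂) (Ufam p S₁ S₂) (Ufam p S₁ S₂) p)
      fun U hU V hV W hW => (abs_tri_le hU hV hW).trans (dsemi_le_Zdsemi le_rfl h _ _ _ p)
    exact le_of_abs_sub_le_of_le_two_mul c0 (pow_le_pow_right₀ (by norm_num) hl)
      (one_le_pow₀ (by norm_num))
      t0 s0 x0 q0 e1 e2 e3

/-- The derivatives of the component `h_{LL}` in arbitrary coordinate directions. -/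
lemma exists_abs_tcon_le (k : ℕ) (C₀ : ℝ) : ∃ C : ℝ, 0 ≤ C ∧ ∀ h : Tsr,
    (∀ μ ν, Sm fun y => h y μ ν) → (∀ p μ ν, h p μ ν = h p ν μ) → (∀ p, WaveGaugeAt h p) →
    ∀ p S₁ S₂ : Pt, 0 < rad p → SphFrame p S₁ S₂ → hnorm k h p ≤ C₀ →
    ∀ l : List ZIdx, l.length ≤ k → ∀ α,
      |tcon (gradT (Ztsr l h) p α) (Lv p) (Lv p)| ≤
        C * (Zdsemi l.length h (Tfam p S₁ S₂) (Ufam p S₁ S₂) (Ufam p S₁ S₂) p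
          + lowErr l.length h S₁ S₂ p) := by
  obtain ⟨c, c0, hc⟩ := exists_abs_tri_le k C₀
  refine ⟨4 * (c + 1), by positivity, fun h hh hs hg p S₁ S₂ hr hf hp l hl α => ?_⟩
  have mL : Lv p ∈ Tfam p S₁ S₂ := Lv_mem_Tfam
  have t0 := Zdsemi_nonneg l.length h (Tfam p S₁ S₂) (Ufam p S₁ S₂) (Ufam p S₁ S₂) p
  have l0 := lowErr_nonneg l.length h S₁ S₂ p
  have hb := hc h hh hs hg p S₁ S₂ hr hf hp l hl
  have ht : ∀ U ∈ Tfam p S₁ S₂, |tri (gradT (Ztsr l h) p) U (Lv p) (Lv p)| ≤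
      Zdsemi l.length h (Tfam p S₁ S₂) (Ufam p S₁ S₂) (Ufam p S₁ S₂) p := fun U hU =>
    (abs_tri_le hU (Tfam_subset_Ufam mL) (Tfam_subset_Ufam mL)).trans
      (dsemi_le_Zdsemi le_rfl h _ _ _ p)
  generalize Zdsemi l.length h (Tfam p S₁ S₂) (Ufam p S₁ S₂) (Ufam p S₁ S₂) p = t at *
  generalize lowErr l.length h S₁ S₂ p = e at *
  have h0 : 0 ≤ c * (t + e) := mul_nonneg c0 (add_nonneg t0 l0)
  rw [mul_assoc]
  refine abs_coord_le hr hf (fun α => tcon (gradT (Ztsr l h) p α) (Lv p) (Lv p)) α fun U hU => ?_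
  rw [add_one_mul]
  have hU' : U = Lbv p ∨ U ∈ Tfam p S₁ S₂ := by
    simp only [Ufam, Tfam, List.mem_cons, List.not_mem_nil, or_false] at hU ⊢
    tauto
  rcases hU' with rfl | hU'
  · exact hb.trans (by linarith)
  · exact (ht U hU').trans (by linarith)

end

/-! ### Estimates for `P` -/

section

variable {p S₁ S₂ : Pt} {m : ℕ}

lemma sum_smul_Wgrad (h : Tsr) (ψ : Fin m → Pt → ℝ) (p V : Pt) :
    ∑ α, V α • Wgrad α h ψ p = (dirT h p V, fun k => dirD V (ψ k) p) := by
  ext μ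
  · rename_i ν
    simp [Wgrad, Prod.fst_sum, Finset.sum_apply, dirT, dirD_eq_cov, cov, gradT, mul_comm]
  · simp [Wgrad, Prod.snd_sum, Finset.sum_apply, dirD_eq_cov, cov, mul_comm]

lemma tcon_PD (N : Fin m → ℝ) (NN : Fin m → Fin m → ℝ) (h : Tsr) (ψ : Fin m → Pt → ℝ)
    (p V W : Pt) :
    tcon (PD N NN h h ψ ψ p) V W = Pform N NN (dirT h p V) (fun k => dirD V (ψ k) p)
      (dirT h p W) (fun k => dirD W (ψ k) p) := by
  have e := Pbil_apply N NN (dirT h p V, fun k => dirD V (ψ k) p)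
    (dirT h p W, fun k => dirD W (ψ k) p)
  rw [← e, ← sum_smul_Wgrad h ψ p V, ← sum_smul_Wgrad h ψ p W]
  simp only [map_sum, map_smul, sum_apply, smul_apply, smul_eq_mul, Finset.mul_sum]
  rw [tcon, Finset.sum_comm]
  refine Finset.sum_congr rfl fun μ _ => Finset.sum_congr rfl fun ν _ => ?_
  rw [PD_eq_Pform, Pbil_apply, Wgrad, Wgrad]
  ring

lemma dirT_symm {h : Tsr} (hs : ∀ p μ ν, h p μ ν = h p ν μ) (p U : Pt) (μ ν : Fin 4) :
    dirT h p U μ ν = dirT h p U ν μ := by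
  have : (fun y => h y μ ν) = fun y => h y ν μ := by ext y; exact hs y μ ν
  simp only [dirT, this]

lemma gradT_symm {h : Tsr} (hs : ∀ p μ ν, h p μ ν = h p ν μ) (p : Pt) (α μ ν : Fin 4) :
    gradT h p α μ ν = gradT h p α ν μ :=
  dirT_symm hs p _ μ ν

lemma Ztsr_symm {h : Tsr} (hs : ∀ p μ ν, h p μ ν = h p ν μ) (l : List ZIdx) (p : Pt)
    (μ ν : Fin 4) : Ztsr l h p μ ν = Ztsr l h p ν μ := by
  have : (fun y => h y μ ν) = fun y => h y ν μ := by ext y; exact hs y μ ν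
  simp only [Ztsr, this]

lemma dsemi_le_dWn (h : Tsr) (ψ : Fin m → Pt → ℝ) (S₁ S₂ p : Pt) :
    dsemi h (Ufam p S₁ S₂) (Ufam p S₁ S₂) (Ufam p S₁ S₂) p ≤ dWn h ψ S₁ S₂ p :=
  le_add_of_nonneg_right (kdsemi_nonneg _ _ _)

lemma kdsemi_le_dWn (h : Tsr) (ψ : Fin m → Pt → ℝ) (S₁ S₂ p : Pt) :
    kdsemi ψ (Ufam p S₁ S₂) p ≤ dWn h ψ S₁ S₂ p :=
  le_add_of_nonneg_left (dsemi_nonneg _ _ _ _ _)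

lemma dsemi_le_dWbar (h : Tsr) (ψ : Fin m → Pt → ℝ) (S₁ S₂ p : Pt) :
    dsemi h (Tfam p S₁ S₂) (Ufam p S₁ S₂) (Ufam p S₁ S₂) p ≤ dWbar h ψ S₁ S₂ p :=
  le_add_of_nonneg_right (kdsemi_nonneg _ _ _)

lemma kdsemi_le_dWbar (h : Tsr) (ψ : Fin m → Pt → ℝ) (S₁ S₂ p : Pt) :
    kdsemi ψ (Tfam p S₁ S₂) p ≤ dWbar h ψ S₁ S₂ p :=
  le_add_of_nonneg_left (dsemi_nonneg _ _ _ _ _)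

lemma dsemi_le_dWG (h : Tsr) (ψ : Fin m → Pt → ℝ) (S₁ S₂ p : Pt) :
    dsemi h (Ufam p S₁ S₂) (Tfam p S₁ S₂) (Ufam p S₁ S₂) p ≤ dWG h ψ S₁ S₂ p :=
  le_add_of_nonneg_right (kdsemi_nonneg _ _ _)

lemma kdsemi_le_dWG (h : Tsr) (ψ : Fin m → Pt → ℝ) (S₁ S₂ p : Pt) :
    kdsemi ψ (Ufam p S₁ S₂) p ≤ dWG h ψ S₁ S₂ p :=
  le_add_of_nonneg_left (dsemi_nonneg _ _ _ _ _)

lemma dWn_nonneg (h : Tsr) (ψ : Fin m → Pt → ℝ) (S₁ S₂ p : Pt) : 0 ≤ dWn h ψ S₁ S₂ p :=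
  add_nonneg (dsemi_nonneg _ _ _ _ _) (kdsemi_nonneg _ _ _)

lemma dWbar_nonneg (h : Tsr) (ψ : Fin m → Pt → ℝ) (S₁ S₂ p : Pt) : 0 ≤ dWbar h ψ S₁ S₂ p :=
  add_nonneg (dsemi_nonneg _ _ _ _ _) (kdsemi_nonneg _ _ _)

lemma dWG_nonneg (h : Tsr) (ψ : Fin m → Pt → ℝ) (S₁ S₂ p : Pt) : 0 ≤ dWG h ψ S₁ S₂ p :=
  add_nonneg (dsemi_nonneg _ _ _ _ _) (kdsemi_nonneg _ _ _)

lemma abs_tcon_dirT_le {h : Tsr} {Ds Vs Ws : List Pt} {U V W : Pt} (hU : U ∈ Ds) (hV : V ∈ Vs)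
    (hW : W ∈ Ws) : |tcon (dirT h p U) V W| ≤ dsemi h Ds Vs Ws p := by
  rw [tcon_dirT]
  exact abs_tri_le hU hV hW

/-- The estimate of the components `P_{𝒯𝒰}`. -/
lemma semi_PD_Tfam_le (N : Fin m → ℝ) (NN : Fin m → Fin m → ℝ) (hr : 0 < rad p)
    (hf : SphFrame p S₁ S₂) {h : Tsr} (hs : ∀ p μ ν, h p μ ν = h p ν μ) (ψ : Fin m → Pt → ℝ) :
    semi (PD N NN h h ψ ψ p) (Tfam p S₁ S₂) (Ufam p S₁ S₂) ≤
      36 * Pconst N NN * (dWbar h ψ S₁ S₂ p * dWn h ψ S₁ S₂ p) := by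
  have mU : ∀ V ∈ Tfam p S₁ S₂, V ∈ Ufam p S₁ S₂ := fun V hV => Tfam_subset_Ufam hV
  have mL : Lv p ∈ Ufam p S₁ S₂ := mU _ Lv_mem_Tfam
  have mB : Lbv p ∈ Ufam p S₁ S₂ := Lbv_mem_Ufam
  refine (semi_le (X := Pconst N NN * (dWbar h ψ S₁ S₂ p * dWn h ψ S₁ S₂ p
    + dWbar h ψ S₁ S₂ p * dWn h ψ S₁ S₂ p + dWbar h ψ S₁ S₂ p * dWn h ψ S₁ S₂ p))
    fun V hV W hW => ?_).trans (le_of_eq ?_)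
  · rw [tcon_PD]
    have bV : ∀ V' ∈ Ufam p S₁ S₂, ∀ W' ∈ Ufam p S₁ S₂, |tcon (dirT h p V) V' W'| ≤
        dWbar h ψ S₁ S₂ p := fun V' hV' W' hW' =>
      (abs_tcon_dirT_le hV hV' hW').trans (dsemi_le_dWbar h ψ S₁ S₂ p)
    have bW : ∀ V' ∈ Ufam p S₁ S₂, ∀ W' ∈ Ufam p S₁ S₂, |tcon (dirT h p W) V' W'| ≤
        dWn h ψ S₁ S₂ p := fun V' hV' W' hW' =>
      (abs_tcon_dirT_le hW hV' hW').trans (dsemi_le_dWn h ψ S₁ S₂ p)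
    exact abs_Pform_le N NN hr hf (dirT_symm hs p V) (dirT_symm hs p W)
      (fun V' hV' => bV V' (mU _ hV')) (fun V' hV' => bW V' (mU _ hV'))
      (fun k => (abs_dirD_le_kdsemi hV k).trans (kdsemi_le_dWbar h ψ S₁ S₂ p))
      (fun k => (abs_dirD_le_kdsemi hW k).trans (kdsemi_le_dWn h ψ S₁ S₂ p))
      (bV _ mL _ mL) (bW _ mL _ mL) (bV _ mB _ mB) (bW _ mB _ mB)
  · simp only [Tfam, Ufam, List.length_cons, List.length_nil]
    push_cast
    ring

lemma abs_Pbil_Wgrad_le (N : Fin m → ℝ) (NN : Fin m → Fin m → ℝ) (hr : 0 < rad p)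
    (hf : SphFrame p S₁ S₂) {h h' : Tsr} (hs : ∀ p μ ν, h p μ ν = h p ν μ)
    (hs' : ∀ p μ ν, h' p μ ν = h' p ν μ) (ψ ψ' : Fin m → Pt → ℝ) {l l' : ℝ} {α β : Fin 4}
    (hl : |tcon (gradT h p α) (Lv p) (Lv p)| ≤ l) (hl' : |tcon (gradT h' p β) (Lv p) (Lv p)| ≤ l') :
    |Pbil N NN (Wgrad α h ψ p) (Wgrad β h' ψ' p)| ≤ 16 * Pconst N NN *
      (dWG h ψ S₁ S₂ p * dWG h' ψ' S₁ S₂ p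
        + l * dsemi h' (Ufam p S₁ S₂) (Ufam p S₁ S₂) (Ufam p S₁ S₂) p
        + dsemi h (Ufam p S₁ S₂) (Ufam p S₁ S₂) (Ufam p S₁ S₂) p * l') := by
  have mB : Lbv p ∈ Ufam p S₁ S₂ := Lbv_mem_Ufam
  have key := abs_Pform_le N NN hr hf (gradT_symm hs p α) (gradT_symm hs' p β)
    (fun V hV W hW => (abs_tcon_gradT_le hr hf hV hW α).trans
      (mul_le_mul_of_nonneg_left (dsemi_le_dWG h ψ S₁ S₂ p) (by norm_num)))
    (fun V hV W hW => (abs_tcon_gradT_le hr hf hV hW β).trans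
      (mul_le_mul_of_nonneg_left (dsemi_le_dWG h' ψ' S₁ S₂ p) (by norm_num)))
    (fun k => (abs_pd_le_kdsemi hr hf ψ α k).trans
      (mul_le_mul_of_nonneg_left (kdsemi_le_dWG h ψ S₁ S₂ p) (by norm_num)))
    (fun k => (abs_pd_le_kdsemi hr hf ψ' β k).trans
      (mul_le_mul_of_nonneg_left (kdsemi_le_dWG h' ψ' S₁ S₂ p) (by norm_num)))
    hl hl' (abs_tcon_gradT_le hr hf mB mB α) (abs_tcon_gradT_le hr hf mB mB β)
  rw [Pbil_apply]
  refine key.trans ?_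
  have l0 := mul_nonneg ((abs_nonneg _).trans hl)
    (dsemi_nonneg h' (Ufam p S₁ S₂) (Ufam p S₁ S₂) (Ufam p S₁ S₂) p)
  have l0' := mul_nonneg (dsemi_nonneg h (Ufam p S₁ S₂) (Ufam p S₁ S₂) (Ufam p S₁ S₂) p)
    ((abs_nonneg _).trans hl')
  rw [mul_comm 16, mul_assoc (Pconst N NN)]
  refine mul_le_mul_of_nonneg_left ?_ (Pconst_pos N NN).le
  linarith

/-- The bound of `P` by all derivatives. -/
lemma abs_PD_le (N : Fin m → ℝ) (NN : Fin m → Fin m → ℝ) (hr : 0 < rad p)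
    (hf : SphFrame p S₁ S₂) {h : Tsr} (hs : ∀ p μ ν, h p μ ν = h p ν μ) (ψ : Fin m → Pt → ℝ)
    (μ ν : Fin 4) : |PD N NN h h ψ ψ p μ ν| ≤ 48 * Pconst N NN * dWn h ψ S₁ S₂ p ^ 2 := by
  have mU : ∀ V ∈ Tfam p S₁ S₂, V ∈ Ufam p S₁ S₂ := fun V hV => Tfam_subset_Ufam hV
  have mL : Lv p ∈ Ufam p S₁ S₂ := mU _ Lv_mem_Tfam
  have mB : Lbv p ∈ Ufam p S₁ S₂ := Lbv_mem_Ufam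
  have b : ∀ α, ∀ V ∈ Ufam p S₁ S₂, ∀ W ∈ Ufam p S₁ S₂, |tcon (gradT h p α) V W| ≤
      4 * dWn h ψ S₁ S₂ p := fun α V hV W hW => (abs_tcon_gradT_le hr hf hV hW α).trans
    (mul_le_mul_of_nonneg_left (dsemi_le_dWn h ψ S₁ S₂ p) (by norm_num))
  have b' : ∀ α k, |pd α (ψ k) p| ≤ 4 * dWn h ψ S₁ S₂ p := fun α k =>
    (abs_pd_le_kdsemi hr hf ψ α k).trans
      (mul_le_mul_of_nonneg_left (kdsemi_le_dWn h ψ S₁ S₂ p) (by norm_num))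
  rw [PD_eq_Pform]
  refine (abs_Pform_le N NN hr hf (gradT_symm hs p μ) (gradT_symm hs p ν)
    (fun V hV => b μ V (mU _ hV)) (fun V hV => b ν V (mU _ hV)) (b' μ) (b' ν)
    (b μ _ mL _ mL) (b ν _ mL _ mL) (b μ _ mB _ mB) (b ν _ mB _ mB)).trans (le_of_eq ?_)
  ring

/-- The main terms in the estimate of `Z^I P`. -/
def mainSum (k : ℕ) (h : Tsr) (ψ : Fin m → Pt → ℝ) (S₁ S₂ p : Pt) : ℝ :=
  ∑ j ∈ Finset.range (k+1), ∑ j' ∈ Finset.range (k+1-j),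
    (ZdWG j h ψ S₁ S₂ p * ZdWG j' h ψ S₁ S₂ p + ZdWbar j h ψ S₁ S₂ p * ZdWn j' h ψ S₁ S₂ p)

/-- The lower-order terms in the estimate of `Z^I P`. -/
def lowSum (k : ℕ) (h : Tsr) (S₁ S₂ p : Pt) : ℝ :=
  ∑ j ∈ Finset.range (k+1), ∑ j' ∈ Finset.range (k+1-j),
    Zdsemi j' h (Ufam p S₁ S₂) (Ufam p S₁ S₂) (Ufam p S₁ S₂) p * lowErr j h S₁ S₂ p

lemma ZdWG_nonneg (j : ℕ) (h : Tsr) (ψ : Fin m → Pt → ℝ) (S₁ S₂ p : Pt) :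
    0 ≤ ZdWG j h ψ S₁ S₂ p := Zsum_nonneg _ fun _ => dWG_nonneg _ _ _ _ _

lemma ZdWbar_nonneg (j : ℕ) (h : Tsr) (ψ : Fin m → Pt → ℝ) (S₁ S₂ p : Pt) :
    0 ≤ ZdWbar j h ψ S₁ S₂ p := Zsum_nonneg _ fun _ => dWbar_nonneg _ _ _ _ _

lemma ZdWn_nonneg (j : ℕ) (h : Tsr) (ψ : Fin m → Pt → ℝ) (S₁ S₂ p : Pt) :
    0 ≤ ZdWn j h ψ S₁ S₂ p := Zsum_nonneg _ fun _ => dWn_nonneg _ _ _ _ _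

lemma Zdsemi_mul_le_mainSum {j j' k : ℕ} (hj : j + j' ≤ k) (h : Tsr) (ψ : Fin m → Pt → ℝ)
    (S₁ S₂ p : Pt) :
    Zdsemi j h (Tfam p S₁ S₂) (Ufam p S₁ S₂) (Ufam p S₁ S₂) p *
      Zdsemi j' h (Ufam p S₁ S₂) (Ufam p S₁ S₂) (Ufam p S₁ S₂) p ≤ mainSum k h ψ S₁ S₂ p := by
  have h1 : Zdsemi j h (Tfam p S₁ S₂) (Ufam p S₁ S₂) (Ufam p S₁ S₂) p ≤ ZdWbar j h ψ S₁ S₂ p :=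
    Zsum_le_Zsum fun l _ => dsemi_le_dWbar (Ztsr l h) (fun k => Ziter l (ψ k)) S₁ S₂ p
  have h2 : Zdsemi j' h (Ufam p S₁ S₂) (Ufam p S₁ S₂) (Ufam p S₁ S₂) p ≤ ZdWn j' h ψ S₁ S₂ p :=
    Zsum_le_Zsum fun l _ => dsemi_le_dWn (Ztsr l h) (fun k => Ziter l (ψ k)) S₁ S₂ p
  refine (mul_le_mul h1 h2 (Zdsemi_nonneg _ _ _ _ _ _) (ZdWbar_nonneg _ _ _ _ _ _)).trans ?_
  refine (le_add_of_nonneg_left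
    (mul_nonneg (ZdWG_nonneg j h ψ S₁ S₂ p) (ZdWG_nonneg j' h ψ S₁ S₂ p))).trans
    (le_sum_sum_range (f := fun j j' => ZdWG j h ψ S₁ S₂ p * ZdWG j' h ψ S₁ S₂ p
      + ZdWbar j h ψ S₁ S₂ p * ZdWn j' h ψ S₁ S₂ p) (fun i j => ?_) hj)
  exact add_nonneg (mul_nonneg (ZdWG_nonneg _ _ _ _ _ _) (ZdWG_nonneg _ _ _ _ _ _))
    (mul_nonneg (ZdWbar_nonneg _ _ _ _ _ _) (ZdWn_nonneg _ _ _ _ _ _))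

lemma ZdWG_mul_le_mainSum {j j' k : ℕ} (hj : j + j' ≤ k) (h : Tsr) (ψ : Fin m → Pt → ℝ)
    (S₁ S₂ p : Pt) :
    ZdWG j h ψ S₁ S₂ p * ZdWG j' h ψ S₁ S₂ p ≤ mainSum k h ψ S₁ S₂ p := by
  refine (le_add_of_nonneg_right
    (mul_nonneg (ZdWbar_nonneg j h ψ S₁ S₂ p) (ZdWn_nonneg j' h ψ S₁ S₂ p))).trans
    (le_sum_sum_range (f := fun j j' => ZdWG j h ψ S₁ S₂ p * ZdWG j' h ψ S₁ S₂ p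
      + ZdWbar j h ψ S₁ S₂ p * ZdWn j' h ψ S₁ S₂ p) (fun i j => ?_) hj)
  exact add_nonneg (mul_nonneg (ZdWG_nonneg _ _ _ _ _ _) (ZdWG_nonneg _ _ _ _ _ _))
    (mul_nonneg (ZdWbar_nonneg _ _ _ _ _ _) (ZdWn_nonneg _ _ _ _ _ _))

lemma Zdsemi_mul_lowErr_le_lowSum {j j' k : ℕ} (hj : j + j' ≤ k) (h : Tsr) (S₁ S₂ p : Pt) :
    Zdsemi j' h (Ufam p S₁ S₂) (Ufam p S₁ S₂) (Ufam p S₁ S₂) p * lowErr j h S₁ S₂ p ≤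
      lowSum k h S₁ S₂ p :=
  le_sum_sum_range (f := fun j j' => Zdsemi j' h (Ufam p S₁ S₂) (Ufam p S₁ S₂) (Ufam p S₁ S₂) p *
    lowErr j h S₁ S₂ p)
    (fun _ _ => mul_nonneg (Zdsemi_nonneg _ _ _ _ _ _) (lowErr_nonneg _ _ _ _ _)) hj

/-- The estimate of `Z^I P` at a point. -/
lemma exists_abs_Ziter_PD_le (N : Fin m → ℝ) (NN : Fin m → Fin m → ℝ) (k : ℕ) (C₀ : ℝ) :
    ∃ C : ℝ, 0 < C ∧ ∀ (h : Tsr) (ψ : Fin m → Pt → ℝ), SmW h ψ →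
    (∀ p μ ν, h p μ ν = h p ν μ) → (∀ p, WaveGaugeAt h p) →
    ∀ p S₁ S₂ : Pt, 0 < rad p → SphFrame p S₁ S₂ → hnorm k h p ≤ C₀ →
    ∀ l : List ZIdx, l.length ≤ k → ∀ μ ν,
      |Ziter l (fun y => PD N NN h h ψ ψ y μ ν) p| ≤
        C * (mainSum k h ψ S₁ S₂ p + lowSum k h S₁ S₂ p) := by
  obtain ⟨c, c0, hc⟩ := exists_abs_tcon_le k C₀
  have P0 := Pconst_pos N NN
  refine ⟨18 ^ k * (16 * Pconst N NN * (1 + 2 * c)), by positivity,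
    fun h ψ H hs hg p S₁ S₂ hr hf hp l hl μ ν => ?_⟩
  have key : |Ziter l (fun y => PD N NN h h ψ ψ y μ ν) p| ≤
      18 ^ l.length * (16 * Pconst N NN * ((1 + 2 * c) *
        (mainSum k h ψ S₁ S₂ p + lowSum k h S₁ S₂ p))) := by
    have e : (fun y => PD N NN h h ψ ψ y μ ν) =
        fun y => Pbil N NN (Wgrad μ h ψ y) (Wgrad ν h ψ y) := by
      ext y
      exact PD_eq_Pform N NN h ψ y μ ν
    rw [e]
    refine H.abs_Ziter_bilin_le (Pbil N NN) l H (fun J K hJK α β => ?_) μ ν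
    have hl1 := hc h H.tsr hs hg p S₁ S₂ hr hf hp J (by omega) α
    have hl2 := hc h H.tsr hs hg p S₁ S₂ hr hf hp K (by omega) β
    refine (abs_Pbil_Wgrad_le N NN hr hf (Ztsr_symm hs J) (Ztsr_symm hs K) _ _ hl1 hl2).trans
      (mul_le_mul_of_nonneg_left ?_ (by positivity))
    have g1 : dWG (Ztsr J h) (fun k => Ziter J (ψ k)) S₁ S₂ p ≤ ZdWG J.length h ψ S₁ S₂ p :=
      le_Zsum (F := fun l => dWG (Ztsr l h) (fun k => Ziter l (ψ k)) S₁ S₂ p)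
        (fun _ => dWG_nonneg _ _ _ _ _) le_rfl
    have g2 : dWG (Ztsr K h) (fun k => Ziter K (ψ k)) S₁ S₂ p ≤ ZdWG K.length h ψ S₁ S₂ p :=
      le_Zsum (F := fun l => dWG (Ztsr l h) (fun k => Ziter l (ψ k)) S₁ S₂ p)
        (fun _ => dWG_nonneg _ _ _ _ _) le_rfl
    have g3 := (mul_le_mul g1 g2 (dWG_nonneg _ _ _ _ _) (ZdWG_nonneg _ _ _ _ _ _)).trans
      (ZdWG_mul_le_mainSum (by omega : J.length + K.length ≤ k) h ψ S₁ S₂ p)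
    have u1 := dsemi_le_Zdsemi (l := J) le_rfl h (Ufam p S₁ S₂) (Ufam p S₁ S₂) (Ufam p S₁ S₂) p
    have u2 := dsemi_le_Zdsemi (l := K) le_rfl h (Ufam p S₁ S₂) (Ufam p S₁ S₂) (Ufam p S₁ S₂) p
    have m1 := Zdsemi_mul_le_mainSum (by omega : J.length + K.length ≤ k) h ψ S₁ S₂ p
    have m2 := Zdsemi_mul_le_mainSum (by omega : K.length + J.length ≤ k) h ψ S₁ S₂ p
    have n1 := Zdsemi_mul_lowErr_le_lowSum (by omega : J.length + K.length ≤ k) h S₁ S₂ p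
    have n2 := Zdsemi_mul_lowErr_le_lowSum (by omega : K.length + J.length ≤ k) h S₁ S₂ p
    have t1 := add_nonneg
      (Zdsemi_nonneg J.length h (Tfam p S₁ S₂) (Ufam p S₁ S₂) (Ufam p S₁ S₂) p)
      (lowErr_nonneg J.length h S₁ S₂ p)
    have t2 := add_nonneg
      (Zdsemi_nonneg K.length h (Tfam p S₁ S₂) (Ufam p S₁ S₂) (Ufam p S₁ S₂) p)
      (lowErr_nonneg K.length h S₁ S₂ p)
    have w1 := mul_le_mul_of_nonneg_left u2 t1
    have w2 := mul_le_mul_of_nonneg_left u1 t2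
    have v1 := mul_le_mul_of_nonneg_left (w1.trans (c := mainSum k h ψ S₁ S₂ p
      + lowSum k h S₁ S₂ p) (by linarith)) c0
    have v2 := mul_le_mul_of_nonneg_left (w2.trans (c := mainSum k h ψ S₁ S₂ p
      + lowSum k h S₁ S₂ p) (by linarith)) c0
    have n0 : 0 ≤ lowSum k h S₁ S₂ p :=
      (mul_nonneg (Zdsemi_nonneg _ _ _ _ _ _) (lowErr_nonneg _ _ _ _ _)).trans n1
    linarith
  refine key.trans ?_
  have m0 : 0 ≤ mainSum k h ψ S₁ S₂ p :=
    (mul_nonneg (ZdWG_nonneg 0 h ψ S₁ S₂ p) (ZdWG_nonneg 0 h ψ S₁ S₂ p)).trans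
      (ZdWG_mul_le_mainSum (Nat.zero_le k) h ψ S₁ S₂ p)
  have n0 : 0 ≤ lowSum k h S₁ S₂ p :=
    (mul_nonneg (Zdsemi_nonneg _ _ _ _ _ _) (lowErr_nonneg _ _ _ _ _)).trans
      (Zdsemi_mul_lowErr_le_lowSum (j := 0) (j' := 0) (Nat.zero_le k) h S₁ S₂ p)
  rw [mul_assoc (18 ^ k), mul_assoc (16 * Pconst N NN)]
  refine mul_le_mul_of_nonneg_right (pow_le_pow_right₀ (by norm_num) hl) ?_
  have := add_nonneg m0 n0
  positivity

end

/-! ### Estimates for the null forms -/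

section

variable {p S₁ S₂ : Pt} {m : ℕ}

lemma abs_Q0f_le (hr : 0 < rad p) (hf : SphFrame p S₁ S₂) {u v : Pt → ℝ} {X Y : ℝ}
    (hu : ∀ U ∈ Ufam p S₁ S₂, |dirD U u p| ≤ X) (hu' : ∀ U ∈ Tfam p S₁ S₂, |dirD U u p| ≤ Y)
    (hv : ∀ U ∈ Ufam p S₁ S₂, |dirD U v p| ≤ X) (hv' : ∀ U ∈ Tfam p S₁ S₂, |dirD U v p| ≤ Y) :
    |Q0f u v p| ≤ 3 * (Y * X) := by
  have e : Q0f u v p = -(1/2) * (dirD (Lv p) u p * dirD (Lbv p) v p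
      + dirD (Lbv p) u p * dirD (Lv p) v p) + dirD S₁ u p * dirD S₁ v p
      + dirD S₂ u p * dirD S₂ v p := by
    simp only [dirD_eq_cov]
    rw [← sum_mink_mul_mul hr hf, Q0f]
    simp only [mul_assoc]
  have mL : Lv p ∈ Tfam p S₁ S₂ := Lv_mem_Tfam
  have m1 : S₁ ∈ Tfam p S₁ S₂ := S₁_mem_Tfam
  have m2 : S₂ ∈ Tfam p S₁ S₂ := S₂_mem_Tfam
  have mB : Lbv p ∈ Ufam p S₁ S₂ := Lbv_mem_Ufam
  have Y0 : 0 ≤ Y := (abs_nonneg _).trans (hu' _ mL)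
  have b : ∀ {x y : ℝ}, |x| ≤ Y → |y| ≤ X → |x * y| ≤ Y * X := fun hx hy => by
    rw [abs_mul]; exact mul_le_mul hx hy (abs_nonneg _) Y0
  have b1 := abs_le.1 (b (hu' _ mL) (hv _ mB))
  have b2 := abs_le.1 (b (hv' _ mL) (hu _ mB))
  have b3 := abs_le.1 (b (hu' _ m1) (hv _ (Tfam_subset_Ufam m1)))
  have b4 := abs_le.1 (b (hu' _ m2) (hv _ (Tfam_subset_Ufam m2)))
  rw [e, abs_le]
  constructor <;> linarith [b1.1, b1.2, b2.1, b2.2, b3.1, b3.2, b4.1, b4.2]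

lemma abs_Qtf_le (hr : 0 < rad p) (hf : SphFrame p S₁ S₂) {u v : Pt → ℝ} {X Y : ℝ}
    (hu : ∀ U ∈ Ufam p S₁ S₂, |dirD U u p| ≤ X) (hu' : ∀ U ∈ Tfam p S₁ S₂, |dirD U u p| ≤ Y)
    (hv : ∀ U ∈ Ufam p S₁ S₂, |dirD U v p| ≤ X) (hv' : ∀ U ∈ Tfam p S₁ S₂, |dirD U v p| ≤ Y)
    (α β : Fin 4) : |Qtf α β u v p| ≤ 27 * (Y * X) := by
  simp only [dirD_eq_cov] at hu hu' hv hv'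
  have eu := fun α => abs_coord_add_le hr hf (fun α => pd α u p) α hu'
  have ev := fun α => abs_coord_add_le hr hf (fun α => pd α v p) α hv'
  have fv := fun α => abs_coord_le hr hf (fun α => pd α v p) α hv
  have bu : ∀ α, |1/2 * ell p α * cov (fun α => pd α u p) (Lbv p)| ≤ 1/2 * X := fun α => by
    rw [mul_assoc, abs_mul, abs_mul, abs_of_pos (by norm_num : (0:ℝ) < 1/2)]
    exact mul_le_mul_of_nonneg_left
      ((mul_le_of_le_one_left (abs_nonneg _) (abs_ell_le p α)).trans (hu _ Lbv_mem_Ufam))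
      (by norm_num)
  have Y0 : 0 ≤ 3 * Y := (abs_nonneg _).trans (eu 0)
  have b : ∀ {x y B : ℝ}, |x| ≤ 3 * Y → |y| ≤ B → |x * y| ≤ 3 * Y * B := fun hx hy => by
    rw [abs_mul]; exact mul_le_mul hx hy (abs_nonneg _) Y0
  have c1 := abs_le.1 (b (eu α) (fv β))
  have c2 := abs_le.1 (b (eu β) (fv α))
  have c3 := abs_le.1 (b (ev β) (bu α))
  have c4 := abs_le.1 (b (ev α) (bu β))
  rw [Qtf, abs_le]
  constructor <;> linarith [c1.1, c1.2, c2.1, c2.2, c3.1, c3.2, c4.1, c4.2]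

lemma abs_dirD_Wcomp_le (hr : 0 < rad p) (hf : SphFrame p S₁ S₂) (h : Tsr) (ψ : Fin m → Pt → ℝ)
    {Ds : List Pt} {U : Pt} (hU : U ∈ Ds) (A : WIdx m) :
    |dirD U (Wcomp h ψ A) p| ≤
      16 * (dsemi h Ds (Ufam p S₁ S₂) (Ufam p S₁ S₂) p + kdsemi ψ Ds p) := by
  have h1 := kdsemi_nonneg ψ Ds p
  have h2 := dsemi_nonneg h Ds (Ufam p S₁ S₂) (Ufam p S₁ S₂) p
  rcases A with ⟨μ, ν⟩ | k
  · have := abs_dirT_le hr hf (π := h) hU μ ν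
    change |dirT h p U μ ν| ≤ _
    linarith
  · have := abs_dirD_le_kdsemi (ψ := ψ) (p := p) hU k
    change |dirD U (ψ k) p| ≤ _
    linarith

/-- A linear combination of null forms of the components of `W`. -/
def nullComb (a : WIdx m → WIdx m → ℝ) (b : WIdx m → WIdx m → Fin 4 → Fin 4 → ℝ) (h : Tsr)
    (ψ : Fin m → Pt → ℝ) (p : Pt) : ℝ :=
  ∑ A, ∑ B, (a A B * Q0f (Wcomp h ψ A) (Wcomp h ψ B) p
    + ∑ α, ∑ β, b A B α β * Qtf α β (Wcomp h ψ A) (Wcomp h ψ B) p)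

/-- The sum of the absolute values of the coefficients of a combination of null forms. -/
def nullCoefSum (a : WIdx m → WIdx m → ℝ) (b : WIdx m → WIdx m → Fin 4 → Fin 4 → ℝ) : ℝ :=
  ∑ A, ∑ B, (|a A B| + ∑ α, ∑ β, |b A B α β|)

lemma nullCoefSum_nonneg (a : WIdx m → WIdx m → ℝ) (b : WIdx m → WIdx m → Fin 4 → Fin 4 → ℝ) :
    0 ≤ nullCoefSum a b :=
  Finset.sum_nonneg fun _ _ => Finset.sum_nonneg fun _ _ => add_nonneg (abs_nonneg _)
    (Finset.sum_nonneg fun _ _ => Finset.sum_nonneg fun _ _ => abs_nonneg _)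

lemma abs_nullComb_le (a : WIdx m → WIdx m → ℝ) (b : WIdx m → WIdx m → Fin 4 → Fin 4 → ℝ)
    (hr : 0 < rad p) (hf : SphFrame p S₁ S₂) (h : Tsr) (ψ : Fin m → Pt → ℝ) :
    |nullComb a b h ψ p| ≤ nullCoefSum a b *
      (27 * (16 * dWbar h ψ S₁ S₂ p * (16 * dWn h ψ S₁ S₂ p))) := by
  have hU : ∀ A, ∀ U ∈ Ufam p S₁ S₂, |dirD U (Wcomp h ψ A) p| ≤ 16 * dWn h ψ S₁ S₂ p :=
    fun A U hU => abs_dirD_Wcomp_le hr hf h ψ hU A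
  have hT : ∀ A, ∀ U ∈ Tfam p S₁ S₂, |dirD U (Wcomp h ψ A) p| ≤ 16 * dWbar h ψ S₁ S₂ p :=
    fun A U hU => abs_dirD_Wcomp_le hr hf h ψ hU A
  have X0 := mul_nonneg (mul_nonneg (by norm_num : (0:ℝ) ≤ 16) (dWbar_nonneg h ψ S₁ S₂ p))
    (mul_nonneg (by norm_num : (0:ℝ) ≤ 16) (dWn_nonneg h ψ S₁ S₂ p))
  simp only [nullCoefSum, Finset.sum_mul, add_mul]
  refine (Finset.abs_sum_le_sum_abs _ _).trans (Finset.sum_le_sum fun A _ =>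
    (Finset.abs_sum_le_sum_abs _ _).trans (Finset.sum_le_sum fun B _ =>
      (abs_add_le _ _).trans (add_le_add ?_ ((Finset.abs_sum_le_sum_abs _ _).trans
        (Finset.sum_le_sum fun α _ => (Finset.abs_sum_le_sum_abs _ _).trans
          (Finset.sum_le_sum fun β _ => ?_))))))
  · rw [abs_mul]
    refine mul_le_mul_of_nonneg_left ?_ (abs_nonneg _)
    exact (abs_Q0f_le hr hf (hU A) (hT A) (hU B) (hT B)).trans
      (mul_le_mul_of_nonneg_right (by norm_num) X0)
  · rw [abs_mul]
    exact mul_le_mul_of_nonneg_left (abs_Qtf_le hr hf (hU A) (hT A) (hU B) (hT B) α β)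
      (abs_nonneg _)

/-- The estimate of the null-form part of the system. -/
lemma exists_semi_Qterm_le (S : GenSystem m) : ∃ C : ℝ, 0 ≤ C ∧
    ∀ (h : Tsr) (ψ : Fin m → Pt → ℝ) (p S₁ S₂ : Pt), 0 < rad p → SphFrame p S₁ S₂ →
      semi (fun μ ν => Qterm S h ψ μ ν p) (Ufam p S₁ S₂) (Ufam p S₁ S₂)
        + ∑ k, |Qkterm S h ψ k p| ≤ C * (dWbar h ψ S₁ S₂ p * dWn h ψ S₁ S₂ p) := by
  have h1 : 0 ≤ ∑ μ, ∑ ν, nullCoefSum (S.q0 μ ν) (S.qt μ ν) :=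
    Finset.sum_nonneg fun μ _ => Finset.sum_nonneg fun ν _ => nullCoefSum_nonneg _ _
  have h2 : 0 ≤ ∑ k, nullCoefSum (S.q0k k) (S.qtk k) :=
    Finset.sum_nonneg fun k _ => nullCoefSum_nonneg _ _
  refine ⟨(256 * (∑ μ, ∑ ν, nullCoefSum (S.q0 μ ν) (S.qt μ ν))
    + ∑ k, nullCoefSum (S.q0k k) (S.qtk k)) * 6912,
    mul_nonneg (add_nonneg (mul_nonneg (by norm_num) h1) h2) (by norm_num),
    fun h ψ p S₁ S₂ hr hf => ?_⟩
  have X0 : 0 ≤ 6912 * (dWbar h ψ S₁ S₂ p * dWn h ψ S₁ S₂ p) := mul_nonneg (by norm_num)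
    (mul_nonneg (dWbar_nonneg h ψ S₁ S₂ p) (dWn_nonneg h ψ S₁ S₂ p))
  have key : ∀ a b, |nullComb a b h ψ p| ≤
      nullCoefSum a b * (6912 * (dWbar h ψ S₁ S₂ p * dWn h ψ S₁ S₂ p)) := fun a b =>
    (abs_nullComb_le a b hr hf h ψ).trans (le_of_eq (by ring))
  have b1 : ∀ μ ν, |Qterm S h ψ μ ν p| ≤ (∑ μ, ∑ ν, nullCoefSum (S.q0 μ ν) (S.qt μ ν)) *
      (6912 * (dWbar h ψ S₁ S₂ p * dWn h ψ S₁ S₂ p)) := fun μ ν => by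
    refine (key (S.q0 μ ν) (S.qt μ ν)).trans (mul_le_mul_of_nonneg_right ?_ X0)
    exact (Finset.single_le_sum (f := fun ν => nullCoefSum (S.q0 μ ν) (S.qt μ ν))
      (fun _ _ => nullCoefSum_nonneg _ _) (Finset.mem_univ ν)).trans
      (Finset.single_le_sum (f := fun μ => ∑ ν, nullCoefSum (S.q0 μ ν) (S.qt μ ν))
        (fun _ _ => Finset.sum_nonneg fun _ _ => nullCoefSum_nonneg _ _) (Finset.mem_univ μ))
  have b2 : ∑ k, |Qkterm S h ψ k p| ≤ (∑ k, nullCoefSum (S.q0k k) (S.qtk k)) *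
      (6912 * (dWbar h ψ S₁ S₂ p * dWn h ψ S₁ S₂ p)) := by
    rw [Finset.sum_mul]
    exact Finset.sum_le_sum fun k _ => key (S.q0k k) (S.qtk k)
  have b3 := semi_Ufam_le hf b1
  linarith

end

/-! ### The estimates of `P` and `Q` -/

section

variable {p S₁ S₂ : Pt} {m : ℕ}

lemma Zsum_zero (F : List ZIdx → ℝ) : Zsum 0 F = F [] := by
  simp [Zsum]

lemma mainSum_zero (h : Tsr) (ψ : Fin m → Pt → ℝ) (S₁ S₂ p : Pt) :
    mainSum 0 h ψ S₁ S₂ p = dWG h ψ S₁ S₂ p ^ 2 + dWbar h ψ S₁ S₂ p * dWn h ψ S₁ S₂ p := by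
  have e1 : ZdWG 0 h ψ S₁ S₂ p = dWG h ψ S₁ S₂ p := Zsum_zero _
  have e2 : ZdWbar 0 h ψ S₁ S₂ p = dWbar h ψ S₁ S₂ p := Zsum_zero _
  have e3 : ZdWn 0 h ψ S₁ S₂ p = dWn h ψ S₁ S₂ p := Zsum_zero _
  simp only [mainSum, zero_add, Finset.sum_range_one, Nat.sub_zero, e1, e2, e3, pow_two]

lemma lowSum_zero_le (h : Tsr) (ψ : Fin m → Pt → ℝ) (S₁ S₂ p : Pt) :
    lowSum 0 h S₁ S₂ p ≤ Wn h ψ S₁ S₂ p * dWn h ψ S₁ S₂ p ^ 2 := by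
  have e1 : Zssemi 0 h (Ufam p S₁ S₂) (Ufam p S₁ S₂) p =
      semi (h p) (Ufam p S₁ S₂) (Ufam p S₁ S₂) := Zsum_zero _
  have e2 : Zdsemi 0 h (Ufam p S₁ S₂) (Ufam p S₁ S₂) (Ufam p S₁ S₂) p =
      dsemi h (Ufam p S₁ S₂) (Ufam p S₁ S₂) (Ufam p S₁ S₂) p := Zsum_zero _
  have e : lowSum 0 h S₁ S₂ p = semi (h p) (Ufam p S₁ S₂) (Ufam p S₁ S₂) *
      dsemi h (Ufam p S₁ S₂) (Ufam p S₁ S₂) (Ufam p S₁ S₂) p ^ 2 := by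
    simp only [lowSum, lowErr, quadErr, zero_add, Finset.sum_range_one, Nat.sub_zero, if_true,
      zero_le_one, e1, e2]
    ring
  have h1 : semi (h p) (Ufam p S₁ S₂) (Ufam p S₁ S₂) ≤ Wn h ψ S₁ S₂ p :=
    le_add_of_nonneg_right (Finset.sum_nonneg fun _ _ => abs_nonneg _)
  rw [e]
  exact mul_le_mul h1 (pow_le_pow_left₀ (dsemi_nonneg _ _ _ _ _) (dsemi_le_dWn h ψ S₁ S₂ p) 2)
    (sq_nonneg _) ((semi_nonneg _ _ _).trans h1)

/-- The estimate of all components of `P`. -/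
lemma exists_semi_PD_le (N : Fin m → ℝ) (NN : Fin m → Fin m → ℝ) :
    ∃ C : ℝ, 0 < C ∧ ∀ (h : Tsr) (ψ : Fin m → Pt → ℝ), SmW h ψ →
    (∀ p μ ν, h p μ ν = h p ν μ) → (∀ p, WaveGaugeAt h p) →
    ∀ p S₁ S₂ : Pt, 0 < rad p → SphFrame p S₁ S₂ →
      semi (PD N NN h h ψ ψ p) (Ufam p S₁ S₂) (Ufam p S₁ S₂) ≤
        C * (dWG h ψ S₁ S₂ p ^ 2 + dWbar h ψ S₁ S₂ p * dWn h ψ S₁ S₂ p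
          + Wn h ψ S₁ S₂ p * dWn h ψ S₁ S₂ p ^ 2) := by
  obtain ⟨c, c0, hc⟩ := exists_abs_Ziter_PD_le N NN 0 256
  have P0 := Pconst_pos N NN
  refine ⟨256 * (c + 48 * Pconst N NN), by positivity, fun h ψ H hs hg p S₁ S₂ hr hf => ?_⟩
  rw [mul_assoc]
  refine semi_Ufam_le hf fun μ ν => ?_
  have m0 := add_nonneg (sq_nonneg (dWG h ψ S₁ S₂ p))
    (mul_nonneg (dWbar_nonneg h ψ S₁ S₂ p) (dWn_nonneg h ψ S₁ S₂ p))
  have s0 : semi (h p) (Ufam p S₁ S₂) (Ufam p S₁ S₂) ≤ Wn h ψ S₁ S₂ p :=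
    le_add_of_nonneg_right (Finset.sum_nonneg fun _ _ => abs_nonneg _)
  have w0 := (semi_nonneg _ _ _).trans s0
  have n0 := mul_nonneg w0 (sq_nonneg (dWn h ψ S₁ S₂ p))
  rw [add_mul]
  rcases le_or_gt (Wn h ψ S₁ S₂ p) 1 with hW | hW
  · have hp : hnorm 0 h p ≤ 256 := by
      have e1 : Zssemi 0 h (Ufam p S₁ S₂) (Ufam p S₁ S₂) p =
        semi (h p) (Ufam p S₁ S₂) (Ufam p S₁ S₂) := Zsum_zero _
      have := hnorm_le hr hf 0 h
      rw [e1] at this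
      linarith
    refine (hc h ψ H hs hg p S₁ S₂ hr hf hp [] le_rfl μ ν).trans
      ((mul_le_mul_of_nonneg_left ?_ c0.le).trans
        (le_add_of_nonneg_right (mul_nonneg (by positivity) (add_nonneg m0 n0))))
    rw [mainSum_zero]
    exact add_le_add_right (lowSum_zero_le h ψ S₁ S₂ p) _
  · refine (abs_PD_le N NN hr hf hs ψ μ ν).trans
      ((mul_le_mul_of_nonneg_left ?_ (by positivity)).trans
        (le_add_of_nonneg_left (mul_nonneg c0.le (add_nonneg m0 n0))))
    exact (le_mul_of_one_le_left (sq_nonneg _) hW.le).trans (le_add_of_nonneg_left m0)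

/-- The estimate of `Z^I P`. -/
lemma exists_Zssemi_PD_le (N : Fin m → ℝ) (NN : Fin m → Fin m → ℝ) (k : ℕ) (C₀ : ℝ) :
    ∃ C : ℝ, 0 < C ∧ ∀ (h : Tsr) (ψ : Fin m → Pt → ℝ), SmW h ψ →
    (∀ p μ ν, h p μ ν = h p ν μ) → (∀ p, WaveGaugeAt h p) →
    ∀ p S₁ S₂ : Pt, 0 < rad p → SphFrame p S₁ S₂ → ZWn k h ψ S₁ S₂ p ≤ C₀ →
      Zssemi k (PD N NN h h ψ ψ) (Ufam p S₁ S₂) (Ufam p S₁ S₂) p ≤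
        C * (mainSum k h ψ S₁ S₂ p + lowSum k h S₁ S₂ p) := by
  obtain ⟨c, c0, hc⟩ := exists_abs_Ziter_PD_le N NN k (256 * C₀)
  have z0 : 0 < Zsum k fun _ => 1 :=
    one_pos.trans_le (le_Zsum (F := fun _ => (1 : ℝ)) (l := []) (fun _ => zero_le_one)
      (Nat.zero_le k))
  refine ⟨(Zsum k fun _ => 1) * (256 * c), by positivity,
    fun h ψ H hs hg p S₁ S₂ hr hf hp => ?_⟩
  have hw : Zssemi k h (Ufam p S₁ S₂) (Ufam p S₁ S₂) p ≤ ZWn k h ψ S₁ S₂ p :=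
    Zsum_le_Zsum fun _ _ => le_add_of_nonneg_right (Finset.sum_nonneg fun _ _ => abs_nonneg _)
  have hn : hnorm k h p ≤ 256 * C₀ :=
    (hnorm_le hr hf k h).trans (mul_le_mul_of_nonneg_left (hw.trans hp) (by norm_num))
  rw [mul_assoc, mul_assoc]
  exact Zsum_le_const_mul fun l hl =>
    semi_Ufam_le hf fun μ ν => hc h ψ H hs hg p S₁ S₂ hr hf hn l hl μ ν

end

/-- modified Corollary 9.7 of Lindblad–Rodnianski. -/
theorem stmt_8 (m : ℕ) (S : GenSystem m) :
    (∃ C : ℝ, 0 < C ∧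
      ∀ (h : Tsr) (ψ : Fin m → Pt → ℝ),
        (∀ μ ν, ContDiff ℝ (⊤ : ℕ∞) (fun p => h p μ ν)) → (∀ k, ContDiff ℝ (⊤ : ℕ∞) (ψ k)) →
        (∀ p μ ν, h p μ ν = h p ν μ) →
        (∀ p : Pt, WaveGaugeAt h p) →
        ∀ (p S₁ S₂ : Pt), 0 < rad p → SphFrame p S₁ S₂ →
          (semi (PD S.Nc S.NNc h h ψ ψ p) (Tfam p S₁ S₂) (Ufam p S₁ S₂) ≤
              C * (dWbar h ψ S₁ S₂ p * dWn h ψ S₁ S₂ p))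
          ∧ (semi (PD S.Nc S.NNc h h ψ ψ p) (Ufam p S₁ S₂) (Ufam p S₁ S₂) ≤
              C * (dWG h ψ S₁ S₂ p ^ 2 + dWbar h ψ S₁ S₂ p * dWn h ψ S₁ S₂ p
                + Wn h ψ S₁ S₂ p * dWn h ψ S₁ S₂ p ^ 2))
          ∧ (semi (fun μ ν => Qterm S h ψ μ ν p) (Ufam p S₁ S₂) (Ufam p S₁ S₂)
                + ∑ k, |Qkterm S h ψ k p| ≤
              C * (dWbar h ψ S₁ S₂ p * dWn h ψ S₁ S₂ p)))
    ∧ (∀ (k : ℕ) (C₀ : ℝ), 0 < C₀ →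
        ∃ C : ℝ, 0 < C ∧
          ∀ (h : Tsr) (ψ : Fin m → Pt → ℝ),
            (∀ μ ν, ContDiff ℝ (⊤ : ℕ∞) (fun p => h p μ ν)) → (∀ k', ContDiff ℝ (⊤ : ℕ∞) (ψ k')) →
            (∀ p μ ν, h p μ ν = h p ν μ) →
            (∀ p : Pt, WaveGaugeAt h p) →
            (∀ (p S₁ S₂ : Pt), SphFrame p S₁ S₂ → ZWn k h ψ S₁ S₂ p ≤ C₀) →
            ∀ (p S₁ S₂ : Pt), 0 < rad p → SphFrame p S₁ S₂ →
              Zssemi k (PD S.Nc S.NNc h h ψ ψ) (Ufam p S₁ S₂) (Ufam p S₁ S₂) p ≤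
                C * ((∑ j ∈ Finset.range (k+1), ∑ j' ∈ Finset.range (k+1-j),
                        (ZdWG j h ψ S₁ S₂ p * ZdWG j' h ψ S₁ S₂ p
                          + ZdWbar j h ψ S₁ S₂ p * ZdWn j' h ψ S₁ S₂ p))
                  + ∑ j ∈ Finset.range (k+1), ∑ j' ∈ Finset.range (k+1-j),
                      Zdsemi j' h (Ufam p S₁ S₂) (Ufam p S₁ S₂) (Ufam p S₁ S₂) p *
                        ((if j = 0 then 0 else
                            Zdsemi (j-1) h (Ufam p S₁ S₂) (Lfam p) (Tfam p S₁ S₂) p)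
                          + (if j ≤ 1 then 0 else
                              Zdsemi (j-2) h (Ufam p S₁ S₂) (Ufam p S₁ S₂) (Ufam p S₁ S₂) p)
                          + ∑ j₁ ∈ Finset.range (j+1), ∑ j₂ ∈ Finset.range (j+1-j₁),
                              Zssemi j₂ h (Ufam p S₁ S₂) (Ufam p S₁ S₂) p *
                                Zdsemi j₁ h (Ufam p S₁ S₂) (Ufam p S₁ S₂) (Ufam p S₁ S₂) p))) := by
  obtain ⟨c, c0, hc⟩ := exists_semi_PD_le S.Nc S.NNc
  obtain ⟨d, d0, hd⟩ := exists_semi_Qterm_le S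
  have P0 := Pconst_pos S.Nc S.NNc
  refine ⟨⟨36 * Pconst S.Nc S.NNc + c + d, by positivity,
    fun h ψ hh hψ hs hg p S₁ S₂ hr hf => ⟨?_, ?_, ?_⟩⟩, fun k C₀ _ => ?_⟩
  · have X0 := mul_nonneg (dWbar_nonneg h ψ S₁ S₂ p) (dWn_nonneg h ψ S₁ S₂ p)
    exact (semi_PD_Tfam_le S.Nc S.NNc hr hf hs ψ).trans
      (mul_le_mul_of_nonneg_right (by linarith) X0)
  · have X0 := mul_nonneg (dWbar_nonneg h ψ S₁ S₂ p) (dWn_nonneg h ψ S₁ S₂ p)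
    have w0 : 0 ≤ Wn h ψ S₁ S₂ p :=
      add_nonneg (semi_nonneg _ _ _) (Finset.sum_nonneg fun _ _ => abs_nonneg _)
    exact (hc h ψ ⟨hh, hψ⟩ hs hg p S₁ S₂ hr hf).trans
      (mul_le_mul_of_nonneg_right (by linarith) (by positivity))
  · have X0 := mul_nonneg (dWbar_nonneg h ψ S₁ S₂ p) (dWn_nonneg h ψ S₁ S₂ p)
    exact (hd h ψ p S₁ S₂ hr hf).trans (mul_le_mul_of_nonneg_right (by linarith) X0)
  · obtain ⟨e, e0, he⟩ := exists_Zssemi_PD_le S.Nc S.NNc k C₀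
    exact ⟨e, e0, fun h ψ hh hψ hs hg hW p S₁ S₂ hr hf =>
      he h ψ ⟨hh, hψ⟩ hs hg p S₁ S₂ hr hf (hW p S₁ S₂ hf)⟩

end LR
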